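/- Let q be a power of an odd prime p, let n be an even integer with 6 ≤ n ≤ 16, and let L = PSp_{2n}(q). Let G be a finite group with ω(G) = ω(L) that is not an almost simple group with socle isomorphic to L. Let K be the solvable radical of G (the largest solvable normal subgroup of G), and suppose there is an injective homomorphism from G/K into Aut(S) whose image contains Inn(S), where S = PSL_m(u) for an odd integer m and a prime power u > 3 whose characteristic v is different from p. Then k_{2n}(q) divides k_m(u). -/

import Mathlib

/-- The spectrum of a group `G`: the set of element orders of `G`. -/
def elementOrders (G : Type*) [Monoid G] : Set ℕ := {n | ∃ g : G, orderOf g = n}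

/-- `PSL n F`: the projective special linear group over `F`,
i.e. the quotient of `SL_n(F)` by its center. -/
abbrev PSL (n : ℕ) (F : Type*) [Field F] :=
  Matrix.SpecialLinearGroup (Fin n) F ⧸
    Subgroup.center (Matrix.SpecialLinearGroup (Fin n) F)

/-- `PSp n F`: the projective symplectic group, i.e. the quotient of the
symplectic group `Sp_{2n}(F)` (2n×2n matrices preserving the standard symplectic
form) by its center. -/
abbrev PSp (n : ℕ) (F : Type*) [Field F] :=
  Matrix.symplecticGroup (Fin n) F ⧸
    Subgroup.center (Matrix.symplecticGroup (Fin n) F)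

/-- `G` is an almost simple group with socle isomorphic to `L`: there is an
injective homomorphism `ι : G → Aut L` whose image contains the inner
automorphisms `Inn L`. -/
def IsAlmostSimpleWithSocle (G : Type*) [Group G] (L : Type*) [Group L] : Prop :=
  ∃ ι : G →* MulAut L, Function.Injective ι ∧ (MulAut.conj (G := L)).range ≤ ι.range

/-- `kpart i q`: the product, with multiplicities, of all primitive prime
divisors of `q^i - 1`, i.e. of the primes `r` such that the multiplicative
order of `q` modulo `r` equals `i`. -/
noncomputable def kpart (i q : ℕ) : ℕ :=
  (q ^ i - 1).factorization.prod fun r m =>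
    if orderOf ((q : ZMod r)) = i then r ^ m else 1

section Arithmetic

lemma kpart_factorization (i q : ℕ) (r : ℕ) :
    (kpart i q).factorization r =
      if orderOf (q : ZMod r) = i then (q ^ i - 1).factorization r else 0 := by
  classical
  have h : kpart i q = ((q ^ i - 1).factorization.filter
      (fun r => orderOf (q : ZMod r) = i)).prod (· ^ ·) := by
    rw [Finsupp.prod_filter_index, kpart, Finsupp.prod, Finsupp.support_filter, Finset.prod_filter]
  rw [h, Nat.prod_pow_factorization_eq_self, Finsupp.filter_apply]
  intro r hr
  rw [Finsupp.support_filter, Finset.mem_filter, Nat.support_factorization] at hr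
  exact Nat.prime_of_mem_primeFactors hr.1

lemma kpart_ne_zero (i q : ℕ) : kpart i q ≠ 0 := by
  unfold kpart
  rw [Finsupp.prod, Finset.prod_ne_zero_iff]
  intro r hr
  have := (Nat.prime_of_mem_primeFactors (Nat.support_factorization _ ▸ hr)).ne_zero
  split_ifs
  · positivity
  · simp

lemma dvd_pow_sub_one_iff {q i r : ℕ} (hq : q ≠ 0) :
    r ∣ q ^ i - 1 ↔ (q : ZMod r) ^ i = 1 := by
  rw [← ZMod.natCast_eq_zero_iff, Nat.cast_sub (Nat.one_le_iff_ne_zero.2 (pow_ne_zero _ hq))]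
  push_cast
  rw [sub_eq_zero]

lemma dvd_pow_add_one_iff {q i r : ℕ} :
    r ∣ q ^ i + 1 ↔ (q : ZMod r) ^ i = -1 := by
  rw [← ZMod.natCast_eq_zero_iff]
  push_cast
  rw [eq_neg_iff_add_eq_zero]

lemma pow_sub_one_ne_zero' {q i : ℕ} (hq : 2 ≤ q) (hi : i ≠ 0) : q ^ i - 1 ≠ 0 := by
  have := Nat.one_lt_pow hi hq
  omega

lemma prime_dvd_kpart_iff {i q r : ℕ} (hq : 2 ≤ q) (hi : i ≠ 0) (hr : r.Prime) :
    r ∣ kpart i q ↔ orderOf (q : ZMod r) = i := by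
  rw [hr.dvd_iff_one_le_factorization (kpart_ne_zero _ _), kpart_factorization]
  split_ifs with h
  · rw [← hr.dvd_iff_one_le_factorization (pow_sub_one_ne_zero' hq hi),
      dvd_pow_sub_one_iff (by omega)]
    simp only [h, iff_true]
    rw [← h, pow_orderOf_eq_one]
  · simp [h]

lemma dvd_kpart_of_forall {i q N : ℕ} (hq : 2 ≤ q) (hi : i ≠ 0) (hN : N ∣ q ^ i - 1)
    (h : ∀ r : ℕ, r.Prime → r ∣ N → orderOf (q : ZMod r) = i) : N ∣ kpart i q := by
  have h0 := pow_sub_one_ne_zero' hq hi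
  have hN0 : N ≠ 0 := fun h => h0 (by simpa [h] using hN)
  rw [← Nat.factorization_le_iff_dvd hN0 (kpart_ne_zero _ _)]
  intro r
  rw [kpart_factorization]
  by_cases hr : r.Prime
  · by_cases hrN : r ∣ N
    · rw [if_pos (h r hr hrN)]
      exact (Nat.factorization_le_iff_dvd hN0 h0).2 hN r
    · rw [Nat.factorization_eq_zero_of_not_dvd hrN]; exact Nat.zero_le _
  · rw [Nat.factorization_eq_zero_of_not_prime _ hr]; exact Nat.zero_le _

lemma kpart_dvd_of_forall {i q N : ℕ}
    (h : ∀ r : ℕ, r.Prime → orderOf (q : ZMod r) = i →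
      r ^ (q ^ i - 1).factorization r ∣ N) : kpart i q ∣ N := by
  rcases eq_or_ne N 0 with rfl | hN
  · simp
  rw [← Nat.factorization_le_iff_dvd (kpart_ne_zero _ _) hN]
  intro r
  rw [kpart_factorization]
  split_ifs with hr
  · by_cases hp : r.Prime
    · exact (hp.pow_dvd_iff_le_factorization hN).1 (h r hp hr)
    · rw [Nat.factorization_eq_zero_of_not_prime _ hp]; exact Nat.zero_le _
  · exact Nat.zero_le _

lemma kpart_dvd_kpart {i q j u : ℕ} (hi : i ≠ 0) (hq : 2 ≤ q) (hj : j ≠ 0) (hu : 2 ≤ u)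
    (h : ∀ r : ℕ, r.Prime → orderOf (q : ZMod r) = i →
      orderOf (u : ZMod r) = j ∧ r ^ (q ^ i - 1).factorization r ∣ u ^ j - 1) :
    kpart i q ∣ kpart j u := by
  refine dvd_kpart_of_forall hu hj (kpart_dvd_of_forall fun r hr hri => (h r hr hri).2) ?_
  intro r hr hrd
  exact (h r hr ((prime_dvd_kpart_iff hq hi hr).1 hrd)).1

lemma pow_eq_neg_one_of_orderOf {K : Type*} [CommRing K] [IsDomain K] {x : K} {n : ℕ} (hn : n ≠ 0)
    (h : orderOf x = 2 * n) : x ^ n = -1 := by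
  have h1 : x ^ n * x ^ n = 1 := by
    rw [← pow_add, ← two_mul, ← h, pow_orderOf_eq_one]
  rcases mul_self_eq_one_iff.1 h1 with h2 | h2
  · have := Nat.le_of_dvd (by omega) (orderOf_dvd_of_pow_eq_one h2)
    omega
  · exact h2

/-- A prime modulo which `q` has order `2 * n` is congruent to `1` modulo `2 * n`. -/
lemma dvd_pred_of_orderOf {q n r : ℕ} (hr : r.Prime) (hn : n ≠ 0)
    (h : orderOf (q : ZMod r) = n) : n ∣ r - 1 := by
  have := Fact.mk hr
  rw [← h]
  apply orderOf_dvd_of_pow_eq_one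
  apply ZMod.pow_card_sub_one_eq_one
  intro h0
  rw [h0, orderOf_zero] at h
  exact hn h.symm

lemma odd_half_pow_add_one {q n : ℕ} (hq : Odd q) (hn : Even n) : Odd ((q ^ n + 1) / 2) := by
  obtain ⟨k, rfl⟩ := hq
  obtain ⟨j, rfl⟩ := hn
  have h1 : Odd ((2 * k + 1) ^ j) := Odd.pow ⟨k, rfl⟩
  obtain ⟨b, hb⟩ := h1
  rw [pow_add, hb]
  refine ⟨b * (b + 1), ?_⟩
  have : (2 * b + 1) * (2 * b + 1) + 1 = 2 * (2 * (b * (b + 1)) + 1) := by ring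
  rw [this, Nat.mul_div_cancel_left _ (by norm_num)]

lemma two_mul_half_pow_add_one {q n : ℕ} (hq : Odd q) : 2 * ((q ^ n + 1) / 2) = q ^ n + 1 := by
  obtain ⟨b, hb⟩ := hq.pow (n := n)
  rw [hb]; omega

lemma pow_factorization_dvd_half {q n r : ℕ} (hn : n ≠ 0) (hqo : Odd q) (hq : 2 ≤ q)
    (hr : r.Prime) (ho : orderOf (q : ZMod r) = 2 * n) :
    r ^ (q ^ (2 * n) - 1).factorization r ∣ (q ^ n + 1) / 2 := by
  have := Fact.mk hr
  have hd := dvd_pred_of_orderOf hr (by omega) ho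
  have hr2 : r ≠ 2 := by
    rintro rfl
    have := Nat.le_of_dvd (by norm_num) hd
    omega
  have h1 : q ^ (2 * n) - 1 = (q ^ n - 1) * (q ^ n + 1) := by
    have := Nat.one_le_pow n q (by omega)
    zify [this, Nat.one_le_pow (2 * n) q (by omega)]
    ring
  have hnd : ¬ r ∣ q ^ n - 1 := by
    rw [dvd_pow_sub_one_iff (by omega)]
    intro h
    have := Nat.le_of_dvd (by omega) (ho ▸ orderOf_dvd_of_pow_eq_one h)
    omega
  have h2 : r ^ (q ^ (2 * n) - 1).factorization r ∣ q ^ n + 1 := by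
    have : (r ^ (q ^ (2 * n) - 1).factorization r).Coprime (q ^ n - 1) :=
      Nat.Coprime.pow_left _ ((hr.coprime_iff_not_dvd).2 hnd)
    refine this.dvd_of_dvd_mul_left (n := q ^ n + 1) ?_
    rw [← h1]
    exact Nat.ordProj_dvd _ _
  rw [← two_mul_half_pow_add_one hqo] at h2
  refine Nat.Coprime.dvd_of_dvd_mul_left (Nat.Coprime.pow_left _ ?_) h2
  exact (Nat.coprime_primes hr Nat.prime_two).2 hr2

lemma kpart_dvd_half {q n : ℕ} (hn : n ≠ 0) (hqo : Odd q) (hq : 2 ≤ q) :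
    kpart (2 * n) q ∣ (q ^ n + 1) / 2 :=
  kpart_dvd_of_forall fun _ hr ho => pow_factorization_dvd_half hn hqo hq hr ho

lemma orderOf_eq_two_mul_of_pow_ne_one {r q n : ℕ} (hr : r.Prime) (hn : n ≠ 0)
    (h1 : (q : ZMod r) ^ n = -1) (hr2 : r ≠ 2)
    (h2 : ∀ p : ℕ, p.Prime → p ∣ n → p ≠ 2 → (q : ZMod r) ^ (2 * n / p) ≠ 1) :
    orderOf (q : ZMod r) = 2 * n := by
  have := Fact.mk hr
  apply orderOf_eq_of_pow_and_pow_div_prime (by omega)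
  · rw [two_mul, pow_add, h1]; ring
  · intro p hp hpn
    rcases eq_or_ne p 2 with rfl | hp2
    · rw [Nat.mul_div_cancel_left _ (by norm_num), h1]
      have : Fact (2 < r) := ⟨by have := hr.two_le; omega⟩
      exact ZMod.neg_one_ne_one
    · refine h2 p hp ?_ hp2
      rcases (hp.dvd_mul).1 hpn with h | h
      · exact absurd ((Nat.prime_dvd_prime_iff_eq hp Nat.prime_two).1 h) hp2
      · exact h

end Arithmetic

section Bounds

lemma kpart_bound_of_factor {q n c P W : ℕ} (hn : n ≠ 0) (hqo : Odd q) (hq : 2 ≤ q)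
    (hP : P * (2 * W) = q ^ n + 1) (hdvd : P ∣ c * kpart (2 * n) q) (hc : c ≠ 0)
    (hle : 5 * c ^ 3 * (2 * W) ^ 2 ≤ 16 * P) (h73 : 73 * c ≤ P) :
    ∃ B, kpart (2 * n) q * B = (q ^ n + 1) / 2 ∧ 5 * B ^ 2 ≤ 4 * kpart (2 * n) q ∧
      73 ≤ kpart (2 * n) q := by
  obtain ⟨B, hB⟩ := kpart_dvd_half hn hqo hq
  refine ⟨B, hB.symm, ?_⟩
  have h0 : 0 < kpart (2 * n) q := Nat.pos_of_ne_zero (kpart_ne_zero _ _)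
  set κ := kpart (2 * n) q
  have hPW : κ * B = P * W := by
    rw [← hB]
    have := two_mul_half_pow_add_one (n := n) hqo
    rw [← hP] at this
    have h2 : 2 * ((q ^ n + 1) / 2) = 2 * (P * W) := by rw [← hP, this]; ring
    omega
  have hPpos : 0 < P := by omega
  have hc' : 0 < c := Nat.pos_of_ne_zero hc
  have hle1 : P ≤ c * κ := Nat.le_of_dvd (by positivity) hdvd
  have hBle : B ≤ c * W := by
    have h1 : P * B ≤ P * (c * W) := by
      calc P * B ≤ (c * κ) * B := Nat.mul_le_mul_right _ hle1
        _ = P * (c * W) := by rw [mul_assoc, hPW]; ring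
    exact Nat.le_of_mul_le_mul_left h1 hPpos
  constructor
  · have h1 : c * (5 * B ^ 2) ≤ c * (4 * κ) := by
      calc c * (5 * B ^ 2) ≤ c * (5 * (c * W) ^ 2) := by gcongr
        _ = 5 * c ^ 3 * W ^ 2 := by ring
        _ ≤ 4 * P := by nlinarith
        _ ≤ 4 * (c * κ) := by gcongr
        _ = c * (4 * κ) := by ring
    exact Nat.le_of_mul_le_mul_left h1 hc'
  · have h1 : c * 73 ≤ c * κ := by linarith
    exact Nat.le_of_mul_le_mul_left h1 hc'

lemma ne_two_of_dvd_odd {r N : ℕ} (hr : r ∣ N) (hN : Odd N) : r ≠ 2 := by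
  rintro rfl
  exact (Nat.not_even_iff_odd.2 hN) (even_iff_two_dvd.2 hr)

lemma prime_eq_of_dvd_two_pow_mul {p n : ℕ} (hp : p.Prime) (h : p ∣ n) (h2 : p ≠ 2)
    {a b : ℕ} {s : ℕ} (hs : s.Prime) (hn : n = 2 ^ a * s ^ b) : p = s := by
  rw [hn] at h
  rcases (hp.dvd_mul).1 h with h | h
  · exact absurd ((Nat.prime_dvd_prime_iff_eq hp Nat.prime_two).1 (hp.dvd_of_dvd_pow h)) h2
  · exact (Nat.prime_dvd_prime_iff_eq hp hs).1 (hp.dvd_of_dvd_pow h)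

lemma kpart_bound_two_pow {q n a : ℕ} (hqo : Odd q) (hq : 3 ≤ q) (hn : n = 2 ^ a) (h8 : 8 ≤ n) :
    ∃ B, kpart (2 * n) q * B = (q ^ n + 1) / 2 ∧ 5 * B ^ 2 ≤ 4 * kpart (2 * n) q ∧
      73 ≤ kpart (2 * n) q := by
  have ha : a ≠ 0 := by rintro rfl; simp at hn; omega
  have hne : Even n := by rw [hn]; exact (Nat.even_pow.2 ⟨even_two, ha⟩)
  have h2 := two_mul_half_pow_add_one (n := n) hqo
  have hbig : 3 ^ 8 ≤ q ^ n := (Nat.pow_le_pow_left hq 8).trans (Nat.pow_le_pow_right (by omega) h8)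
  refine kpart_bound_of_factor (c := 1) (P := (q ^ n + 1) / 2) (W := 1) (by omega) hqo (by omega)
    (by omega) ?_ one_ne_zero (by omega) (by omega)
  rw [one_mul]
  refine dvd_kpart_of_forall (by omega) (by omega) ?_ ?_
  · have h1 : q ^ (2 * n) - 1 = (q ^ n - 1) * (q ^ n + 1) := by
      have := Nat.one_le_pow n q (by omega)
      zify [this, Nat.one_le_pow (2 * n) q (by omega)]
      ring
    rw [h1]
    exact (Dvd.intro_left 2 h2).trans (Dvd.intro_left _ rfl)
  · intro r hr hd
    refine orderOf_eq_two_mul_of_pow_ne_one hr (by omega) ?_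
      (ne_two_of_dvd_odd hd (odd_half_pow_add_one hqo hne)) ?_
    · rw [← dvd_pow_add_one_iff, ← h2]
      exact hd.trans (Dvd.intro_left _ rfl)
    · intro p hp hpn hp2
      rw [hn] at hpn
      exact absurd ((Nat.prime_dvd_prime_iff_eq hp Nat.prime_two).1 (hp.dvd_of_dvd_pow hpn)) hp2

/-- Common set-up for `n = 2 ^ a * s` where `P` is the cyclotomic factor of `q ^ n + 1`. -/
lemma dvd_kpart_of_factor {q n a s P W : ℕ} (hq : 3 ≤ q) (hs : s.Prime) (hn : n = 2 ^ a * s)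
    (hP : P * W = q ^ n + 1) (hodd : Odd P)
    (h : ∀ r : ℕ, r.Prime → r ∣ P → (q : ZMod r) ^ n = -1 → (q : ZMod r) ^ (2 * n / s) = 1 → False) :
    P ∣ kpart (2 * n) q := by
  have hn0 : n ≠ 0 := by rw [hn]; exact mul_ne_zero (by positivity) hs.ne_zero
  refine dvd_kpart_of_forall (by omega) (by omega) ?_ ?_
  · have h1 : q ^ (2 * n) - 1 = (q ^ n - 1) * (q ^ n + 1) := by
      have := Nat.one_le_pow n q (by omega)
      zify [this, Nat.one_le_pow (2 * n) q (by omega)]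
      ring
    rw [h1, ← hP]
    exact (Dvd.intro _ rfl).trans (Dvd.intro_left _ rfl)
  · intro r hr hd
    have h1 : (q : ZMod r) ^ n = -1 := by
      rw [← dvd_pow_add_one_iff, ← hP]; exact hd.trans (Dvd.intro _ rfl)
    refine orderOf_eq_two_mul_of_pow_ne_one hr hn0 h1 (ne_two_of_dvd_odd hd hodd) ?_
    intro p hp hpn hp2
    have : p = s := prime_eq_of_dvd_two_pow_mul (a := a) (b := 1) hp hpn hp2 hs (by rw [hn, pow_one])
    subst this
    exact fun h2 => h r hr hd h1 h2

lemma kpart_bound_three {q n a : ℕ} (hqo : Odd q) (hq : 3 ≤ q) (ha : a ≠ 0) (hn : n = 2 ^ a * 3) :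
    ∃ B, kpart (2 * n) q * B = (q ^ n + 1) / 2 ∧ 5 * B ^ 2 ≤ 4 * kpart (2 * n) q ∧
      73 ≤ kpart (2 * n) q := by
  obtain ⟨t, ht⟩ := hqo.pow (n := 2 ^ a)
  have hqn : q ^ n = (2 * t + 1) ^ 3 := by rw [hn, pow_mul, ht]
  have h9 : 9 ≤ 2 * t + 1 := by
    rw [← ht]
    calc 9 = 3 ^ 2 := by norm_num
      _ ≤ q ^ 2 := Nat.pow_le_pow_left hq 2
      _ ≤ q ^ (2 ^ a) := Nat.pow_le_pow_right (by omega) (by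
        calc 2 = 2 ^ 1 := rfl
          _ ≤ 2 ^ a := Nat.pow_le_pow_right (by omega) (by omega))
  have hP : (4 * t ^ 2 + 2 * t + 1) * (2 * (t + 1)) = q ^ n + 1 := by rw [hqn]; ring
  refine kpart_bound_of_factor (c := 1) (by rw [hn]; positivity) hqo (by omega) hP ?_ one_ne_zero
    (by nlinarith) (by nlinarith)
  rw [one_mul]
  refine dvd_kpart_of_factor hq Nat.prime_three hn hP ⟨2 * t ^ 2 + t, by ring⟩ ?_
  intro r hr hd _ h1
  have h2 : 2 * n / 3 = 2 ^ a * 2 := by rw [hn]; omega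
  rw [h2, pow_mul, ← Nat.cast_pow, ht] at h1
  have hd0 := (ZMod.natCast_eq_zero_iff _ _).2 hd
  push_cast at h1 hd0
  have h3 : ((3 : ℕ) : ZMod r) = 0 := by
    push_cast; linear_combination h1 - (2 * t + 3 : ZMod r) * (h1 - hd0)
  have hr3 := (Nat.prime_dvd_prime_iff_eq hr Nat.prime_three).1 ((ZMod.natCast_eq_zero_iff _ _).1 h3)
  subst hr3
  obtain ⟨b, rfl⟩ := Nat.exists_eq_succ_of_ne_zero ha
  have hsq : ((q : ZMod 3) ^ 2 ^ b) ^ 2 = 2 * t + 1 := by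
    rw [← pow_mul, ← pow_succ]; exact_mod_cast congrArg (Nat.cast : ℕ → ZMod 3) ht
  revert hd0 hsq
  generalize (t : ZMod 3) = x
  generalize (q : ZMod 3) ^ 2 ^ b = y
  revert x y
  decide

lemma kpart_bound_ten {q : ℕ} (hqo : Odd q) (hq : 3 ≤ q) :
    ∃ B, kpart (2 * 10) q * B = (q ^ 10 + 1) / 2 ∧ 5 * B ^ 2 ≤ 4 * kpart (2 * 10) q ∧
      73 ≤ kpart (2 * 10) q := by
  obtain ⟨t, ht⟩ := hqo.pow (n := 2)
  have hqn : q ^ 10 = (2 * t + 1) ^ 5 := by rw [← ht, ← pow_mul]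
  have h9 : 9 ≤ 2 * t + 1 := by
    rw [← ht]
    exact Nat.pow_le_pow_left hq 2
  have h4 : 4 ≤ t := by omega
  set P := 16 * t ^ 4 + 24 * t ^ 3 + 16 * t ^ 2 + 4 * t + 1 with hPdef
  have hP : P * (2 * (t + 1)) = q ^ 10 + 1 := by rw [hqn, hPdef]; ring
  have key : P ∣ 5 * kpart (2 * 10) q := by
    have hPx : ∀ r : ℕ, r ∣ P → (16 * t ^ 4 + 24 * t ^ 3 + 16 * t ^ 2 + 4 * t + 1 : ZMod r) = 0 := by
      intro r hd
      have := (ZMod.natCast_eq_zero_iff _ _).2 hd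
      rw [hPdef] at this
      exact_mod_cast this
    have hfive : ∀ r : ℕ, r.Prime → r ∣ P → (q : ZMod r) ^ 10 = -1 →
        (q : ZMod r) ^ (2 * 10 / 5) = 1 → r = 5 := by
      intro r hr hd h1 h2
      have hd0 := hPx r hd
      have h2' : ((q : ZMod r) ^ 2) ^ 2 = 1 := by rw [← pow_mul]; exact h2
      have h1' : ((q : ZMod r) ^ 2) ^ 5 = -1 := by rw [← pow_mul]; exact h1
      have hq2 : (q : ZMod r) ^ 2 = 2 * t + 1 := by
        exact_mod_cast congrArg (Nat.cast : ℕ → ZMod r) ht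
      rw [hq2] at h1' h2'
      have hx : (2 * t + 1 : ZMod r) = -1 := by
        linear_combination h1' - ((2 * t + 1) ^ 3 + (2 * t + 1)) * h2'
      have h5 : ((5 : ℕ) : ZMod r) = 0 := by
        push_cast
        linear_combination hd0 - ((2 * t + 1) ^ 3 - 2 * (2 * t + 1) ^ 2 + 3 * (2 * t + 1) - 4) * hx
      exact (Nat.prime_dvd_prime_iff_eq hr Nat.prime_five).1 ((ZMod.natCast_eq_zero_iff _ _).1 h5)
    have hPodd : Odd P := ⟨8 * t ^ 4 + 12 * t ^ 3 + 8 * t ^ 2 + 2 * t, by rw [hPdef]; ring⟩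
    by_cases h5 : 5 ∣ P
    · obtain ⟨P', hP'⟩ := h5
      rw [hP']
      refine Nat.mul_dvd_mul_left 5 ?_
      have h25 : ¬ 5 ∣ P' := by
        rintro ⟨c, rfl⟩
        have h25 : 25 ∣ P := ⟨c, by rw [hP']; ring⟩
        have := hPx 25 h25
        revert this
        generalize (t : ZMod 25) = x
        revert x
        decide
      refine dvd_kpart_of_factor (n := 10) (a := 1) (W := 5 * (2 * (t + 1))) hq Nat.prime_five rfl
        (by rw [← hP, hP']; ring) ?_ ?_
      · rw [hP'] at hPodd
        exact (Nat.odd_mul.1 hPodd).2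
      · intro r hr hd h1 h2
        have := hfive r hr (hP' ▸ hd.trans (Dvd.intro_left _ rfl)) h1 h2
        subst this
        exact h25 hd
    · refine Dvd.dvd.mul_left ?_ 5
      refine dvd_kpart_of_factor (n := 10) (a := 1) hq Nat.prime_five rfl hP hPodd ?_
      intro r hr hd h1 h2
      have := hfive r hr hd h1 h2
      subst this
      exact h5 hd
  have e3 : t ^ 3 ≥ 4 * t ^ 2 := by nlinarith
  have e4 : t ^ 4 ≥ 16 * t ^ 2 := by nlinarith
  refine kpart_bound_of_factor (c := 5) (by norm_num) hqo (by omega) hP key (by norm_num) ?_ ?_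
  · rw [hPdef]; nlinarith
  · rw [hPdef]; nlinarith

lemma kpart_bound_fourteen {q : ℕ} (hqo : Odd q) (hq : 3 ≤ q) :
    ∃ B, kpart (2 * 14) q * B = (q ^ 14 + 1) / 2 ∧ 5 * B ^ 2 ≤ 4 * kpart (2 * 14) q ∧
      73 ≤ kpart (2 * 14) q := by
  obtain ⟨t, ht⟩ := hqo.pow (n := 2)
  have hqn : q ^ 14 = (2 * t + 1) ^ 7 := by rw [← ht, ← pow_mul]
  have h9 : 9 ≤ 2 * t + 1 := by
    rw [← ht]
    exact Nat.pow_le_pow_left hq 2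
  have h4 : 4 ≤ t := by omega
  set P := 64 * t ^ 6 + 160 * t ^ 5 + 176 * t ^ 4 + 104 * t ^ 3 + 36 * t ^ 2 + 6 * t + 1 with hPdef
  have hP : P * (2 * (t + 1)) = q ^ 14 + 1 := by rw [hqn, hPdef]; ring
  have e3 : t ^ 3 ≥ 4 * t ^ 2 := by nlinarith
  have e4 : t ^ 4 ≥ 16 * t ^ 2 := by nlinarith
  refine kpart_bound_of_factor (c := 1) (by norm_num) hqo (by omega) hP ?_ (by norm_num) ?_ ?_
  · rw [one_mul]
    refine dvd_kpart_of_factor (n := 14) (a := 1) hq (s := 7) (by norm_num) rfl hP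
      ⟨32 * t ^ 6 + 80 * t ^ 5 + 88 * t ^ 4 + 52 * t ^ 3 + 18 * t ^ 2 + 3 * t, by rw [hPdef]; ring⟩ ?_
    intro r hr hd h1 h2
    have hd0 := (ZMod.natCast_eq_zero_iff _ _).2 hd
    rw [hPdef] at hd0
    push_cast at hd0
    have h2' : ((q : ZMod r) ^ 2) ^ 2 = 1 := by rw [← pow_mul]; exact h2
    have h1' : ((q : ZMod r) ^ 2) ^ 7 = -1 := by rw [← pow_mul]; exact h1
    have hq2 : (q : ZMod r) ^ 2 = 2 * t + 1 := by
      exact_mod_cast congrArg (Nat.cast : ℕ → ZMod r) ht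
    rw [hq2] at h1' h2'
    have hx : (2 * t + 1 : ZMod r) = -1 := by
      linear_combination h1' - ((2 * t + 1) ^ 5 + (2 * t + 1) ^ 3 + (2 * t + 1)) * h2'
    have h7 : ((7 : ℕ) : ZMod r) = 0 := by
      push_cast
      linear_combination hd0 - ((2 * t + 1) ^ 5 - 2 * (2 * t + 1) ^ 4 + 3 * (2 * t + 1) ^ 3
        - 4 * (2 * t + 1) ^ 2 + 5 * (2 * t + 1) - 6) * hx
    have hr7 := (Nat.prime_dvd_prime_iff_eq hr (by norm_num : Nat.Prime 7)).1
      ((ZMod.natCast_eq_zero_iff _ _).1 h7)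
    subst hr7
    rw [hx] at hq2
    revert hq2
    generalize (q : ZMod 7) = x
    revert x
    decide
  · rw [hPdef]; nlinarith [Nat.zero_le (t ^ 5), Nat.zero_le (t ^ 6)]
  · rw [hPdef]; nlinarith [Nat.zero_le (t ^ 5), Nat.zero_le (t ^ 6)]

lemma kpart_bound {q n : ℕ} (hqo : Odd q) (hq : 3 ≤ q) (hn1 : 6 ≤ n) (hn2 : n ≤ 16)
    (hn : Even n) :
    ∃ B, kpart (2 * n) q * B = (q ^ n + 1) / 2 ∧ 5 * B ^ 2 ≤ 4 * kpart (2 * n) q ∧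
      73 ≤ kpart (2 * n) q := by
  obtain ⟨j, rfl⟩ := hn
  have h1 : 3 ≤ j := by omega
  have h2 : j ≤ 8 := by omega
  interval_cases j
  · exact kpart_bound_three (a := 1) hqo hq (by norm_num) rfl
  · exact kpart_bound_two_pow (a := 3) hqo hq rfl (by norm_num)
  · exact kpart_bound_ten hqo hq
  · exact kpart_bound_three (a := 2) hqo hq (by norm_num) rfl
  · exact kpart_bound_fourteen hqo hq
  · exact kpart_bound_two_pow (a := 4) hqo hq rfl (by norm_num)

end Bounds

section TwoGroups

lemma IsPGroup.exists_mem_center_of_normal {p : ℕ} [Fact p.Prime] {P : Type*} [Group P] [Finite P]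
    (hP : IsPGroup p P) {N : Subgroup P} [N.Normal] (hN : N ≠ ⊥) :
    ∃ c ∈ N, c ≠ 1 ∧ ∀ g : P, g * c = c * g := by
  have hnt : Nontrivial N := (Subgroup.nontrivial_iff_ne_bot N).2 hN
  have hd : p ∣ Nat.card N := by
    obtain ⟨k, hk, h⟩ := ((hP.to_subgroup N).nontrivial_iff_card).1 hnt
    rw [h]; exact dvd_pow_self _ (by omega)
  have h1 : (1 : N) ∈ MulAction.fixedPoints (ConjAct P) N := by
    intro g; ext; simp
  obtain ⟨b, hb, hb1⟩ := (hP.of_equiv ConjAct.toConjAct).exists_fixed_point_of_prime_dvd_card_of_fixed_point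
    N hd h1
  refine ⟨b, b.2, fun h => hb1 (Subtype.ext h.symm), fun g => ?_⟩
  have := congrArg Subtype.val (hb (ConjAct.toConjAct g))
  rw [ConjAct.Subgroup.val_conj_smul, ConjAct.toConjAct_smul] at this
  rw [← mul_inv_eq_iff_eq_mul]
  exact this

lemma IsPGroup.exists_normal_selfCentralizing {p : ℕ} [Fact p.Prime] {P : Type*} [Group P]
    [Finite P] (hP : IsPGroup p P) :
    ∃ A : Subgroup P, A.Normal ∧ (∀ x ∈ A, ∀ y ∈ A, x * y = y * x) ∧
      ∀ g, (∀ x ∈ A, x * g = g * x) → g ∈ A := by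
  obtain ⟨A, ⟨hAn, hAc⟩, hmax⟩ := (Set.toFinite {A : Subgroup P | A.Normal ∧
    ∀ x ∈ A, ∀ y ∈ A, x * y = y * x}).exists_maximal ⟨⊥, inferInstance, by simp⟩
  refine ⟨A, hAn, hAc, fun g hg => ?_⟩
  by_contra hgA
  set C := Subgroup.centralizer (A : Set P) with hC
  have hgC : g ∈ C := Subgroup.mem_centralizer_iff.2 hg
  have hCn : C.Normal := Subgroup.normal_centralizer
  have hQ : IsPGroup p (P ⧸ A) := hP.to_quotient A
  have hne : C.map (QuotientGroup.mk' A) ≠ ⊥ := by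
    intro h
    rw [Subgroup.map_eq_bot_iff, QuotientGroup.ker_mk'] at h
    exact hgA (h hgC)
  have := hCn.map _ (QuotientGroup.mk'_surjective A)
  obtain ⟨c', ⟨c, hcC, rfl⟩, hc1, hcc⟩ := hQ.exists_mem_center_of_normal hne
  have hcA : c ∉ A := fun h => hc1 ((QuotientGroup.eq_one_iff c).2 h)
  have hcom : ∀ x ∈ A, x * c = c * x := Subgroup.mem_centralizer_iff.1 hcC
  set B := A ⊔ Subgroup.zpowers c with hB
  have hcB : c ∈ B := Subgroup.mem_sup_right (Subgroup.mem_zpowers c)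
  have hBA : A ≤ B := le_sup_left
  have hBn : B.Normal := by
    have h1 : B = Subgroup.comap (QuotientGroup.mk' A) ((Subgroup.zpowers (QuotientGroup.mk' A c))) := by
      rw [← MonoidHom.map_zpowers, Subgroup.comap_map_eq, QuotientGroup.ker_mk', sup_comm]
    rw [h1]
    have : (Subgroup.zpowers (QuotientGroup.mk' A c)).Normal := by
      constructor
      intro n hn g
      obtain ⟨k, rfl⟩ := Subgroup.mem_zpowers_iff.1 hn
      have : Commute g (QuotientGroup.mk' A c) := hcc g
      rw [(this.zpow_right k).eq, mul_inv_cancel_right]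
      exact hn
    infer_instance
  have hBc : ∀ x ∈ B, ∀ y ∈ B, x * y = y * x := by
    have hAB : B ≤ Subgroup.centralizer (A : Set P) := by
      refine sup_le (fun x hx => Subgroup.mem_centralizer_iff.2 fun y hy => hAc y hy x hx) ?_
      rw [Subgroup.zpowers_le]; exact hcC
    have hcB : B ≤ Subgroup.centralizer ({c} : Set P) := by
      refine sup_le (fun x hx => Subgroup.mem_centralizer_singleton_iff.2 (hcom x hx)) ?_
      rw [Subgroup.zpowers_le]; exact Subgroup.mem_centralizer_singleton_iff.2 rfl
    have hBB : B ≤ Subgroup.centralizer (B : Set P) := by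
      conv_lhs => rw [hB]
      refine sup_le (fun x hx => Subgroup.mem_centralizer_iff.2 fun y hy => ?_) ?_
      · exact (Subgroup.mem_centralizer_iff.1 (hAB hy) x hx).symm
      · rw [Subgroup.zpowers_le]
        exact Subgroup.mem_centralizer_iff.2 fun y hy =>
          (Subgroup.mem_centralizer_singleton_iff.1 (hcB hy))
    exact fun x hx y hy => Subgroup.mem_centralizer_iff.1 (hBB hy) x hx
  exact hcA (hmax ⟨hBn, hBc⟩ hBA hcB)

lemma two_pow_dvd_of_dvd_sq_sub_one {k : ℕ} {s : ℤ} (hk : k ≠ 0) (h : (2 : ℤ) ^ k ∣ s ^ 2 - 1) :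
    (2 : ℤ) ^ k ∣ 2 * (s - 1) ∨ (2 : ℤ) ^ k ∣ 2 * (s + 1) := by
  have hodd : Odd s := by
    by_contra hs
    rw [Int.not_odd_iff_even] at hs
    obtain ⟨j, hj⟩ := hs
    obtain ⟨c, hc⟩ := (dvd_pow_self (2 : ℤ) hk).trans h
    have : s ^ 2 = 2 * (c) + 1 := by linarith
    rw [hj] at this
    have h2 : 2 * (2 * j ^ 2 - c) = 1 := by linear_combination this
    omega
  obtain ⟨w, rfl⟩ := hodd
  have h4 : (2 : ℤ) ^ k ∣ (4 * w) * (w + 1) := by convert h using 1; ring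
  rcases Int.even_or_odd w with hw | hw
  · left
    have hc : IsCoprime ((2 : ℤ) ^ k) (w + 1) :=
      IsCoprime.pow_left (by obtain ⟨j, rfl⟩ := hw; exact ⟨-j, 1, by ring⟩)
    rw [show 2 * (2 * w + 1 - 1) = 4 * w by ring]
    exact hc.dvd_of_dvd_mul_right h4
  · right
    have hc : IsCoprime ((2 : ℤ) ^ k) w :=
      IsCoprime.pow_left (by obtain ⟨j, rfl⟩ := hw; exact ⟨-j, 1, by ring⟩)
    have : (2 : ℤ) ^ k ∣ (4 * (w + 1)) * w := by convert h4 using 1; ring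
    rw [show 2 * (2 * w + 1 + 1) = 4 * (w + 1) by ring]
    exact hc.dvd_of_dvd_mul_right this

lemma conj_sq_zpow {P : Type*} [Group P] {g a : P} {s : ℤ} (h : g * a * g⁻¹ = a ^ s) (i : ℤ) :
    g * a ^ i * g⁻¹ = a ^ (s * i) := by
  rw [zpow_mul, ← h, conj_zpow]

/-- In a finite `2`-group with at most one involution `z`, an element `g` whose square lies in a
self-centralizing normal cyclic subgroup `⟨a⟩` of order `2 ^ k`, `2 ≤ k`, without lying in it,
inverts `a`, and its square is `z`. -/
lemma conj_eq_inv_of_unique_involution {P : Type*} [Group P] {z a g : P} {k : ℕ}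
    (hz : ∀ t : P, t ^ 2 = 1 → t = 1 ∨ t = z) (hk : 2 ≤ k) (ha : orderOf a = 2 ^ k)
    (hcent : ∀ x, a * x = x * a → x ∈ Subgroup.zpowers a)
    (hnorm : g * a * g⁻¹ ∈ Subgroup.zpowers a)
    (hg : g ∉ Subgroup.zpowers a) (hg2 : g ^ 2 ∈ Subgroup.zpowers a) :
    g * a * g⁻¹ = a⁻¹ ∧ g ^ 2 = z := by
  have hdvd : ∀ i : ℤ, a ^ i = 1 ↔ (2 : ℤ) ^ k ∣ i := by
    intro i
    rw [← orderOf_dvd_iff_zpow_eq_one, ha]; push_cast; rfl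
  set w : P := a ^ ((2 : ℤ) ^ (k - 1)) with hw
  have hw2 : w ^ 2 = 1 := by
    rw [hw, ← zpow_natCast, ← zpow_mul, hdvd]
    refine ⟨1, ?_⟩
    obtain ⟨j, rfl⟩ : ∃ j, k = j + 1 := ⟨k - 1, by omega⟩
    simp [pow_succ]
  have hw1 : w ≠ 1 := by
    rw [hw, Ne, hdvd]
    intro h
    have := Int.le_of_dvd (by positivity) h
    have := pow_lt_pow_right₀ (by norm_num : (1 : ℤ) < 2) (show k - 1 < k by omega)
    omega
  have hwz : w = z := (hz w hw2).resolve_left hw1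
  have hwA : w ∈ Subgroup.zpowers a := ⟨_, rfl⟩
  have hzA : ∀ t : P, t ^ 2 = 1 → t ∈ Subgroup.zpowers a := by
    intro t ht
    rcases hz t ht with rfl | rfl
    · exact one_mem _
    · rw [← hwz]; exact hwA
  obtain ⟨s, hs⟩ := hnorm
  obtain ⟨c, hc⟩ := hg2
  simp only at hs hc
  have hs' := hs.symm
  have hcomm : a ^ (s * c) = a ^ c := by
    rw [← conj_sq_zpow hs', hc]; group
  have hss : (2 : ℤ) ^ k ∣ s ^ 2 - 1 := by
    rw [← hdvd, zpow_sub, zpow_one, mul_inv_eq_one, sq, zpow_mul, hs, conj_zpow, hs]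
    have : g * (g * a * g⁻¹) * g⁻¹ = g ^ 2 * a * (g ^ 2)⁻¹ := by simp only [sq]; group
    rw [this, ← hc]; group
  have hmul : ∀ i : ℤ, (g * a ^ i) ^ 2 = a ^ (c + s * i + i) := by
    intro i
    have h1 : g⁻¹ * a ^ i * g = a ^ (s * i) := by
      have : g * a ^ (s * i) * g⁻¹ = a ^ i := by
        rw [conj_sq_zpow hs', ← mul_assoc, ← sq]
        have := (hdvd ((s ^ 2 - 1) * i)).2 (hss.mul_right _)
        rw [sub_mul, one_mul, zpow_sub, mul_inv_eq_one] at this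
        exact this
      rw [← this]; group
    rw [zpow_add, zpow_add, ← h1, hc]; simp only [sq]; group
  have hnot : ∀ i : ℤ, ¬ (2 : ℤ) ^ k ∣ c + s * i + i := by
    intro i hi
    rw [← hdvd, ← hmul] at hi
    apply hg
    have := hzA _ hi
    exact (Subgroup.mul_mem_cancel_right _ (Subgroup.zpow_mem _ (Subgroup.mem_zpowers a) i)).1 this
  have hsinv : (2 : ℤ) ^ k ∣ s + 1 → g * a * g⁻¹ = a⁻¹ ∧ g ^ 2 = z := by
    intro h
    constructor
    · rw [← hs, ← mul_inv_eq_one, inv_inv, ← zpow_add_one, hdvd]; exact h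
    · have h2 : g ^ 2 * g ^ 2 = 1 := by
        rw [← hc, ← zpow_add, hdvd]
        have h3 : (2 : ℤ) ^ k ∣ s * c - c := by
          rw [← hdvd, zpow_sub, hcomm, mul_inv_cancel]
        have h4 := (h.mul_right c).sub h3
        rwa [show (s + 1) * c - (s * c - c) = c + c by ring] at h4
      refine (hz _ (by rw [sq, h2])).resolve_left fun h1 => hg (hzA g h1)
  have hcc : (2 : ℤ) ^ k ∣ (s - 1) * c := by
    rw [← hdvd, sub_mul, one_mul, zpow_sub, hcomm, mul_inv_cancel]
  have hs1 : ¬ (2 : ℤ) ^ k ∣ s - 1 := by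
    intro h
    rw [← hdvd, zpow_sub_one, mul_inv_eq_one, hs] at h
    exact hg (hcent g (by rw [← mul_inv_eq_iff_eq_mul.1 h]))
  obtain ⟨j, rfl⟩ : ∃ j, k = j + 2 := ⟨k - 2, by omega⟩
  have hpar : ∀ x : ℤ, x % 2 = 1 → ∀ N : ℕ, ∀ y : ℤ, (2 : ℤ) ^ N ∣ x * y → (2 : ℤ) ^ N ∣ y := by
    intro x hx N y h
    refine IsCoprime.dvd_of_dvd_mul_left (IsCoprime.pow_left ?_) h
    exact ⟨-(x / 2), 1, by omega⟩
  have hpow : (2 : ℤ) ^ (j + 2) = 4 * 2 ^ j := by ring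
  rcases two_pow_dvd_of_dvd_sq_sub_one (by omega) hss with h | h
  · -- `s - 1 = 2 ^ (j + 1) * y` with `y` odd
    obtain ⟨y, hy⟩ : (2 : ℤ) ^ (j + 1) ∣ s - 1 := by
      obtain ⟨y, hy⟩ := h
      exact ⟨y, by rw [pow_succ]; rw [hpow] at hy; linarith⟩
    have hyodd : y % 2 = 1 := by
      by_contra hy2
      apply hs1
      obtain ⟨y', rfl⟩ : (2 : ℤ) ∣ y := by omega
      exact ⟨y', by rw [hy]; ring⟩
    rcases Nat.eq_zero_or_pos j with rfl | hj
    · apply hsinv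
      norm_num at hy ⊢
      omega
    · exfalso
      have hc2 : (2 : ℤ) ∣ c := by
        have h1 : (2 : ℤ) ^ (j + 1) * 2 ∣ 2 ^ (j + 1) * (y * c) := by
          rw [← mul_assoc, ← hy, ← pow_succ]; exact hcc
        have h2 := Int.dvd_of_mul_dvd_mul_left (by positivity) h1
        have := hpar y hyodd 1 c (by simpa using h2)
        simpa using this
      obtain ⟨d, rfl⟩ := hc2
      obtain ⟨i, rfl⟩ : ∃ i, j = i + 1 := ⟨j - 1, by omega⟩
      rcases Int.even_or_odd' d with ⟨e, rfl | rfl⟩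
      · apply hnot (-(2 * e))
        refine ⟨-(y * e), ?_⟩
        have : s = 1 + 2 ^ (i + 1 + 1) * y := by linarith
        rw [this]; ring
      · have : s = 1 + 2 ^ (i + 1 + 1) * y := by linarith
        obtain ⟨y', hy'⟩ : ∃ y', y = 2 * y' + 1 := ⟨y / 2, by omega⟩
        apply hnot (-(2 * e + 1) + 2 ^ (i + 1))
        refine ⟨-(y' * (2 * e + 1)) - e + y * 2 ^ i, ?_⟩
        rw [this, hy']; ring
  · obtain ⟨y, hy⟩ : (2 : ℤ) ^ (j + 1) ∣ s + 1 := by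
      obtain ⟨y, hy⟩ := h
      exact ⟨y, by rw [pow_succ]; rw [hpow] at hy; linarith⟩
    by_cases hy2 : (2 : ℤ) ∣ y
    · apply hsinv
      obtain ⟨y', rfl⟩ := hy2
      exact ⟨y', by rw [hy]; ring⟩
    · exfalso
      obtain ⟨y', hy'⟩ : ∃ y', y = 2 * y' + 1 := ⟨y / 2, by omega⟩
      have hs0 : s = -1 + 2 ^ (j + 1) * y := by linarith
      have hc2 : (2 : ℤ) ^ (j + 1) ∣ c := by
        have h1 : (2 : ℤ) * 2 ^ (j + 1) ∣ 2 * ((2 ^ j * y - 1) * c) := by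
          rw [← pow_succ', ← mul_assoc]
          rwa [show (2 : ℤ) * (2 ^ j * y - 1) = s - 1 by rw [hs0]; ring]
        have h2 := Int.dvd_of_mul_dvd_mul_left (by norm_num) h1
        rcases Nat.eq_zero_or_pos j with rfl | hj
        · exfalso
          apply hs1
          refine ⟨y', ?_⟩
          rw [hs0, hy']; ring
        · refine hpar _ ?_ _ _ h2
          obtain ⟨i, rfl⟩ : ∃ i, j = i + 1 := ⟨j - 1, by omega⟩
          rw [show (2 : ℤ) ^ (i + 1) * y - 1 = 2 * (2 ^ i * y - 1) + 1 by ring]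
          omega
      obtain ⟨e, rfl⟩ := hc2
      rcases Int.even_or_odd' e with ⟨f, rfl | rfl⟩
      · apply hnot 0
        exact ⟨f, by ring⟩
      · apply hnot 1
        refine ⟨f + y' + 1, ?_⟩
        rw [hs0, hy']; ring

lemma exists_generator_of_unique_involution {P : Type*} [Group P] [Finite P] (hP : IsPGroup 2 P)
    {z : P} (hz : ∀ t : P, t ^ 2 = 1 → t = 1 ∨ t = z) {A : Subgroup P}
    (hA : ∀ x ∈ A, ∀ y ∈ A, x * y = y * x) :
    ∃ a ∈ A, ∀ t ∈ A, t ∈ Subgroup.zpowers a := by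
  obtain ⟨⟨a, haA⟩, ha⟩ := Finite.exists_max (fun t : A => orderOf (t : P))
  refine ⟨a, haA, ?_⟩
  have hmax : ∀ t ∈ A, orderOf t ≤ orderOf a := fun t ht => ha ⟨t, ht⟩
  have hone : a = 1 → ∀ t ∈ A, t = 1 := fun h t ht => by
    have := hmax t ht
    rw [h, orderOf_one] at this
    rw [← orderOf_eq_one_iff]
    have := orderOf_pos t
    omega
  have hsq : ∀ t ∈ A, t ^ 2 = 1 → t ∈ Subgroup.zpowers a := by
    intro t ht h2
    by_cases ht1 : t = 1
    · rw [ht1]; exact one_mem _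
    have ha1 : a ≠ 1 := fun h => ht1 (hone h t ht)
    obtain ⟨k, hk⟩ := (IsPGroup.iff_orderOf.1 hP) a
    obtain ⟨j, rfl⟩ : ∃ j, k = j + 1 := by
      refine ⟨k - 1, ?_⟩
      have : k ≠ 0 := by rintro rfl; exact ha1 (orderOf_eq_one_iff.1 (by simpa using hk))
      omega
    have h3 : (a ^ 2 ^ j) ^ 2 = 1 := by rw [← pow_mul, ← pow_succ, ← hk, pow_orderOf_eq_one]
    have h4 : a ^ 2 ^ j ≠ 1 := by
      intro h
      have := Nat.le_of_dvd (by positivity) (orderOf_dvd_of_pow_eq_one h)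
      rw [hk] at this
      exact absurd this (not_le.2 (Nat.pow_lt_pow_right (by norm_num) (by omega)))
    rw [(hz t h2).resolve_left ht1, ← (hz _ h3).resolve_left h4]
    exact Subgroup.pow_mem _ (Subgroup.mem_zpowers a) _
  have key : ∀ n : ℕ, ∀ t ∈ A, t ^ 2 ^ n = 1 → t ∈ Subgroup.zpowers a := by
    intro n
    induction n with
    | zero => intro t _ h; rw [pow_zero, pow_one] at h; rw [h]; exact one_mem _
    | succ n ih =>
      intro t ht h
      obtain ⟨i, hi⟩ := ih (t ^ 2) (A.pow_mem ht 2) (by rw [← pow_mul, ← pow_succ', h])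
      simp only at hi
      have hco : Commute a t := hA a haA t ht
      rcases Int.even_or_odd' i with ⟨d, rfl | rfl⟩
      · have h1 : (t * a ^ (-d)) ^ 2 = 1 := by
          rw [(hco.symm.zpow_right _).mul_pow, ← hi, ← zpow_natCast, ← zpow_mul, ← zpow_add]
          rw [show 2 * d + -d * ((2 : ℕ) : ℤ) = 0 by push_cast; ring, zpow_zero]
        have h2 := hsq _ (A.mul_mem ht (A.zpow_mem haA _)) h1
        exact (Subgroup.mul_mem_cancel_right _ (Subgroup.zpow_mem _ (Subgroup.mem_zpowers a) _)).1 h2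
      · by_cases ha1 : a = 1
        · rw [hone ha1 t ht]; exact one_mem _
        exfalso
        obtain ⟨k, hk⟩ := (IsPGroup.iff_orderOf.1 hP) a
        obtain ⟨l, hl⟩ := (IsPGroup.iff_orderOf.1 hP) t
        have hle := hmax t ht
        rw [hk, hl] at hle
        have hlk : l ≤ k := (Nat.pow_le_pow_iff_right (by norm_num)).1 hle
        have hk0 : k ≠ 0 := by rintro rfl; exact ha1 (orderOf_eq_one_iff.1 (by simpa using hk))
        obtain ⟨j, rfl⟩ : ∃ j, k = j + 1 := ⟨k - 1, by omega⟩
        have h1 : t ^ 2 ^ (j + 1) = 1 := by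
          rw [← orderOf_dvd_iff_pow_eq_one, hl]; exact pow_dvd_pow 2 hlk
        rw [pow_succ', pow_mul, ← hi, ← zpow_natCast, ← zpow_mul, ← orderOf_dvd_iff_zpow_eq_one,
          hk] at h1
        push_cast at h1
        rw [pow_succ, mul_comm (2 * d + 1)] at h1
        have := Int.dvd_of_mul_dvd_mul_left (by positivity) h1
        omega
  intro t ht
  obtain ⟨n, hn⟩ := hP t
  exact key n t ht hn

lemma commute_of_unique_involution {P : Type*} [Group P] [Finite P] (hP : IsPGroup 2 P) {z : P}
    (hz : ∀ t : P, t ^ 2 = 1 → t = 1 ∨ t = z) {x y : P} (hxz : x ^ 2 ≠ z)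
    (hyz : y ^ 2 ≠ z) : x * y = y * x := by
  obtain ⟨A, hAn, hAc, hAs⟩ := hP.exists_normal_selfCentralizing
  obtain ⟨a, haA, ha⟩ := exists_generator_of_unique_involution hP hz hAc
  have hAa : A = Subgroup.zpowers a := by
    refine le_antisymm (fun t ht => ?_) (by rwa [Subgroup.zpowers_le])
    exact ha t ht
  subst hAa
  obtain ⟨k, hk⟩ := (IsPGroup.iff_orderOf.1 hP) a
  by_cases hk2 : 2 ≤ k
  · have hnorm : ∀ g : P, g * a * g⁻¹ ∈ Subgroup.zpowers a := fun g =>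
      hAn.conj_mem _ (Subgroup.mem_zpowers a) g
    have hcent : ∀ g, a * g = g * a → g ∈ Subgroup.zpowers a := fun g hg => hAs g (by
      rintro _ ⟨i, rfl⟩
      exact (Commute.zpow_left (show Commute a g from hg) i).eq)
    have key : ∀ g : P, g ∉ Subgroup.zpowers a → g ^ 2 ∈ Subgroup.zpowers a →
        g * a * g⁻¹ = a⁻¹ ∧ g ^ 2 = z := fun g h1 h2 =>
      conj_eq_inv_of_unique_involution hz hk2 hk hcent (hnorm g) h1 h2
    have key2 : ∀ g : P, g ∉ Subgroup.zpowers a → g ^ 2 ∈ Subgroup.zpowers a := by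
      intro g hg
      by_contra hg2
      have hex : ∃ n, g ^ 2 ^ n ∈ Subgroup.zpowers a := by
        obtain ⟨n, hn⟩ := hP g
        exact ⟨n, by rw [hn]; exact one_mem _⟩
      classical
      obtain ⟨n, hn⟩ : ∃ n, Nat.find hex = n + 2 := by
        have h0 : Nat.find hex ≠ 0 := fun h => hg (by
          have := Nat.find_spec hex; rw [h] at this; simpa using this)
        have h1 : Nat.find hex ≠ 1 := fun h => hg2 (by
          have := Nat.find_spec hex; rw [h] at this; simpa using this)
        exact ⟨Nat.find hex - 2, by omega⟩
      have hn1 : g ^ 2 ^ (n + 1) ∉ Subgroup.zpowers a := Nat.find_min hex (by omega)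
      have hn2 : (g ^ 2 ^ (n + 1)) ^ 2 ∈ Subgroup.zpowers a := by
        have := Nat.find_spec hex
        rw [hn, pow_succ, pow_mul] at this
        exact this
      have hinv := (key _ hn1 hn2).1
      obtain ⟨s, hs⟩ := hnorm (g ^ 2 ^ n)
      simp only at hs
      have h1 : g ^ 2 ^ (n + 1) = g ^ 2 ^ n * g ^ 2 ^ n := by rw [pow_succ, pow_mul, sq]
      have h2 : a ^ (s * s) = a⁻¹ := by
        rw [zpow_mul, hs, conj_zpow, hs, ← hinv, h1]; group
      have h3 : a ^ (s * s + 1) = 1 := by rw [zpow_add_one, h2, inv_mul_cancel]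
      rw [← orderOf_dvd_iff_zpow_eq_one, hk] at h3
      have h4 : (4 : ℤ) ∣ s * s + 1 := by
        refine dvd_trans ?_ h3
        push_cast
        exact pow_dvd_pow 2 hk2
      rcases Int.even_or_odd' s with ⟨t, rfl | rfl⟩
      · have : (2 * t) * (2 * t) + 1 = 4 * (t * t) + 1 := by ring
        omega
      · have : (2 * t + 1) * (2 * t + 1) + 1 = 4 * (t * t + t) + 2 := by ring
        omega
    have hmem : ∀ g : P, g ^ 2 ≠ z → g ∈ Subgroup.zpowers a := fun g hg => by
      by_contra h
      exact hg (key g h (key2 g h)).2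
    exact hAc x (hmem x hxz) y (hmem y hyz)
  · have ha2 : a ^ 2 = 1 := by
      rw [← orderOf_dvd_iff_pow_eq_one, hk]
      exact (pow_dvd_pow 2 (show k ≤ 1 by omega)).trans (by norm_num)
    have hcen : ∀ g : P, a * g = g * a := by
      intro g
      rcases hz a ha2 with h | h
      · rw [h, one_mul, mul_one]
      · have h1 : (g * a * g⁻¹) ^ 2 = 1 := by rw [conj_pow, ha2]; group
        rcases hz _ h1 with h2 | h2
        · have : a = 1 := by
            rw [mul_inv_eq_one] at h2
            simpa using h2
          rw [this, one_mul, mul_one]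
        · rw [← h, mul_inv_eq_iff_eq_mul] at h2
          exact h2.symm
    have htop : ∀ g : P, g ∈ Subgroup.zpowers a := fun g => hAs g (by
      rintro _ ⟨i, rfl⟩
      exact (Commute.zpow_left (show Commute a g from hcen g) i).eq)
    exact hAc x (htop x) y (htop y)

end TwoGroups

section FiniteGroups

lemma exists_orderOf_mul_of_commute {G : Type*} [Group G] [Finite G] {s w : G} (h : Commute s w)
    {a b : ℕ} (hab : a.Coprime b) (ha : a ∣ orderOf s) (hb : b ∣ orderOf w) :
    ∃ g : G, orderOf g = a * b := by
  refine ⟨s ^ (orderOf s / a) * w ^ (orderOf w / b), ?_⟩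
  have h1 := orderOf_pow_orderOf_div (orderOf_pos s).ne' ha
  have h2 := orderOf_pow_orderOf_div (orderOf_pos w).ne' hb
  rw [((h.pow_left _).pow_right _).orderOf_mul_eq_mul_orderOf_of_coprime (by rwa [h1, h2]), h1, h2]

lemma exists_orderOf_of_dvd {G : Type*} [Group G] [Finite G] {g : G} {a : ℕ}
    (ha : a ∣ orderOf g) : ∃ g : G, orderOf g = a :=
  ⟨_, orderOf_pow_orderOf_div (orderOf_pos g).ne' ha⟩

lemma exists_orderOf_of_surjective {G H : Type*} [Group G] [Finite G] [Group H] {f : G →* H}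
    (hf : Function.Surjective f) (x : H) : ∃ g : G, orderOf g = orderOf x := by
  obtain ⟨g, rfl⟩ := hf x
  exact exists_orderOf_of_dvd (orderOf_map_dvd f g)

lemma IsPGroup.prime_dvd_orderOf {p : ℕ} [Fact p.Prime] {P : Type*} [Group P] [Finite P]
    (hP : IsPGroup p P) {x : P} (hx : x ≠ 1) : p ∣ orderOf x := by
  obtain ⟨k, hk⟩ := (IsPGroup.iff_orderOf.1 hP) x
  rw [hk]
  refine dvd_pow_self _ ?_
  rintro rfl
  exact hx (orderOf_eq_one_iff.1 (by simpa using hk))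

lemma IsPGroup.prime_dvd_orderOf_coe {p : ℕ} [Fact p.Prime] {G : Type*} [Group G] [Finite G]
    {P : Subgroup G} (hP : IsPGroup p P) {x : G} (hxP : x ∈ P) (hx : x ≠ 1) : p ∣ orderOf x := by
  have := hP.prime_dvd_orderOf (x := ⟨x, hxP⟩) (fun h => hx (congrArg Subtype.val h))
  rwa [Subgroup.orderOf_mk] at this

lemma eq_of_involutions_of_normal {N : Type*} [Group N] [Finite N] {r : ℕ} [Fact r.Prime]
    (hr2 : r ≠ 2) {R : Subgroup N} [R.Normal] (hR : IsPGroup r R) (hne : R ≠ ⊥)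
    (hno : ∀ g : N, orderOf g ≠ 2 * r) {T : Subgroup N} (hT : IsPGroup 2 T) {s t : N}
    (hs : s ∈ T) (ht : t ∈ T) (hs2 : s ^ 2 = 1) (ht2 : t ^ 2 = 1) (hs1 : s ≠ 1) (ht1 : t ≠ 1) :
    s = t := by
  have hcop : Nat.Coprime 2 r := (Nat.coprime_primes Nat.prime_two Fact.out).2 hr2.symm
  have hcent : ∀ w ∈ T, w ≠ 1 → ∀ x ∈ R, Commute w x → x = 1 := by
    intro w hw hw1 x hx hc
    by_contra hx1
    obtain ⟨g, hg⟩ := exists_orderOf_mul_of_commute hc hcop (hT.prime_dvd_orderOf_coe hw hw1)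
      (hR.prime_dvd_orderOf_coe hx hx1)
    exact hno g hg
  have hinv : ∀ w ∈ T, w ^ 2 = 1 → w ≠ 1 → ∀ x ∈ R, w * x * w⁻¹ = x⁻¹ := by
    intro w hw hw2 hw1 x hx
    have hfp : MonoidHom.FixedPointFree (MulAut.conjNormal w : MulAut R) := by
      intro y hy
      have hy' := congrArg Subtype.val hy
      rw [MulAut.conjNormal_apply, mul_inv_eq_iff_eq_mul] at hy'
      exact Subtype.ext (hcent w hw hw1 y y.2 hy')
    have hin : Function.Involutive (MulAut.conjNormal w : MulAut R) := by
      intro y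
      have : (MulAut.conjNormal w * MulAut.conjNormal w : MulAut R) y = y := by
        rw [← map_mul, ← sq, hw2, map_one, MulAut.one_apply]
      exact this
    have := congrFun (hfp.coe_eq_inv_of_involutive hin) ⟨x, hx⟩
    simpa using congrArg Subtype.val this
  by_contra hst
  have h1 : s * t ≠ 1 := by
    intro h
    apply hst
    rw [mul_eq_one_iff_eq_inv.1 h, inv_eq_iff_mul_eq_one, ← sq, ht2]
  obtain ⟨x, hx, hx1⟩ := R.bot_or_exists_ne_one.resolve_left hne
  refine hx1 (hcent (s * t) (T.mul_mem hs ht) h1 x hx ?_)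
  change s * t * x = x * (s * t)
  rw [← mul_inv_eq_iff_eq_mul]
  calc s * t * x * (s * t)⁻¹ = s * (t * x * t⁻¹) * s⁻¹ := by group
    _ = x := by rw [hinv t ht ht2 ht1 x hx, hinv s hs hs2 hs1 x⁻¹ (R.inv_mem hx), inv_inv]

/-- If `r` divides the order of a normal subgroup `K` and there are no elements of order `2 * r`,
then the `2`-subgroups of `G ⧸ K` are severely restricted. -/
lemma not_dvd_card_of_two_subgroups {G : Type*} [Group G] [Finite G] {K : Subgroup G} [K.Normal]
    {r : ℕ} (hr : r.Prime) (hr2 : r ≠ 2) (hno : ∀ g : G, orderOf g ≠ 2 * r)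
    {V W : Subgroup (G ⧸ K)} (hV : IsPGroup 2 V) (hW : IsPGroup 2 W)
    {a b : G ⧸ K} (ha : a ∈ V) (hb : b ∈ V) (ha2 : a ^ 2 = 1) (hb2 : b ^ 2 = 1) (ha1 : a ≠ 1)
    (hb1 : b ≠ 1) (hab : a ≠ b)
    {x y : G ⧸ K} (hx : x ∈ W) (hy : y ∈ W) (hx2 : x ^ 2 ≠ 1) (hy2 : y ^ 2 ≠ 1)
    (hxy : x * y ≠ y * x) : ¬ r ∣ Nat.card K := by
  intro hrK
  have := Fact.mk hr
  obtain ⟨R⟩ : Nonempty (Sylow r K) := inferInstance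
  set R₁ : Subgroup G := (R : Subgroup K).map K.subtype with hR₁
  set N : Subgroup G := Subgroup.normalizer (R₁ : Set G) with hN
  set R₂ : Subgroup N := R₁.subgroupOf N with hR₂
  have hR₂n : R₂.Normal := by rw [hR₂, hN]; infer_instance
  have hR₁p : IsPGroup r R₁ := R.isPGroup'.map _
  have hR₂p : IsPGroup r R₂ := hR₁p.comap_of_injective N.subtype N.subtype_injective
  have hR₂ne : R₂ ≠ ⊥ := by
    intro h
    have hle : R₁ ≤ N := Subgroup.le_normalizer
    rw [hR₂, Subgroup.subgroupOf_eq_bot, disjoint_iff, inf_eq_left.2 hle, hR₁,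
      Subgroup.map_eq_bot_iff_of_injective _ K.subtype_injective] at h
    exact R.ne_bot_of_dvd_card hrK h
  have hnoN : ∀ g : N, orderOf g ≠ 2 * r := fun g h => hno g (by rw [Subgroup.orderOf_coe, h])
  set f : N →* G ⧸ K := (QuotientGroup.mk' K).comp N.subtype with hf
  have hfs : Function.Surjective f := by
    intro q
    obtain ⟨g, rfl⟩ := QuotientGroup.mk'_surjective K q
    have hg : g ∈ N ⊔ K := by rw [hN, hR₁, R.normalizer_sup_eq_top]; trivial
    obtain ⟨n, hn, k, hk, rfl⟩ := Subgroup.mem_sup_of_normal_right.1 hg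
    refine ⟨⟨n, hn⟩, ?_⟩
    rw [map_mul, (QuotientGroup.eq_one_iff k).2 hk |> fun h => (h : QuotientGroup.mk' K k = 1),
      mul_one]
    rfl
  have hlift : ∀ U : Subgroup (G ⧸ K), IsPGroup 2 U → ∃ T : Sylow 2 N, U ≤ (T : Subgroup N).map f := by
    intro U hU
    obtain ⟨Q, hQ⟩ := hU.exists_le_sylow
    obtain ⟨T, rfl⟩ := Sylow.mapSurjective_surjective hfs 2 Q
    exact ⟨T, by simpa using hQ⟩
  have huniq : ∀ T : Sylow 2 N, ∀ s ∈ T, ∀ t ∈ T, s ^ 2 = 1 → t ^ 2 = 1 → s ≠ 1 → t ≠ 1 → s = t :=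
    fun T s hs t ht => eq_of_involutions_of_normal hr2 hR₂p hR₂ne hnoN T.isPGroup' hs ht
  obtain ⟨T₁, hT₁⟩ := hlift V hV
  obtain ⟨T₂, hT₂⟩ := hlift W hW
  have hker : ∃ z ∈ T₁, z ^ 2 = 1 ∧ z ≠ 1 ∧ f z = 1 := by
    by_contra hcon
    push Not at hcon
    have hinj : ∀ t ∈ T₁, f t = 1 → t = 1 := by
      intro t ht hft
      by_contra ht1
      have hd := T₁.isPGroup'.prime_dvd_orderOf_coe ht ht1
      have ho := orderOf_pow_orderOf_div (orderOf_pos t).ne' hd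
      refine hcon (t ^ (orderOf t / 2)) (T₁.pow_mem ht _) ?_ ?_ (by rw [map_pow, hft, one_pow])
      · have := pow_orderOf_eq_one (t ^ (orderOf t / 2)); rwa [ho] at this
      · intro h; rw [h, orderOf_one] at ho; omega
    obtain ⟨s, hs, rfl⟩ := hT₁ ha
    obtain ⟨t, ht, rfl⟩ := hT₁ hb
    apply hab
    rw [huniq T₁ s hs t ht (hinj _ (T₁.pow_mem hs 2) (by rw [map_pow, ha2]))
      (hinj _ (T₁.pow_mem ht 2) (by rw [map_pow, hb2])) (fun h => ha1 (by rw [h, map_one]))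
      (fun h => hb1 (by rw [h, map_one]))]
  obtain ⟨z₁, hz₁, hz₁2, hz₁1, hz₁f⟩ := hker
  obtain ⟨g, hg⟩ := MulAction.exists_smul_eq N T₁ T₂
  set z := g * z₁ * g⁻¹ with hz
  have hzT : z ∈ T₂ := by
    rw [← hg]
    exact Subgroup.smul_mem_pointwise_smul z₁ (MulAut.conj g) _ hz₁
  have hz2 : z ^ 2 = 1 := by rw [hz, conj_pow, hz₁2]; group
  have hz1 : z ≠ 1 := by
    intro h
    rw [hz, mul_inv_eq_one] at h
    exact hz₁1 (by simpa using h)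
  have hzf : f z = 1 := by rw [hz, map_mul, map_mul, hz₁f, mul_one, ← map_mul, mul_inv_cancel, map_one]
  obtain ⟨s, hs, rfl⟩ := hT₂ hx
  obtain ⟨t, ht, rfl⟩ := hT₂ hy
  apply hxy
  have hT : ∀ w : T₂, w ^ 2 = 1 → w = 1 ∨ w = ⟨z, hzT⟩ := by
    intro w hw
    by_cases hw1 : w = 1
    · exact Or.inl hw1
    · right
      apply Subtype.ext
      exact huniq T₂ w w.2 z hzT (by simpa using congrArg Subtype.val hw) hz2
        (fun h => hw1 (Subtype.ext h)) hz1
  have hne : ∀ w (hw : w ∈ T₂), f w ^ 2 ≠ 1 → (⟨w, hw⟩ : T₂) ^ 2 ≠ ⟨z, hzT⟩ := by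
    intro w hw hfw h
    have := congrArg Subtype.val h
    apply hfw
    rw [← map_pow, ← hzf]
    exact congrArg f this
  have := commute_of_unique_involution T₂.isPGroup' hT (hne s hs hx2) (hne t ht hy2)
  rw [← map_mul, ← map_mul]
  exact congrArg f (congrArg Subtype.val this)

/-- If a normal subgroup has fewer classes of involutions than `r` and there are no elements
of order `2 * r`, then `r` does not divide its index. -/
lemma not_dvd_index_of_involution_classes {G : Type*} [Group G] [Finite G] {S : Subgroup G}
    [S.Normal] {r : ℕ} (hr : r.Prime) (hr2 : r ≠ 2) (hno : ∀ g : G, orderOf g ≠ 2 * r)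
    (c : G → ℕ) {k : ℕ} (hk : k < r) (hc : ∀ t ∈ S, orderOf t = 2 → c t < k)
    (hconj : ∀ t ∈ S, ∀ t' ∈ S, orderOf t = 2 → orderOf t' = 2 → c t = c t' →
      ∃ s ∈ S, s * t * s⁻¹ = t')
    {t : G} (ht : t ∈ S) (ht2 : orderOf t = 2) : ¬ r ∣ Nat.card (G ⧸ S) := by
  intro hd
  have := Fact.mk hr
  obtain ⟨x', hx'⟩ := exists_prime_orderOf_dvd_card' r hd
  obtain ⟨x, rfl⟩ := QuotientGroup.mk'_surjective S x'
  set T : ℕ → G := fun i => x ^ i * t * (x ^ i)⁻¹ with hT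
  have hTS : ∀ i, T i ∈ S := fun i => ‹S.Normal›.conj_mem t ht _
  have hT2 : ∀ i, orderOf (T i) = 2 := fun i => by
    have : T i = MulAut.conj (x ^ i) t := rfl
    rw [this, MulEquiv.orderOf_eq, ht2]
  obtain ⟨i, hi, j, hj, hij, hcij⟩ := Finset.exists_ne_map_eq_of_card_lt_of_maps_to
    (s := Finset.range r) (t := Finset.range k) (by simpa using hk) (f := fun i => c (T i))
    (fun i _ => by simpa using hc _ (hTS i) (hT2 i))
  obtain ⟨s, hs, hst⟩ := hconj _ (hTS i) _ (hTS j) (hT2 i) (hT2 j) hcij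
  set y := (x ^ j)⁻¹ * s * x ^ i with hy
  have hcom : Commute t y := by
    have h1 : y * t * y⁻¹ = t := by
      calc y * t * y⁻¹ = (x ^ j)⁻¹ * (s * (x ^ i * t * (x ^ i)⁻¹) * s⁻¹) * x ^ j := by
            rw [hy]; group
        _ = (x ^ j)⁻¹ * (x ^ j * t * (x ^ j)⁻¹) * x ^ j := by rw [hst]
        _ = t := by group
    exact (mul_inv_eq_iff_eq_mul.1 h1).symm
  have hyne : QuotientGroup.mk' S y ≠ 1 := by
    have hs1 : QuotientGroup.mk' S s = 1 := (QuotientGroup.eq_one_iff s).2 hs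
    rw [hy, map_mul, map_mul, hs1, mul_one, map_inv, map_pow, map_pow, Ne, inv_mul_eq_one]
    intro h
    have := pow_injOn_Iio_orderOf (by rw [Set.mem_Iio, hx']; simpa using hj)
      (by rw [Set.mem_Iio, hx']; simpa using hi) h
    exact hij this.symm
  have hyr : r ∣ orderOf y := by
    have hy1 : (QuotientGroup.mk' S y) ^ r = 1 := by
      have hs1 : QuotientGroup.mk' S s = 1 := (QuotientGroup.eq_one_iff s).2 hs
      rw [hy, map_mul, map_mul, hs1, mul_one, map_inv, map_pow, map_pow]
      have hcm : Commute ((QuotientGroup.mk' S x ^ j)⁻¹) (QuotientGroup.mk' S x ^ i) :=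
        ((Commute.refl _).pow_pow j i).inv_left
      rw [hcm.mul_pow, inv_pow, ← pow_mul, ← pow_mul, mul_comm j, mul_comm i, pow_mul, pow_mul,
        ← hx', pow_orderOf_eq_one]
      simp
    rw [← orderOf_eq_prime hy1 hyne]
    exact orderOf_map_dvd _ _
  obtain ⟨g, hg⟩ := exists_orderOf_mul_of_commute hcom
    ((Nat.coprime_primes Nat.prime_two hr).2 hr2.symm) ht2.symm.dvd hyr
  exact hno g hg

end FiniteGroups

section Solvable

lemma pow_card_eq_one_of_fixedPointFree {G V : Type*} [Group G] [Finite G] [CommGroup V]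
    (φ : G →* MulAut V) {B : Subgroup G} {y : G} (hyB : y ∈ Subgroup.normalizer (B : Set G)) {c : ℕ}
    (hc : 0 < c) (hyc : y ^ c = 1) (h1 : ∀ v, (∀ x ∈ B, φ x v = v) → v = 1)
    (h2 : ∀ v, φ y v = v → v = 1)
    (h3 : ∀ i, 0 < i → i < c → ∀ x ∈ B, x * y ^ i = y ^ i * x → x = 1) (v : V) :
    v ^ Nat.card B = 1 := by
  classical
  have : Fintype B := Fintype.ofFinite B
  have hB : ∀ w : V, ∏ x : B, φ x w = 1 := by
    intro w
    apply h1
    intro g hg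
    rw [map_prod]
    refine Fintype.prod_equiv (Equiv.mulLeft (⟨g, hg⟩ : B)) _ _ fun x => ?_
    rw [← MulAut.mul_apply, ← map_mul]
    rfl
  have hy : ∀ w : V, ∏ i ∈ Finset.range c, φ (y ^ i) w = 1 := by
    intro w
    apply h2
    rw [map_prod]
    obtain ⟨d, rfl⟩ : ∃ d, c = d + 1 := ⟨c - 1, by omega⟩
    have : ∀ i, φ y (φ (y ^ i) w) = φ (y ^ (i + 1)) w := fun i => by
      rw [← MulAut.mul_apply, ← map_mul, ← pow_succ']
    rw [Finset.prod_congr rfl fun i _ => this i, Finset.prod_range_succ, hyc,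
      Finset.prod_range_succ' _ d, pow_zero]
  have hL : ∏ x : B, ∏ i ∈ Finset.range c, φ (x * y ^ i * (x : G)⁻¹) v = 1 := by
    refine Finset.prod_eq_one fun x _ => ?_
    have : ∀ i, φ (x * y ^ i * (x : G)⁻¹) v = φ x (φ (y ^ i) (φ (x : G)⁻¹ v)) := fun i => by
      rw [map_mul, map_mul, MulAut.mul_apply, MulAut.mul_apply]
    rw [Finset.prod_congr rfl fun i _ => this i, ← map_prod, hy, map_one]
  rw [Finset.prod_comm, Finset.range_eq_Ico, Finset.prod_eq_prod_Ico_succ_bot hc] at hL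
  have hrest : ∏ i ∈ Finset.Ico (0 + 1) c, ∏ x : B, φ (x * y ^ i * (x : G)⁻¹) v = 1 := by
    refine Finset.prod_eq_one fun i hi => ?_
    rw [Finset.mem_Ico] at hi
    have hyi : y ^ i ∈ Subgroup.normalizer (B : Set G) := Subgroup.pow_mem _ hyB i
    have hmem : ∀ x : B, (x : G) * (y ^ i * (x : G)⁻¹ * (y ^ i)⁻¹) ∈ B := fun x =>
      B.mul_mem x.2 ((Subgroup.mem_normalizer_iff.1 hyi _).1 (B.inv_mem x.2))
    set f : B → B := fun x => ⟨_, hmem x⟩ with hf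
    have hinj : Function.Injective f := by
      intro x x' hxx
      have hx : (x : G) * (y ^ i * (x : G)⁻¹ * (y ^ i)⁻¹) =
        x' * (y ^ i * (x' : G)⁻¹ * (y ^ i)⁻¹) := congrArg Subtype.val hxx
      have hx1 : ((x' : G)⁻¹ * x) * y ^ i = y ^ i * ((x' : G)⁻¹ * x) := by
        calc ((x' : G)⁻¹ * x) * y ^ i = (x' : G)⁻¹ * (x * (y ^ i * (x : G)⁻¹ * (y ^ i)⁻¹)) * y ^ i * x := by
              group
          _ = y ^ i * ((x' : G)⁻¹ * x) := by rw [hx]; group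
      have := h3 i (by omega) hi.2 _ (B.mul_mem (B.inv_mem x'.2) x.2) hx1
      exact Subtype.ext (inv_mul_eq_one.1 this).symm
    have hbij : Function.Bijective f := Finite.injective_iff_bijective.1 hinj
    rw [← hB (φ (y ^ i) v)]
    refine Fintype.prod_bijective f hbij _ _ fun x => ?_
    rw [← MulAut.mul_apply, ← map_mul]
    congr 2
    simp only [hf]; group
  rw [hrest, mul_one] at hL
  simpa using hL

lemma exists_elementary_normal {G : Type*} [Group G] [Finite G] [Group.IsSolvable G] [Nontrivial G] :
    ∃ N : Subgroup G, N.Normal ∧ N ≠ ⊥ ∧ (∀ x ∈ N, ∀ y ∈ N, x * y = y * x) ∧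
      ∃ p : ℕ, p.Prime ∧ ∀ x ∈ N, x ^ p = 1 := by
  classical
  have hex := Group.IsSolvable.solvable (G := G)
  obtain ⟨n, hn⟩ : ∃ n, Nat.find hex = n + 1 := by
    refine ⟨Nat.find hex - 1, ?_⟩
    have : Nat.find hex ≠ 0 := by
      intro h
      have := Nat.find_spec hex
      rw [h, derivedSeries_zero] at this
      exact top_ne_bot this
    omega
  set A := derivedSeries G n with hA
  have hAn : A.Normal := derivedSeries_normal G n
  have hA1 : A ≠ ⊥ := Nat.find_min hex (by omega)
  have hAc : ∀ x ∈ A, ∀ y ∈ A, x * y = y * x := by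
    have h := Nat.find_spec hex
    rw [hn, derivedSeries_succ, Subgroup.commutator_eq_bot_iff_le_centralizer] at h
    exact fun x hx y hy => (Subgroup.mem_centralizer_iff.1 (h hy) x hx)
  have hcard : Nat.card A ≠ 1 := fun h => hA1 (A.card_eq_one.1 h)
  set p := (Nat.card A).minFac
  have hp : p.Prime := Nat.minFac_prime hcard
  have := Fact.mk hp
  let N : Subgroup G :=
    { carrier := {x | x ∈ A ∧ x ^ p = 1}
      one_mem' := ⟨A.one_mem, one_pow _⟩
      mul_mem' := fun {x y} hx hy => ⟨A.mul_mem hx.1 hy.1, by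
        rw [(show Commute x y from hAc x hx.1 y hy.1).mul_pow, hx.2, hy.2, one_mul]⟩
      inv_mem' := fun {x} hx => ⟨A.inv_mem hx.1, by rw [inv_pow, hx.2, inv_one]⟩ }
  refine ⟨N, ⟨fun x hx g => ⟨hAn.conj_mem x hx.1 g, by rw [conj_pow, hx.2]; group⟩⟩, ?_,
    fun x hx y hy => hAc x hx.1 y hy.1, p, hp, fun x hx => hx.2⟩
  obtain ⟨x, hx⟩ := exists_prime_orderOf_dvd_card' p (Nat.minFac_dvd (Nat.card A))
  intro h
  have hxN : (x : G) ∈ N := ⟨x.2, by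
    have := pow_orderOf_eq_one x
    rw [hx] at this
    exact_mod_cast congrArg Subtype.val this⟩
  rw [h, Subgroup.mem_bot] at hxN
  have : x = 1 := Subtype.ext hxN
  rw [this, orderOf_one] at hx
  exact hp.one_lt.ne hx

lemma IsPGroup.of_forall_pow_eq_one {p : ℕ} {G : Type*} [Group G] {N : Subgroup G}
    (h : ∀ x ∈ N, x ^ p = 1) : IsPGroup p N := fun x => ⟨1, by
  rw [pow_one]; exact Subtype.ext (by simpa using h x x.2)⟩

/-- A lift of a pair consisting of a `b`-subgroup and an element normalizing it, modulo a normal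
subgroup. -/
lemma exists_normalizing_lift {H : Type*} [Group H] [Finite H] {N : Subgroup H} [N.Normal]
    {b c : ℕ} (hb : b.Prime) (hc : c.Prime) (hbc : b ≠ c) {B : Subgroup (H ⧸ N)}
    (hB : IsPGroup b B) (hB1 : B ≠ ⊥) {y : H ⧸ N} (hyB : y ∈ Subgroup.normalizer (B : Set (H ⧸ N)))
    (hy : c ∣ orderOf y) :
    ∃ (B' : Subgroup H) (y' : H), IsPGroup b B' ∧ B' ≠ ⊥ ∧
      y' ∈ Subgroup.normalizer (B' : Set H) ∧ c ∣ orderOf y' := by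
  have := Fact.mk hb
  set P := B.comap (QuotientGroup.mk' N) with hP
  set M := Subgroup.normalizer (P : Set H) with hM
  set P' := P.subgroupOf M with hP'
  have hP'n : P'.Normal := by rw [hP', hM]; infer_instance
  obtain ⟨y₀, rfl⟩ := QuotientGroup.mk'_surjective N y
  have hyM : y₀ ∈ M := by
    rw [hM, Subgroup.mem_normalizer_iff]
    intro h
    rw [hP, Subgroup.mem_comap, Subgroup.mem_comap, map_mul, map_mul, map_inv]
    exact Subgroup.mem_normalizer_iff.1 hyB _
  obtain ⟨R⟩ : Nonempty (Sylow b P') := inferInstance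
  set R₁ : Subgroup M := (R : Subgroup P').map P'.subtype with hR₁
  have hmem : (⟨y₀, hyM⟩ : M) ∈ Subgroup.normalizer (R₁ : Set M) ⊔ P' := by
    rw [hR₁, R.normalizer_sup_eq_top]; trivial
  obtain ⟨n, hn, k, hk, hnk⟩ := Subgroup.mem_sup_of_normal_right.1 hmem
  refine ⟨R₁.map M.subtype, n, (R.isPGroup'.map _).map _, ?_, ?_, ?_⟩
  · rw [Ne, Subgroup.map_eq_bot_iff_of_injective _ M.subtype_injective, hR₁,
      Subgroup.map_eq_bot_iff_of_injective _ P'.subtype_injective]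
    apply R.ne_bot_of_dvd_card
    obtain ⟨i, hi, hBi⟩ := (hB.nontrivial_iff_card).1 ((Subgroup.nontrivial_iff_ne_bot B).2 hB1)
    have h1 : Nat.card P' = Nat.card P := Nat.card_congr (Subgroup.subgroupOfEquivOfLe
      (Subgroup.le_normalizer)).toEquiv
    have h2 : Nat.card B ∣ Nat.card P := by
      have h3 : P.map (QuotientGroup.mk' N) = B :=
        Subgroup.map_comap_eq_self_of_surjective (QuotientGroup.mk'_surjective N) B
      rw [← h3]
      exact Subgroup.card_map_dvd _ _
    rw [h1]
    refine dvd_trans ?_ h2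
    rw [hBi]
    exact dvd_pow_self _ (by omega)
  · rw [Subgroup.mem_normalizer_iff] at hn ⊢
    intro h
    constructor
    · rintro ⟨t, ht, rfl⟩
      exact ⟨n * t * n⁻¹, (hn t).1 ht, by simp⟩
    · rintro ⟨t, ht, hth⟩
      have e : n * (n⁻¹ * t * n) * n⁻¹ = t := by group
      refine ⟨n⁻¹ * t * n, (hn _).2 (by rw [e]; exact ht), ?_⟩
      simp only [Subgroup.coe_subtype] at hth
      simp [hth, mul_assoc]
  · have h1 : QuotientGroup.mk' P' ⟨y₀, hyM⟩ ^ orderOf n = 1 := by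
      rw [← hnk, map_mul, show QuotientGroup.mk' P' k = 1 from (QuotientGroup.eq_one_iff k).2 hk,
        mul_one, ← map_pow, pow_orderOf_eq_one, map_one]
    rw [← map_pow] at h1
    have h2 : (⟨y₀, hyM⟩ : M) ^ orderOf n ∈ P' := (QuotientGroup.eq_one_iff _).1 h1
    have h3 : QuotientGroup.mk' N y₀ ^ orderOf n ∈ B := by
      rw [← map_pow]
      exact h2
    obtain ⟨i, hi⟩ := hB ⟨_, h3⟩
    have h4 : (QuotientGroup.mk' N y₀ ^ orderOf n) ^ b ^ i = 1 := by
      simpa using congrArg Subtype.val hi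
    rw [← pow_mul] at h4
    have h5 := hy.trans (orderOf_dvd_of_pow_eq_one h4)
    rw [Subgroup.orderOf_coe]
    rcases (hc.dvd_mul).1 h5 with h | h
    · exact h
    · exact absurd ((Nat.prime_dvd_prime_iff_eq hc hb).1 (hc.dvd_of_dvd_pow h)).symm hbc

lemma exists_normalizing_pair (n : ℕ) : ∀ (H : Type) [Group H] [Finite H] [Group.IsSolvable H],
    Nat.card H = n → ∀ {b c : ℕ}, b.Prime → c.Prime → b ≠ c → b ∣ Nat.card H → c ∣ Nat.card H →
    ∃ (B : Subgroup H) (y : H), y ∈ Subgroup.normalizer (B : Set H) ∧ B ≠ ⊥ ∧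
      ((IsPGroup b B ∧ c ∣ orderOf y) ∨ (IsPGroup c B ∧ b ∣ orderOf y)) := by
  induction n using Nat.strong_induction_on with
  | _ n ih =>
    intro H _ _ _ hH b c hb hc hbc hbH hcH
    have hbF := Fact.mk hb
    have hcF := Fact.mk hc
    have : Nontrivial H := by
      rw [← Finite.one_lt_card_iff_nontrivial]
      exact hb.one_lt.trans_le (Nat.le_of_dvd Nat.card_pos hbH)
    obtain ⟨N, hN, hN1, hNc, q, hq, hNq⟩ := exists_elementary_normal (G := H)
    have hqF := Fact.mk hq
    have hNp : IsPGroup q N := IsPGroup.of_forall_pow_eq_one hNq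
    have hnorm : ∀ y, y ∈ Subgroup.normalizer (N : Set H) := by
      rw [Subgroup.normalizer_eq_top]; intro y; trivial
    by_cases hqb : q = b
    · subst hqb
      obtain ⟨y, hy⟩ := exists_prime_orderOf_dvd_card' c hcH
      exact ⟨N, y, hnorm y, hN1, Or.inl ⟨hNp, hy.symm.dvd⟩⟩
    by_cases hqc : q = c
    · subst hqc
      obtain ⟨y, hy⟩ := exists_prime_orderOf_dvd_card' b hbH
      exact ⟨N, y, hnorm y, hN1, Or.inr ⟨hNp, hy.symm.dvd⟩⟩
    have hcard := Subgroup.card_eq_card_quotient_mul_card_subgroup N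
    obtain ⟨i, hi⟩ := (IsPGroup.iff_card).1 hNp
    have hdvd : ∀ s : ℕ, s.Prime → q ≠ s → s ∣ Nat.card H → s ∣ Nat.card (H ⧸ N) := by
      intro s hs hqs hsH
      rw [hcard] at hsH
      rcases (hs.dvd_mul).1 hsH with h | h
      · exact h
      · rw [hi] at h
        exact absurd ((Nat.prime_dvd_prime_iff_eq hs hq).1 (hs.dvd_of_dvd_pow h)).symm hqs
    have hlt : Nat.card (H ⧸ N) < n := by
      have h1 : 1 < Nat.card N := by
        rw [Finite.one_lt_card_iff_nontrivial]; exact (Subgroup.nontrivial_iff_ne_bot N).2 hN1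
      have h2 : 0 < Nat.card (H ⧸ N) := Nat.card_pos
      rw [← hH, hcard]
      nlinarith
    obtain ⟨B, y, hyB, hB1, h⟩ := ih _ hlt (H ⧸ N) rfl hb hc hbc (hdvd b hb hqb hbH)
      (hdvd c hc hqc hcH)
    rcases h with ⟨h1, h2⟩ | ⟨h1, h2⟩
    · obtain ⟨B', y', h3, h4, h5, h6⟩ := exists_normalizing_lift hb hc hbc h1 hB1 hyB h2
      exact ⟨B', y', h5, h4, Or.inl ⟨h3, h6⟩⟩
    · obtain ⟨B', y', h3, h4, h5, h6⟩ := exists_normalizing_lift hc hb hbc.symm h1 hB1 hyB h2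
      exact ⟨B', y', h5, h4, Or.inr ⟨h3, h6⟩⟩

lemma false_of_normalizing_pair {G : Type*} [Group G] [Finite G] {N : Subgroup G} [N.Normal]
    (hN1 : N ≠ ⊥) (hNc : ∀ x ∈ N, ∀ y ∈ N, x * y = y * x) {p b c : ℕ} (hp : p.Prime)
    (hb : b.Prime) (hc : c.Prime) (hpb : p ≠ b) (hpc : p ≠ c) (hbc : b ≠ c)
    (hNp : ∀ x ∈ N, x ^ p = 1)
    (h1 : ∀ g : G, orderOf g ≠ p * b) (h2 : ∀ g : G, orderOf g ≠ p * c)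
    (h3 : ∀ g : G, orderOf g ≠ b * c) {B : Subgroup G} {y : G} (hB : IsPGroup b B) (hB1 : B ≠ ⊥)
    (hyB : y ∈ Subgroup.normalizer (B : Set G)) (hy : c ∣ orderOf y) : False := by
  have := Fact.mk hp
  have := Fact.mk hb
  have := Fact.mk hc
  have hNP : IsPGroup p N := IsPGroup.of_forall_pow_eq_one hNp
  set y' := y ^ (orderOf y / c) with hy'
  have ho : orderOf y' = c := orderOf_pow_orderOf_div (orderOf_pos y).ne' hy
  have hyc : y' ^ c = 1 := by rw [← ho, pow_orderOf_eq_one]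
  have hy'B : y' ∈ Subgroup.normalizer (B : Set G) := Subgroup.pow_mem _ hyB _
  let _ : CommGroup N := { (inferInstance : Group N) with
    mul_comm := fun x y => Subtype.ext (hNc x x.2 y y.2) }
  have hfix : ∀ g : G, ∀ v : N, MulAut.conjNormal g v = v → Commute (v : G) g := by
    intro g v h
    have := congrArg Subtype.val h
    rw [MulAut.conjNormal_apply, mul_inv_eq_iff_eq_mul] at this
    exact this.symm
  have key := pow_card_eq_one_of_fixedPointFree (MulAut.conjNormal (H := N)) hy'B hc.pos hyc
    (fun v hv => by
      by_contra hv1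
      obtain ⟨x, hx, hx1⟩ := B.bot_or_exists_ne_one.resolve_left hB1
      obtain ⟨g, hg⟩ := exists_orderOf_mul_of_commute (hfix x v (hv x hx))
        ((Nat.coprime_primes hp hb).2 hpb)
        (hNP.prime_dvd_orderOf_coe v.2 (fun h => hv1 (Subtype.ext h)))
        (hB.prime_dvd_orderOf_coe hx hx1)
      exact h1 g hg)
    (fun v hv => by
      by_contra hv1
      obtain ⟨g, hg⟩ := exists_orderOf_mul_of_commute (hfix y' v hv)
        ((Nat.coprime_primes hp hc).2 hpc)
        (hNP.prime_dvd_orderOf_coe v.2 (fun h => hv1 (Subtype.ext h))) ho.symm.dvd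
      exact h2 g hg)
    (fun i hi hic x hx hxy => by
      by_contra hx1
      obtain ⟨g, hg⟩ := exists_orderOf_mul_of_commute (show Commute x (y' ^ i) from hxy)
        ((Nat.coprime_primes hb hc).2 hbc) (hB.prime_dvd_orderOf_coe hx hx1)
        (b := c) (by
          rw [Nat.Coprime.orderOf_pow]
          · exact ho.symm.dvd
          · rw [ho]; exact Nat.coprime_of_lt_prime hi.ne' hic hc)
      exact h3 g hg)
  obtain ⟨v, hv, hv1⟩ := N.bot_or_exists_ne_one.resolve_left hN1
  obtain ⟨i, hi⟩ := (IsPGroup.iff_card).1 hB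
  have hvB : v ^ Nat.card B = 1 := by simpa using congrArg Subtype.val (key ⟨v, hv⟩)
  have hd1 := orderOf_dvd_of_pow_eq_one hvB
  have hd2 := hNP.prime_dvd_orderOf_coe hv hv1
  rw [hi] at hd1
  exact hpb ((Nat.prime_dvd_prime_iff_eq hp hb).1 (hp.dvd_of_dvd_pow (hd2.trans hd1)))

lemma exists_orderOf_of_three_primes (n : ℕ) : ∀ (G : Type) [Group G] [Finite G] [Group.IsSolvable G],
    Nat.card G = n → ∀ {a b c : ℕ}, a.Prime → b.Prime → c.Prime → a ≠ b → a ≠ c → b ≠ c →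
    a ∣ Nat.card G → b ∣ Nat.card G → c ∣ Nat.card G →
    (∀ g : G, orderOf g ≠ a * b) → (∀ g : G, orderOf g ≠ a * c) → (∀ g : G, orderOf g ≠ b * c) →
    False := by
  induction n using Nat.strong_induction_on with
  | _ n ih =>
    intro G _ _ _ hG a b c ha hb hc hab hac hbc haG hbG hcG h1 h2 h3
    have : Nontrivial G := by
      rw [← Finite.one_lt_card_iff_nontrivial]
      exact hb.one_lt.trans_le (Nat.le_of_dvd Nat.card_pos hbG)
    obtain ⟨N, hN, hN1, hNc, q, hq, hNq⟩ := exists_elementary_normal (G := G)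
    have hqF := Fact.mk hq
    have hcomm : ∀ {s t : ℕ}, (∀ g : G, orderOf g ≠ s * t) → ∀ g : G, orderOf g ≠ t * s :=
      fun h g => by rw [mul_comm]; exact h g
    have fin : ∀ {b c : ℕ}, b.Prime → c.Prime → q ≠ b → q ≠ c → b ≠ c → b ∣ Nat.card G →
        c ∣ Nat.card G → (∀ g : G, orderOf g ≠ q * b) → (∀ g : G, orderOf g ≠ q * c) →
        (∀ g : G, orderOf g ≠ b * c) → False := by
      intro b c hb hc hqb hqc hbc hbG hcG h1 h2 h3
      obtain ⟨B, y, hyB, hB1, ⟨h4, h5⟩ | ⟨h4, h5⟩⟩ :=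
        exists_normalizing_pair _ G rfl hb hc hbc hbG hcG
      · exact false_of_normalizing_pair hN1 hNc hq hb hc hqb hqc hbc hNq h1 h2 h3 h4 hB1 hyB h5
      · exact false_of_normalizing_pair hN1 hNc hq hc hb hqc hqb hbc.symm hNq h2 h1 (hcomm h3) h4
          hB1 hyB h5
    by_cases hqa : q = a
    · subst hqa; exact fin hb hc hab hac hbc hbG hcG h1 h2 h3
    by_cases hqb : q = b
    · subst hqb; exact fin ha hc hab.symm hbc hac haG hcG (hcomm h1) h3 h2
    by_cases hqc : q = c
    · subst hqc; exact fin ha hb hac.symm hbc.symm hab haG hbG (hcomm h2) (hcomm h3) h1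
    have hNp : IsPGroup q N := IsPGroup.of_forall_pow_eq_one hNq
    have hcard := Subgroup.card_eq_card_quotient_mul_card_subgroup N
    obtain ⟨i, hi⟩ := (IsPGroup.iff_card).1 hNp
    have hdvd : ∀ s : ℕ, s.Prime → q ≠ s → s ∣ Nat.card G → s ∣ Nat.card (G ⧸ N) := by
      intro s hs hqs hsH
      rw [hcard] at hsH
      rcases (hs.dvd_mul).1 hsH with h | h
      · exact h
      · rw [hi] at h
        exact absurd ((Nat.prime_dvd_prime_iff_eq hs hq).1 (hs.dvd_of_dvd_pow h)).symm hqs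
    have hlt : Nat.card (G ⧸ N) < n := by
      have h1 : 1 < Nat.card N := by
        rw [Finite.one_lt_card_iff_nontrivial]; exact (Subgroup.nontrivial_iff_ne_bot N).2 hN1
      have h2 : 0 < Nat.card (G ⧸ N) := Nat.card_pos
      rw [← hG, hcard]
      nlinarith
    have hlift : ∀ {s : ℕ}, (∀ g : G, orderOf g ≠ s) → ∀ g : G ⧸ N, orderOf g ≠ s := by
      intro s hs g hg
      obtain ⟨g', hg'⟩ := exists_orderOf_of_surjective (QuotientGroup.mk'_surjective N) g
      exact hs g' (hg'.trans hg)
    exact ih _ hlt (G ⧸ N) rfl ha hb hc hab hac hbc (hdvd a ha hqa haG) (hdvd b hb hqb hbG)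
      (hdvd c hc hqc hcG) (hlift h1) (hlift h2) (hlift h3)

end Solvable

section Irreducible

open Polynomial

lemma natDegree_eq_orderOf_of_dvd_cyclotomic {F : Type*} [Field F] [Fintype F] {r : ℕ}
    (hr : r.Prime) (hF : ¬ r ∣ Fintype.card F) {P : F[X]} (hP : Irreducible P)
    (hd : P ∣ cyclotomic r F) : P.natDegree = orderOf (Fintype.card F : ZMod r) := by
  obtain ⟨p, -, n, hp, hc⟩ := FiniteField.card' F
  have := Fact.mk hp
  have hpr : p.Coprime r := by
    rw [Nat.coprime_primes hp hr]
    rintro rfl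
    exact hF (hc ▸ dvd_pow_self p n.ne_zero)
  rw [natDegree_of_dvd_cyclotomic_of_irreducible hc hpr hd hP,
    hc, ← orderOf_units, ZMod.coe_unitOfCoprime]

variable {F : Type*} [Field F] [Fintype F] {ι : Type*} [Fintype ι] [DecidableEq ι]

/-- The matrices commuting with a matrix of prime order whose minimal polynomial has maximal
degree form a field. -/
lemma exists_field_of_prime_order {r : ℕ} (hr : r.Prime)
    (hN : orderOf (Fintype.card F : ZMod r) = Fintype.card ι) (hι : 0 < Fintype.card ι)
    {x : Matrix ι ι F} (hx : x ^ r = 1) (hx1 : x ≠ 1) :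
    ∃ P : F[X], Irreducible P ∧ P.Monic ∧ P.natDegree = Fintype.card ι ∧
      ∃ φ : AdjoinRoot P →ₐ[F] Matrix ι ι F, φ (AdjoinRoot.root P) = x ∧
        ∀ g, Commute g x → ∃ a, φ a = g := by
  have hrF : ¬ r ∣ Fintype.card F := by
    intro h
    rw [(ZMod.natCast_eq_zero_iff _ _).2 h] at hN
    have := Fact.mk hr
    rw [orderOf_zero] at hN
    omega
  have hint : IsIntegral F x := Algebra.IsIntegral.isIntegral x
  set M := minpoly F x with hM
  have hMd : M ∣ X ^ r - 1 := minpoly.dvd F x (by simp [hx])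
  have hfac : (X - 1) * cyclotomic r F = X ^ r - 1 := by
    rw [mul_comm]
    have := Fact.mk hr
    exact cyclotomic_prime_mul_X_sub_one F r
  obtain ⟨P, hP, hPm, hPM, hPc⟩ : ∃ P : F[X], Irreducible P ∧ P.Monic ∧ P ∣ M ∧
      P ∣ cyclotomic r F := by
    by_contra! hcon
    have hcop : IsCoprime M (cyclotomic r F) := by
      refine isCoprime_of_irreducible_dvd (fun h => (cyclotomic_ne_zero r F) h.2) ?_
      intro z hz h1 h2
      have hz0 := hz.ne_zero
      refine hcon (z * C z.leadingCoeff⁻¹)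
        (irreducible_mul_leadingCoeff_inv.2 hz) (monic_mul_leadingCoeff_inv hz0) ?_ ?_
      · exact (IsUnit.mul_right_dvd (isUnit_C.2 (by simpa using hz0))).2 h1
      · exact (IsUnit.mul_right_dvd (isUnit_C.2 (by simpa using hz0))).2 h2
    rw [← hfac] at hMd
    have h1 := hcop.dvd_of_dvd_mul_right hMd
    have h2 := (minpoly.dvd_iff).1 h1
    simp only [map_sub, aeval_X, map_one, sub_eq_zero] at h2
    exact hx1 h2
  have hPdeg : P.natDegree = Fintype.card ι :=
    (natDegree_eq_orderOf_of_dvd_cyclotomic hr hrF hP hPc).trans hN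
  have hPM' : P = M := by
    refine (eq_of_monic_of_dvd_of_natDegree_le hPm (minpoly.monic hint) hPM ?_).symm
    rw [hPdeg]
    refine (natDegree_le_of_dvd (minpoly.dvd F x (Matrix.aeval_self_charpoly x))
      (Matrix.charpoly_monic x).ne_zero).trans ?_
    rw [Matrix.charpoly_natDegree_eq_dim]
  let φ : AdjoinRoot P →ₐ[F] Matrix ι ι F := Ideal.Quotient.liftₐ (Ideal.span {P}) (aeval x)
    fun f hf => (minpoly.dvd_iff).1 (hM ▸ hPM' ▸ Ideal.mem_span_singleton.1 hf)
  have hφ : ∀ f, φ (AdjoinRoot.mk P f) = aeval x f := fun f => rfl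
  refine ⟨P, hP, hPm, hPdeg, φ, (hφ X).trans (aeval_X x), ?_⟩
  intro g hg
  obtain ⟨i⟩ : Nonempty ι := Fintype.card_pos_iff.1 hι
  set v : ι → F := Pi.single i 1 with hv
  have hv0 : v ≠ 0 := fun h => by simpa [hv] using congrFun h i
  let L : F[X] →ₗ[F] (ι → F) :=
    (LinearMap.applyₗ v ∘ₗ Matrix.toLin'.toLinearMap) ∘ₗ (aeval x).toLinearMap
  have hL : ∀ f, L f = (aeval x f).mulVec v := fun f => rfl
  let L' : degreeLT F (Fintype.card ι) →ₗ[F] (ι → F) := L ∘ₗ (degreeLT F _).subtype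
  have hinj : Function.Injective L' := by
    rw [injective_iff_map_eq_zero]
    rintro ⟨f, hf⟩ h
    change (aeval x f).mulVec v = 0 at h
    by_contra hf0
    have hf0 : f ≠ 0 := fun h => hf0 (Subtype.ext h)
    have hcop : IsCoprime P f := by
      rw [hP.coprime_iff_not_dvd]
      intro hd
      have := natDegree_le_of_dvd hd hf0
      rw [hPdeg] at this
      rw [mem_degreeLT, ← natDegree_lt_iff_degree_lt hf0] at hf
      omega
    obtain ⟨s, t, hst⟩ := hcop
    have h1 : aeval x (s * P + t * f) = 1 := by rw [hst, map_one]
    rw [map_add, map_mul, map_mul, hPM', minpoly.aeval, mul_zero, zero_add] at h1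
    apply hv0
    rw [← Matrix.one_mulVec v, ← h1, ← Matrix.mulVec_mulVec, h, Matrix.mulVec_zero]
  have hsurj : Function.Surjective L' := by
    refine (LinearMap.injective_iff_surjective_of_finrank_eq_finrank ?_).1 hinj
    rw [(degreeLTEquiv F (Fintype.card ι)).finrank_eq]
    simp
  have hs : ∀ w, ∃ f : F[X], (aeval x f).mulVec v = w := fun w => by
    obtain ⟨f, hf⟩ := hsurj w
    exact ⟨f, hf⟩
  obtain ⟨f, hf⟩ := hs (g.mulVec v)
  refine ⟨AdjoinRoot.mk P f, ?_⟩
  rw [hφ]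
  apply Matrix.toLin'.injective
  refine LinearMap.ext fun w => ?_
  obtain ⟨f', rfl⟩ := hs w
  have hc : Commute g (aeval x f') := by
    have hx : x ∈ Algebra.adjoin F {x} := Algebra.self_mem_adjoin_singleton F x
    refine Polynomial.induction_on' (motive := fun f' => Commute g (aeval x f')) f'
      (fun a b ha hb => by rw [map_add]; exact ha.add_right hb) fun n a => ?_
    rw [aeval_monomial]
    exact (Algebra.commute_algebraMap_right a g).mul_right (hg.pow_right n)
  rw [Matrix.toLin'_apply, Matrix.toLin'_apply, Matrix.mulVec_mulVec, Matrix.mulVec_mulVec, hc.eq,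
    ← map_mul, mul_comm, map_mul, ← Matrix.mulVec_mulVec, hf, Matrix.mulVec_mulVec]

lemma AdjoinRoot.card_eq {P : F[X]} (hP : P.Monic) :
    Nat.card (AdjoinRoot P) = Fintype.card F ^ P.natDegree := by
  rw [Nat.card_congr (AdjoinRoot.powerBasis' hP).basis.equivFun.toEquiv]
  simp

lemma pow_card_sub_one_of_commute {r : ℕ} (hr : r.Prime)
    (hN : orderOf (Fintype.card F : ZMod r) = Fintype.card ι) (hι : 0 < Fintype.card ι)
    {x g : Matrix ι ι F} (hx : x ^ r = 1) (hx1 : x ≠ 1) (hg : Commute g x) (hg0 : g ≠ 0) :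
    g ^ (Fintype.card F ^ Fintype.card ι - 1) = 1 := by
  obtain ⟨P, hP, hPm, hPd, φ, -, h⟩ := exists_field_of_prime_order hr hN hι hx hx1
  obtain ⟨a, rfl⟩ := h g hg
  have := Fact.mk hP
  have hc := AdjoinRoot.card_eq hPm
  have : Finite (AdjoinRoot P) := Nat.finite_of_card_ne_zero (by
    rw [hc]; exact pow_ne_zero _ Fintype.card_ne_zero)
  have := Fintype.ofFinite (AdjoinRoot P)
  rw [Nat.card_eq_fintype_card, hPd] at hc
  rw [← map_pow, ← hc, FiniteField.pow_card_sub_one_eq_one, map_one]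
  rintro rfl
  exact hg0 (map_zero _)

end Irreducible

section SymplecticCentralizer

open Polynomial Matrix

variable {F : Type*} [Field F] [Fintype F] {l : Type*} [Fintype l] [DecidableEq l]

/-- An element of the symplectic group commuting with an element of prime order acting
irreducibly has order dividing `q ^ n + 1`; more precisely its `(q ^ n + 1) / 2`-th power
is `± 1`. -/
lemma SymplecticGroup.pow_half_of_commute {r : ℕ} (hr : r.Prime) (hqo : Odd (Fintype.card F))
    (hN : orderOf (Fintype.card F : ZMod r) = Fintype.card l + Fintype.card l)
    (hl : 0 < Fintype.card l) (hd : r ∣ Fintype.card F ^ Fintype.card l + 1)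
    {x g : symplecticGroup l F} (hx : x ^ r = 1) (hx1 : x ≠ 1) (hg : Commute g x) :
    (g : Matrix (l ⊕ l) (l ⊕ l) F) ^ ((Fintype.card F ^ Fintype.card l + 1) / 2) = 1 ∨
      (g : Matrix (l ⊕ l) (l ⊕ l) F) ^ ((Fintype.card F ^ Fintype.card l + 1) / 2) = -1 := by
  set q := Fintype.card F
  set n := Fintype.card l
  have hx' : (x : Matrix (l ⊕ l) (l ⊕ l) F) ^ r = 1 := by
    rw [← SubmonoidClass.coe_pow, hx, Submonoid.coe_one]
  have hx1' : (x : Matrix (l ⊕ l) (l ⊕ l) F) ≠ 1 := fun h => hx1 (Subtype.ext h)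
  obtain ⟨P, hP, hPm, hPd, φ, hφ, h⟩ := exists_field_of_prime_order hr
    (by rw [hN, Fintype.card_sum]) (by rw [Fintype.card_sum]; omega) hx' hx1'
  obtain ⟨a, ha⟩ := h g (congrArg Subtype.val hg.eq)
  have := Fact.mk hP
  have hJ : J l F * J l F = -1 := J_squared l F
  let ψ : AdjoinRoot P →ₐ[F] Matrix (l ⊕ l) (l ⊕ l) F := AlgHom.ofLinearMap
    { toFun := fun b => -J l F * (φ b)ᵀ * J l F
      map_add' := fun b c => by rw [map_add, transpose_add, Matrix.mul_add, Matrix.add_mul]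
      map_smul' := fun b c => by simp [transpose_smul] }
    (by simp [hJ])
    (fun b c => by
      have : (φ (b * c))ᵀ = (φ b)ᵀ * (φ c)ᵀ := by
        rw [mul_comm, map_mul, transpose_mul]
      simp only [LinearMap.coe_mk, AddHom.coe_mk, this]
      calc -J l F * ((φ b)ᵀ * (φ c)ᵀ) * J l F
          = -J l F * (φ b)ᵀ * -(J l F * J l F) * (φ c)ᵀ * J l F := by
            rw [hJ]; simp [Matrix.mul_assoc]
        _ = _ := by simp [Matrix.mul_assoc])
  have hψ : ∀ y : symplecticGroup l F, ∀ b, φ b = y → ψ b = (y⁻¹ : symplecticGroup l F) := by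
    intro y b hb
    rw [SymplecticGroup.coe_inv, ← hb]
    rfl
  have hσ : ψ = φ.comp ((FiniteField.frobeniusAlgHom F (AdjoinRoot P)) ^ n) := by
    refine AdjoinRoot.algHom_ext ?_
    have e : ((FiniteField.frobeniusAlgHom F (AdjoinRoot P)) ^ n) (AdjoinRoot.root P) =
        AdjoinRoot.root P ^ (q ^ n) := by
      rw [AlgHom.coe_pow, FiniteField.coe_frobeniusAlgHom, pow_iterate]
    rw [hψ x _ hφ, AlgHom.comp_apply, e, map_pow, hφ, ← SubmonoidClass.coe_pow]
    congr 1
    rw [inv_eq_iff_mul_eq_one, ← pow_succ', ← orderOf_dvd_iff_pow_eq_one]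
    exact (orderOf_dvd_of_pow_eq_one hx).trans hd
  have h1 : a ^ (q ^ n + 1) = 1 := by
    have : Nonempty l := Fintype.card_pos_iff.1 hl
    apply φ.toRingHom.injective
    have e : ((FiniteField.frobeniusAlgHom F (AdjoinRoot P)) ^ n) a = a ^ (q ^ n) := by
      rw [AlgHom.coe_pow, FiniteField.coe_frobeniusAlgHom, pow_iterate]
    have := hψ g a ha
    rw [hσ, AlgHom.comp_apply, e] at this
    change φ _ = φ 1
    rw [pow_succ, map_mul, this, ha, ← Submonoid.coe_mul, inv_mul_cancel, map_one,
      Submonoid.coe_one]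
  rw [← two_mul_half_pow_add_one hqo, mul_comm, pow_mul, sq_eq_one_iff] at h1
  rw [← ha, ← map_pow]
  rcases h1 with h1 | h1
  · left; rw [h1, map_one]
  · right; rw [h1, map_neg, map_one]

end SymplecticCentralizer

section Symplectic

open Matrix

variable {F : Type*} [Field F] {l : Type*} [Fintype l] [DecidableEq l]

lemma SymplecticGroup.upper_mem {S : Matrix l l F} (hS : Sᵀ = S) :
    fromBlocks 1 S 0 1 ∈ symplecticGroup l F := by
  rw [SymplecticGroup.mem_iff, J, fromBlocks_transpose, fromBlocks_multiply, fromBlocks_multiply]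
  simp [hS]

lemma SymplecticGroup.lower_mem {S : Matrix l l F} (hS : Sᵀ = S) :
    fromBlocks 1 0 S 1 ∈ symplecticGroup l F := by
  rw [SymplecticGroup.mem_iff, J, fromBlocks_transpose, fromBlocks_multiply, fromBlocks_multiply]
  simp [hS]

lemma SymplecticGroup.sq_eq_one_of_mem_center {z : symplecticGroup l F}
    (hz : z ∈ Subgroup.center (symplecticGroup l F)) : z ^ 2 = 1 := by
  rw [Subgroup.mem_center_iff] at hz
  obtain ⟨a, b, c, d, hzz⟩ : ∃ a b c d, (z : Matrix (l ⊕ l) (l ⊕ l) F) = fromBlocks a b c d :=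
    ⟨_, _, _, _, (fromBlocks_toBlocks _).symm⟩
  have hup : ∀ S : Matrix l l F, Sᵀ = S → S * c = 0 ∧ S * d = a * S := by
    intro S hS
    have h := congrArg Subtype.val (hz ⟨_, SymplecticGroup.upper_mem hS⟩)
    simp only [Submonoid.coe_mul, hzz, fromBlocks_multiply, fromBlocks_inj] at h
    obtain ⟨h1, h2, -, -⟩ := h
    simp only [Matrix.one_mul, Matrix.mul_one, Matrix.mul_zero, add_zero, add_eq_left] at h1 h2
    refine ⟨h1, ?_⟩
    rw [add_comm] at h2
    exact add_right_cancel h2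
  have hlow : b = 0 := by
    have h := congrArg Subtype.val (hz ⟨_, SymplecticGroup.lower_mem (transpose_one (n := l))⟩)
    simp only [Submonoid.coe_mul, hzz, fromBlocks_multiply, fromBlocks_inj] at h
    obtain ⟨h1, -, -, -⟩ := h
    simpa using h1.symm
  obtain ⟨hc, hd⟩ := hup 1 transpose_one
  simp only [Matrix.one_mul, Matrix.mul_one] at hc hd
  subst hc hd hlow
  have hdiag : dᵀ = d := by
    ext i j
    by_cases hij : i = j
    · rw [hij, transpose_apply]
    have key : ∀ i j, i ≠ j → d i j = 0 := fun i j hij => by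
      have h := congrFun (congrFun (hup (diagonal (Pi.single i 1)) (diagonal_transpose _)).2 i) j
      simpa [diagonal_mul, mul_diagonal, Ne.symm hij] using h
    rw [transpose_apply, key i j hij, key j i (Ne.symm hij)]
  have hmem := (SymplecticGroup.mem_iff).1 z.2
  rw [hzz, J, fromBlocks_transpose, fromBlocks_multiply, fromBlocks_multiply, fromBlocks_inj] at hmem
  have h1 : d * d = 1 := by simpa [hdiag] using hmem.2.2.1
  apply Subtype.ext
  rw [SubmonoidClass.coe_pow, hzz, sq, fromBlocks_multiply]
  simp [h1]

lemma SymplecticGroup.orderOf_mk_of_odd {g : symplecticGroup l F} (hg : Odd (orderOf g)) :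
    orderOf (QuotientGroup.mk' (Subgroup.center (symplecticGroup l F)) g) = orderOf g := by
  refine Nat.dvd_antisymm (orderOf_map_dvd _ g) ?_
  set k := orderOf (QuotientGroup.mk' (Subgroup.center (symplecticGroup l F)) g) with hk
  have h1 := pow_orderOf_eq_one (QuotientGroup.mk' (Subgroup.center (symplecticGroup l F)) g)
  rw [← hk, ← map_pow] at h1
  have h2 := SymplecticGroup.sq_eq_one_of_mem_center ((QuotientGroup.eq_one_iff _).1 h1)
  rw [← pow_mul] at h2
  exact (Nat.Coprime.dvd_mul_right (Nat.coprime_two_right.2 hg)).1 (orderOf_dvd_of_pow_eq_one h2)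

lemma SymplecticGroup.mem_center_of_eq {g : symplecticGroup l F}
    (h : (g : Matrix (l ⊕ l) (l ⊕ l) F) = 1 ∨ (g : Matrix (l ⊕ l) (l ⊕ l) F) = -1) :
    g ∈ Subgroup.center (symplecticGroup l F) := by
  rw [Subgroup.mem_center_iff]
  intro x
  apply Subtype.ext
  rcases h with h | h <;> simp [h]

/-- In `PSp` over a field of odd order `q`, the order of an element of order divisible by a
primitive prime divisor of `q ^ (2 * n) - 1` divides `(q ^ n + 1) / 2`. -/
lemma SymplecticGroup.orderOf_quotient_dvd_of_dvd [Fintype F] {r : ℕ} (hr : r.Prime) (hr2 : r ≠ 2)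
    (hqo : Odd (Fintype.card F))
    (hN : orderOf (Fintype.card F : ZMod r) = Fintype.card l + Fintype.card l)
    (hl : 0 < Fintype.card l) (hd : r ∣ Fintype.card F ^ Fintype.card l + 1)
    (y : symplecticGroup l F ⧸ Subgroup.center (symplecticGroup l F)) (hy : r ∣ orderOf y) :
    orderOf y ∣ (Fintype.card F ^ Fintype.card l + 1) / 2 := by
  have : Finite (symplecticGroup l F) := inferInstance
  obtain ⟨g, rfl⟩ := QuotientGroup.mk'_surjective _ y
  set π := QuotientGroup.mk' (Subgroup.center (symplecticGroup l F)) with hπ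
  have hker : ∀ w, π w = 1 → w ^ 2 = 1 := fun w hw =>
    SymplecticGroup.sq_eq_one_of_mem_center ((QuotientGroup.eq_one_iff _).1 hw)
  set x := (g ^ (orderOf (π g) / r)) ^ (r + 1) with hx
  have ho : orderOf (π (g ^ (orderOf (π g) / r))) = r := by
    rw [map_pow]
    exact orderOf_pow_orderOf_div (orderOf_pos _).ne' hy
  have hxr : x ^ r = 1 := by
    have h1 : π ((g ^ (orderOf (π g) / r)) ^ r) = 1 := by
      rw [map_pow]; exact orderOf_dvd_iff_pow_eq_one.1 ho.dvd
    obtain ⟨j, hj⟩ := (hr.odd_of_ne_two hr2).add_one.two_dvd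
    rw [hx, ← pow_mul, mul_comm, pow_mul, hj, pow_mul, hker _ h1, one_pow]
  have hx1 : x ≠ 1 := by
    intro h
    have h1 : π x = 1 := by rw [h, map_one]
    have h2 : π (g ^ (orderOf (π g) / r)) ^ (r + 1) = 1 := by rw [← map_pow]; exact h1
    have h3 := orderOf_dvd_of_pow_eq_one h2
    rw [ho] at h3
    exact hr.one_lt.ne' (Nat.dvd_one.1 ((Nat.dvd_add_right (dvd_refl r)).1 h3))
  have hc : Commute g x := ((Commute.refl g).pow_right _).pow_right _
  have key := SymplecticGroup.pow_half_of_commute hr hqo hN hl hd hxr hx1 hc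
  apply orderOf_dvd_of_pow_eq_one
  rw [← map_pow]
  refine (QuotientGroup.eq_one_iff _).2 (SymplecticGroup.mem_center_of_eq ?_)
  rwa [SubmonoidClass.coe_pow]

end Symplectic

section SymplecticElements

open Matrix

variable {F : Type*} [Field F] {E : Type*} [Field E] [Algebra F E] {l l' : Type*}

lemma transpose_traceMatrix (b : l → E) :
    (Algebra.traceMatrix F b)ᵀ = Algebra.traceMatrix F b := by
  ext i j
  simp [Algebra.traceForm_apply, mul_comm]

variable [Fintype l] [DecidableEq l]

lemma traceMatrix_mul_leftMulMatrix (b : Module.Basis l F E) (a : E) (i j : l) :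
    (Algebra.traceMatrix F b * Algebra.leftMulMatrix b a) i j =
      Algebra.trace F E (a * b j * b i) := by
  rw [← congrFun (Algebra.traceMatrix_of_basis_mulVec b (a * b j)) i, Matrix.mul_apply]
  simp only [mulVec, dotProduct, Algebra.leftMulMatrix_eq_repr_mul, Module.Basis.equivFun_apply]

lemma transpose_leftMulMatrix_mul (b : Module.Basis l F E) (a : E) :
    (Algebra.leftMulMatrix b a)ᵀ * Algebra.traceMatrix F b =
      Algebra.traceMatrix F b * Algebra.leftMulMatrix b a := by
  nth_rw 1 [← transpose_traceMatrix b]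
  rw [← transpose_mul]
  ext i j
  rw [transpose_apply, traceMatrix_mul_leftMulMatrix, traceMatrix_mul_leftMulMatrix]
  congr 1
  ring

/-- Restriction of scalars, extended by the identity on a further symplectic summand. -/
noncomputable def symplecticBlocks (b : Module.Basis l F E) (l' : Type*) [DecidableEq l']
    (A : Matrix (Fin 2) (Fin 2) E) : Matrix ((l ⊕ l') ⊕ (l ⊕ l')) ((l ⊕ l') ⊕ (l ⊕ l')) F :=
  let X := Algebra.traceMatrix F b
  let M := Algebra.leftMulMatrix b
  fromBlocks (fromBlocks (M (A 0 0)) 0 0 1) (fromBlocks (M (A 0 1) * X⁻¹) 0 0 0)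
    (fromBlocks (X * M (A 1 0)) 0 0 0) (fromBlocks (X * M (A 1 1) * X⁻¹) 0 0 1)

variable [Algebra.IsSeparable F E]

lemma isUnit_det_traceMatrix (b : Module.Basis l F E) : IsUnit (Algebra.traceMatrix F b).det := by
  have : FiniteDimensional F E := Module.Finite.of_basis b
  exact isUnit_iff_ne_zero.2 (Algebra.discr_not_zero_of_basis F b)

variable [DecidableEq l']

lemma symplecticBlocks_one (b : Module.Basis l F E) : symplecticBlocks b l' 1 = 1 := by
  simp [symplecticBlocks, mul_nonsing_inv _ (isUnit_det_traceMatrix b)]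

lemma symplecticBlocks_injective (b : Module.Basis l F E) :
    Function.Injective (symplecticBlocks b l' : Matrix (Fin 2) (Fin 2) E → _) := by
  have hX := isUnit_det_traceMatrix b
  have hM := Algebra.leftMulMatrix_injective b
  intro A B h
  simp only [symplecticBlocks, fromBlocks_inj, and_true] at h
  obtain ⟨h1, h2, h3, h4⟩ := h
  have hl : ∀ {P Q : Matrix l l F}, Algebra.traceMatrix F b * P = Algebra.traceMatrix F b * Q →
      P = Q := fun {P Q} h => by
    rw [← nonsing_inv_mul_cancel_left _ P hX, h, nonsing_inv_mul_cancel_left _ Q hX]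
  have hr : ∀ {P Q : Matrix l l F}, P * (Algebra.traceMatrix F b)⁻¹ =
      Q * (Algebra.traceMatrix F b)⁻¹ → P = Q := fun {P Q} h => by
    rw [← nonsing_inv_mul_cancel_right _ P hX, h, nonsing_inv_mul_cancel_right _ Q hX]
  ext i j
  fin_cases i <;> fin_cases j
  · exact hM h1
  · exact hM (hr h2)
  · exact hM (hl h3)
  · exact hM (hl (hr h4))

variable [Fintype l']

lemma symplecticBlocks_mul (b : Module.Basis l F E) (A B : Matrix (Fin 2) (Fin 2) E) :
    symplecticBlocks b l' (A * B) = symplecticBlocks b l' A * symplecticBlocks b l' B := by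
  have hX := isUnit_det_traceMatrix b
  have h1 : ∀ P : Matrix l l F, (Algebra.traceMatrix F b)⁻¹ * (Algebra.traceMatrix F b * P) = P :=
    fun P => nonsing_inv_mul_cancel_left _ _ hX
  simp only [symplecticBlocks, fromBlocks_multiply, Matrix.mul_apply, Fin.sum_univ_two, map_add,
    map_mul, Matrix.mul_zero, Matrix.zero_mul, add_zero, zero_add, Matrix.mul_one, fromBlocks_add,
    Matrix.mul_add, Matrix.add_mul, Matrix.mul_assoc, h1]

lemma symplecticBlocks_mem (b : Module.Basis l F E) {A : Matrix (Fin 2) (Fin 2) E}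
    (hA : A.det = 1) : symplecticBlocks b l' A ∈ symplecticGroup (l ⊕ l') F := by
  have hX := isUnit_det_traceMatrix b
  set X := Algebra.traceMatrix F b with hXX
  have hXt : Xᵀ = X := transpose_traceMatrix b
  have hXi : X⁻¹ᵀ = X⁻¹ := by rw [transpose_nonsing_inv, hXt]
  have hM : ∀ a, (Algebra.leftMulMatrix b a)ᵀ = X * Algebra.leftMulMatrix b a * X⁻¹ := fun a => by
    rw [← transpose_leftMulMatrix_mul, mul_nonsing_inv_cancel_right _ _ hX]
  have h1 : ∀ P : Matrix l l F, X⁻¹ * (X * P) = P := fun P => nonsing_inv_mul_cancel_left _ _ hX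
  have hc : ∀ a c, Algebra.leftMulMatrix b a * Algebra.leftMulMatrix b c =
      Algebra.leftMulMatrix b (a * c) := fun a c => (map_mul _ _ _).symm
  have hc' : ∀ a c (P : Matrix l l F), Algebra.leftMulMatrix b a * (Algebra.leftMulMatrix b c * P) =
      Algebra.leftMulMatrix b (a * c) * P := fun a c P => by rw [← Matrix.mul_assoc, hc]
  rw [det_fin_two, sub_eq_iff_eq_add'] at hA
  rw [SymplecticGroup.mem_iff, symplecticBlocks, J, fromBlocks_transpose, fromBlocks_multiply,
    fromBlocks_multiply]
  simp only [fromBlocks_transpose, fromBlocks_multiply, transpose_mul, hM, hXi, hXt, ← hXX,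
    transpose_zero, transpose_one, Matrix.mul_zero, Matrix.zero_mul, add_zero, zero_add,
    Matrix.mul_one, Matrix.mul_neg, Matrix.neg_mul, fromBlocks_neg, fromBlocks_add, neg_zero,
    Matrix.mul_assoc, h1, hc, hc', nonsing_inv_mul _ hX, hA, map_add, map_one]
  rw [fromBlocks_inj]
  refine ⟨?_, ?_, ?_, ?_⟩
  · rw [mul_comm (A 0 1) (A 0 0)]; simp
  · rw [mul_comm (A 0 1) (A 1 0), ← fromBlocks_one, fromBlocks_neg]
    simp
  · rw [mul_comm (A 1 1) (A 0 0), hA, mul_comm (A 1 0) (A 0 1)]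
    simp [Matrix.add_mul, Matrix.mul_add, mul_nonsing_inv _ hX]
  · rw [mul_comm (A 1 0) (A 1 1)]
    simp

lemma exists_symplectic_orderOf (b : Module.Basis l F E) {ι : Type*} [Fintype ι] [DecidableEq ι]
    (e : l ⊕ l' ≃ ι) {A : Matrix (Fin 2) (Fin 2) E} (hA : A.det = 1) :
    ∃ g : symplecticGroup ι F, orderOf g = orderOf A := by
  let f : Matrix (Fin 2) (Fin 2) E →* Matrix (ι ⊕ ι) (ι ⊕ ι) F :=
    (reindexAlgEquiv F F (Equiv.sumCongr e e) : _ →* _).comp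
      { toFun := symplecticBlocks b l'
        map_one' := symplecticBlocks_one b
        map_mul' := symplecticBlocks_mul b }
  have hf : Function.Injective f :=
    (reindexAlgEquiv F F (Equiv.sumCongr e e)).injective.comp (symplecticBlocks_injective b)
  have hmem : f A ∈ symplecticGroup ι F := by
    have h := (SymplecticGroup.mem_iff).1 (symplecticBlocks_mem (l' := l') b hA)
    rw [SymplecticGroup.mem_iff]
    have hJ : J ι F = reindexAlgEquiv F F (Equiv.sumCongr e e) (J (l ⊕ l') F) := by
      ext i j
      rcases i with i | i <;> rcases j with j | j <;> simp [J, Matrix.one_apply]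
    have ht : (f A)ᵀ = reindexAlgEquiv F F (Equiv.sumCongr e e) (symplecticBlocks b l' A)ᵀ := rfl
    have hA' : f A = reindexAlgEquiv F F (Equiv.sumCongr e e) (symplecticBlocks b l' A) := rfl
    rw [ht, hA', hJ, ← map_mul, ← map_mul, h]
  refine ⟨⟨f A, hmem⟩, ?_⟩
  rw [← orderOf_submonoid, ← orderOf_injective f hf]

lemma exists_orderOf_eq_card_add_one [Fintype E] :
    ∃ A : Matrix (Fin 2) (Fin 2) E, A.det = 1 ∧ orderOf A = Fintype.card E + 1 := by
  obtain ⟨p, hp⟩ := CharP.exists E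
  have := Fact.mk (CharP.char_is_prime E p)
  let E₂ := FiniteField.Extension E p 2
  have := Fintype.ofFinite E₂
  have hc : Fintype.card E₂ = Fintype.card E ^ 2 := by
    rw [Fintype.card_eq_nat_card, FiniteField.natCard_extension, Nat.card_eq_fintype_card]
  let b : Module.Basis (Fin 2) E E₂ :=
    Module.finBasisOfFinrankEq E E₂ (FiniteField.finrank_extension E p 2)
  obtain ⟨w, hw⟩ := IsCyclic.exists_generator (α := E₂ˣ)
  have ho : orderOf w = (Fintype.card E - 1) * (Fintype.card E + 1) := by
    rw [orderOf_eq_card_of_forall_mem_zpowers hw, Nat.card_units, Nat.card_eq_fintype_card, hc,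
      mul_comm, ← Nat.sq_sub_sq, one_pow]
  have hE : 0 < Fintype.card E - 1 := Nat.sub_pos_of_lt Fintype.one_lt_card
  set z := w ^ (Fintype.card E - 1) with hz
  have hoz : orderOf z = Fintype.card E + 1 := by
    rw [hz, orderOf_pow_of_dvd hE.ne' (ho ▸ dvd_mul_right _ _), ho, Nat.mul_div_cancel_left _ hE]
  refine ⟨Algebra.leftMulMatrix b (z : E₂), ?_, ?_⟩
  · rw [← Algebra.norm_eq_matrix_det]
    apply (algebraMap E E₂).injective
    rw [FiniteField.algebraMap_norm_eq_pow_sum, FiniteField.finrank_extension, map_one,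
      Finset.sum_range_succ, Finset.sum_range_one, pow_zero, pow_one, Nat.card_eq_fintype_card,
      ← Units.val_pow_eq_pow_val, add_comm, ← hoz, pow_orderOf_eq_one, Units.val_one]
  · rw [← hoz, ← orderOf_units]
    exact orderOf_injective (Algebra.leftMulMatrix b).toMonoidHom
      (Algebra.leftMulMatrix_injective b) _

lemma exists_orderOf_eq_card_sub_one [Fintype E] :
    ∃ A : Matrix (Fin 2) (Fin 2) E, A.det = 1 ∧ orderOf A = Fintype.card E - 1 := by
  obtain ⟨w, hw⟩ := IsCyclic.exists_generator (α := Eˣ)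
  have ho : orderOf w = Fintype.card E - 1 := by
    rw [orderOf_eq_card_of_forall_mem_zpowers hw, Nat.card_units, Nat.card_eq_fintype_card]
  refine ⟨diagonal ![(w : E), (w⁻¹ : Eˣ)], by simp [det_diagonal], ?_⟩
  rw [← ho]
  refine orderOf_eq_orderOf_iff.2 fun k => ?_
  rw [diagonal_pow, diagonal_eq_one]
  constructor
  · intro h
    have := congrFun h 0
    exact Units.ext (by simpa using this)
  · intro h
    ext i
    fin_cases i
    · simp [← Units.val_pow_eq_pow_val, h]
    · simp [← Units.val_pow_eq_pow_val, inv_pow, h]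

end SymplecticElements

open Matrix in
lemma exists_PSp_orderOf {F : Type*} [Field F] [Fintype F] {n d N : ℕ} (hd : d ≠ 0) (hdn : d ≤ n)
    (hN : Odd N) (h : N ∣ Fintype.card F ^ d - 1 ∨ N ∣ Fintype.card F ^ d + 1) :
    ∃ y : PSp n F, orderOf y = N := by
  obtain ⟨p, hp⟩ := CharP.exists F
  have := Fact.mk (CharP.char_is_prime F p)
  have := NeZero.mk hd
  let E := FiniteField.Extension F p d
  have := Fintype.ofFinite E
  have hc : Fintype.card E = Fintype.card F ^ d := by
    rw [Fintype.card_eq_nat_card, FiniteField.natCard_extension, Nat.card_eq_fintype_card]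
  let b : Module.Basis (Fin d) F E :=
    Module.finBasisOfFinrankEq F E (FiniteField.finrank_extension F p d)
  obtain ⟨A, hA, hAN⟩ : ∃ A : Matrix (Fin 2) (Fin 2) E, A.det = 1 ∧ N ∣ orderOf A := by
    rcases h with h | h
    · obtain ⟨A, hA, ho⟩ := exists_orderOf_eq_card_sub_one (E := E)
      exact ⟨A, hA, by rwa [ho, hc]⟩
    · obtain ⟨A, hA, ho⟩ := exists_orderOf_eq_card_add_one (E := E)
      exact ⟨A, hA, by rwa [ho, hc]⟩
  obtain ⟨g, hg⟩ := exists_symplectic_orderOf b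
    ((finSumFinEquiv (m := d) (n := n - d)).trans (finCongr (Nat.add_sub_cancel' hdn))) hA
  obtain ⟨g', hg'⟩ := exists_orderOf_of_dvd (hg ▸ hAN)
  exact ⟨_, (SymplecticGroup.orderOf_mk_of_odd (hg' ▸ hN)).trans hg'⟩

section Orbits

variable {Γ : Type*} [CommGroup Γ] {q s t d N : ℕ} {x : Γ}

lemma injOn_pow_pow_of_dvd_orderOf (hs : orderOf (q : ZMod s) = N) (hx : s ∣ orderOf x)
    (hN : N ≠ 0) : Set.InjOn (fun i => x ^ q ^ i) (Finset.range N) := by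
  intro i hi j hj hij
  rw [Finset.coe_range, Set.mem_Iio] at hi hj
  have h1 : q ^ i ≡ q ^ j [MOD s] := (pow_eq_pow_iff_modEq.1 hij).of_dvd hx
  rw [← ZMod.natCast_eq_natCast_iff, Nat.cast_pow, Nat.cast_pow] at h1
  have hu : IsUnit (q : ZMod s) := by
    refine IsUnit.of_pow_eq_one (n := N) (hs ▸ pow_orderOf_eq_one _) hN
  obtain ⟨w, hw⟩ := hu
  rw [← hw, ← Units.val_pow_eq_pow_val, ← Units.val_pow_eq_pow_val, Units.val_inj,
    pow_eq_pow_iff_modEq, ← orderOf_units, hw, hs] at h1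
  exact Nat.ModEq.eq_of_lt_of_lt h1 hi hj

lemma pow_pow_mul_pow_pow_ne_one (hs2 : 2 < s) (hs : orderOf (q : ZMod s) = d) (hd : Odd d)
    (hx : s ∣ orderOf x) (i j : ℕ) : x ^ q ^ i * x ^ q ^ j ≠ 1 := by
  intro h
  have := Fact.mk hs2
  rw [← pow_add] at h
  have h1 : s ∣ q ^ i + q ^ j := hx.trans (orderOf_dvd_of_pow_eq_one h)
  rw [← ZMod.natCast_eq_zero_iff, Nat.cast_add, Nat.cast_pow, Nat.cast_pow,
    add_eq_zero_iff_eq_neg] at h1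
  have h2 := congrArg (· ^ d) h1
  have hp : (q : ZMod s) ^ d = 1 := hs ▸ pow_orderOf_eq_one _
  simp only [hd.neg_pow, ← pow_mul, mul_comm _ d] at h2
  rw [pow_mul, pow_mul, hp, one_pow, one_pow] at h2
  exact ZMod.neg_one_ne_one h2.symm

lemma card_union_inv_orbit [DecidableEq Γ] (hs2 : 2 < s) (hs : orderOf (q : ZMod s) = d)
    (hd : Odd d) (hx : s ∣ orderOf x)
    (hinj : Set.InjOn (fun i => x ^ q ^ i) (Finset.range N)) :
    ((Finset.range N).image (fun i => x ^ q ^ i) ∪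
      ((Finset.range N).image (fun i => x ^ q ^ i)).image (fun y => y⁻¹)).card = N + N := by
  rw [Finset.card_union_of_disjoint, Finset.card_image_of_injective _ inv_injective,
    Finset.card_image_of_injOn hinj, Finset.card_range]
  rw [Finset.disjoint_left]
  intro y hy hy'
  simp only [Finset.mem_image] at hy hy'
  obtain ⟨i, -, rfl⟩ := hy
  obtain ⟨-, ⟨j, -, rfl⟩, h⟩ := hy'
  exact pow_pow_mul_pow_pow_ne_one hs2 hs hd hx i j (by rw [← h, inv_mul_cancel])

lemma four_mul_le_card [DecidableEq Γ] {R : Finset Γ} (hpow : ∀ x ∈ R, x ^ q ∈ R)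
    (hinv : ∀ x ∈ R, x⁻¹ ∈ R) (hs : s.Prime) (ht : t.Prime) (hs2 : s ≠ 2)
    (hds : orderOf (q : ZMod s) = d) (hdt : orderOf (q : ZMod t) = 2 * d) (hd : Odd d)
    (hR : ∀ x ∈ R, x ^ (s * t) = 1) (hx : ∃ x ∈ R, x ^ t ≠ 1) (hy : ∃ y ∈ R, y ^ s ≠ 1) :
    4 * d ≤ R.card := by
  have hs2 : 2 < s := lt_of_le_of_ne hs.two_le hs2.symm
  have hd0 : d ≠ 0 := hd.pos.ne'
  have horb : ∀ x ∈ R, ∀ i, x ^ q ^ i ∈ R := by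
    intro x hx i
    induction i with
    | zero => simpa using hx
    | succ i ih => rw [pow_succ, pow_mul]; exact hpow _ ih
  have hdvds : ∀ x ∈ R, x ^ t ≠ 1 → s ∣ orderOf x := fun x hx h => by
    have := Fact.mk hs
    rw [← orderOf_eq_prime (p := s) (by rw [← pow_mul, mul_comm, hR x hx]) h]
    exact orderOf_pow_dvd t
  have hdvdt : ∀ x ∈ R, x ^ s ≠ 1 → t ∣ orderOf x := fun x hx h => by
    have := Fact.mk ht
    rw [← orderOf_eq_prime (p := t) (by rw [← pow_mul, hR x hx]) h]
    exact orderOf_pow_dvd s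
  have hsub : ∀ x ∈ R, ∀ N, (Finset.range N).image (fun i => x ^ q ^ i) ∪
      ((Finset.range N).image (fun i => x ^ q ^ i)).image (fun y => y⁻¹) ⊆ R := by
    intro x hx N y hy
    simp only [Finset.mem_union, Finset.mem_image] at hy
    rcases hy with ⟨i, -, rfl⟩ | ⟨-, ⟨i, -, rfl⟩, rfl⟩
    · exact horb x hx i
    · exact hinv _ (horb x hx i)
  obtain ⟨x, hxR, hx⟩ := hx
  obtain ⟨y, hyR, hy⟩ := hy
  have hinjy := injOn_pow_pow_of_dvd_orderOf hdt (hdvdt y hyR hy) (mul_ne_zero two_ne_zero hd0)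
  by_cases hxs : x ^ s = 1
  · have h1 := card_union_inv_orbit hs2 hds hd (hdvds x hxR hx)
      (injOn_pow_pow_of_dvd_orderOf hds (hdvds x hxR hx) hd0)
    have h2 : ((Finset.range (2 * d)).image (fun i => y ^ q ^ i)).card = 2 * d := by
      rw [Finset.card_image_of_injOn hinjy, Finset.card_range]
    have hdisj : Disjoint ((Finset.range d).image (fun i => x ^ q ^ i) ∪
        ((Finset.range d).image (fun i => x ^ q ^ i)).image (fun y => y⁻¹))
        ((Finset.range (2 * d)).image (fun i => y ^ q ^ i)) := by
      rw [Finset.disjoint_left]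
      intro z hz hz'
      have hzs : z ^ s = 1 := by
        simp only [Finset.mem_union, Finset.mem_image] at hz
        rcases hz with ⟨i, -, rfl⟩ | ⟨-, ⟨i, -, rfl⟩, rfl⟩ <;>
          simp [inv_pow, pow_right_comm x _ s, hxs]
      simp only [Finset.mem_image] at hz'
      obtain ⟨i, -, rfl⟩ := hz'
      rw [pow_right_comm] at hzs
      have hc : t ∣ q ^ i := by
        have := Fact.mk ht
        rw [← orderOf_eq_prime (p := t) (by rw [← pow_mul, hR y hyR]) hy]
        exact orderOf_dvd_of_pow_eq_one hzs
      have hq := ht.dvd_of_dvd_pow hc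
      rw [← ZMod.natCast_eq_zero_iff] at hq
      have := Fact.mk ht
      rw [hq, orderOf_zero] at hdt
      omega
    have h3 := Finset.card_le_card (Finset.union_subset (hsub x hxR d)
      (Finset.subset_union_left.trans (hsub y hyR (2 * d))))
    rw [Finset.card_union_of_disjoint hdisj, h1, h2] at h3
    omega
  · have h1 := card_union_inv_orbit hs2 hds hd (hdvds x hxR hx)
      (injOn_pow_pow_of_dvd_orderOf hdt (hdvdt x hxR hxs) (mul_ne_zero two_ne_zero hd0))
    have := Finset.card_le_card (hsub x hxR (2 * d))
    omega

end Orbits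

section EigenvalueOrbits

open Matrix Polynomial

variable {F : Type*} [Field F] {ι : Type*} [Fintype ι] [DecidableEq ι]

lemma Matrix.pow_eq_one_of_forall_aeval_charpoly {M : Matrix ι ι F} {N k : ℕ} (hN : (N : F) ≠ 0)
    (hk : k ≠ 0) (hM : M ^ N = 1)
    (h : ∀ z : AlgebraicClosure F, aeval z M.charpoly = 0 → z ^ k = 1) : M ^ k = 1 := by
  have hd : minpoly F M ∣ X ^ N - C 1 := minpoly.dvd F M (by simp [hM])
  have hsep := ((separable_X_pow_sub_C (1 : F) hN one_ne_zero).of_dvd hd).map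
    (f := algebraMap F (AlgebraicClosure F))
  have h0 : (minpoly F M).map (algebraMap F (AlgebraicClosure F)) ≠ 0 :=
    map_ne_zero (minpoly.ne_zero (Matrix.isIntegral M))
  have h1 : (X ^ k - C 1 : F[X]).map (algebraMap F (AlgebraicClosure F)) ≠ 0 :=
    map_ne_zero (X_pow_sub_C_ne_zero (Nat.pos_of_ne_zero hk) _)
  have hdvd : minpoly F M ∣ X ^ k - C 1 := by
    rw [← map_dvd_map' (algebraMap F (AlgebraicClosure F)), IsAlgClosed.dvd_iff_roots_le_roots h0 h1,
      Multiset.le_iff_subset (nodup_roots hsep)]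
    intro z hz
    rw [mem_roots h0, IsRoot.def, eval_map_algebraMap] at hz
    obtain ⟨w, hw⟩ := M.minpoly_dvd_charpoly
    have hz' := h z (by rw [hw, map_mul, hz, zero_mul])
    rw [mem_roots h1, IsRoot.def, eval_map_algebraMap]
    simp [hz']
  obtain ⟨w, hw⟩ := hdvd
  have := congrArg (aeval M) hw
  rw [map_mul, minpoly.aeval, zero_mul] at this
  simpa [sub_eq_zero] using this

lemma Matrix.four_mul_le_card [Fintype F] {M : Matrix ι ι F} {s t d : ℕ} (hs : s.Prime)
    (ht : t.Prime) (hs2 : s ≠ 2) (hds : orderOf (Fintype.card F : ZMod s) = d)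
    (hdt : orderOf (Fintype.card F : ZMod t) = 2 * d) (hd : Odd d) (hst : M ^ (s * t) = 1)
    (hMs : M ^ s ≠ 1) (hMt : M ^ t ≠ 1) (hinv : M⁻¹.charpoly = M.charpoly) :
    4 * d ≤ Fintype.card ι := by
  classical
  have hchar : ∀ {a : ℕ}, a.Prime → orderOf (Fintype.card F : ZMod a) ≠ 0 → (a : F) ≠ 0 := by
    intro a ha hoa hz
    have := Fact.mk ha
    obtain ⟨p, hp⟩ := CharP.exists F
    have hpa := (Nat.prime_dvd_prime_iff_eq (CharP.char_is_prime F p) ha).1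
      ((CharP.cast_eq_zero_iff F p a).1 hz)
    subst hpa
    have : (Fintype.card F : ZMod p) = 0 := by
      rw [ZMod.natCast_eq_zero_iff]
      exact (CharP.cast_eq_zero_iff F p _).1 (FiniteField.cast_card_eq_zero F)
    rw [this, orderOf_zero] at hoa
    exact hoa rfl
  have hN : ((s * t : ℕ) : F) ≠ 0 := by
    rw [Nat.cast_mul]
    exact mul_ne_zero (hchar hs (hds ▸ hd.pos.ne'))
      (hchar ht (hdt ▸ mul_ne_zero two_ne_zero hd.pos.ne'))
  have hMu : IsUnit M := IsUnit.of_pow_eq_one hst (mul_ne_zero hs.ne_zero ht.ne_zero)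
  have hroot : ∀ z : AlgebraicClosure F, aeval z M.charpoly = 0 → z ^ (s * t) = 1 := by
    intro z hz
    have h1 : z ∈ spectrum _ (M.map (algebraMap F (AlgebraicClosure F))) := by
      rw [Matrix.mem_spectrum_iff_isRoot_charpoly, Matrix.charpoly_map, IsRoot.def,
        eval_map_algebraMap, hz]
    have h2 := spectrum.pow_mem_pow _ (s * t) h1
    rw [← RingHom.mapMatrix_apply, ← map_pow, hst, map_one] at h2
    have : Nontrivial (Matrix ι ι (AlgebraicClosure F)) := by
      by_contra hc
      rw [not_nontrivial_iff_subsingleton] at hc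
      exact absurd h2 (by simp)
    rwa [spectrum.one_eq, Set.mem_singleton_iff] at h2
  set R : Finset (AlgebraicClosure F)ˣ :=
    (M.charpoly.rootSet (AlgebraicClosure F)).toFinset.preimage _ Units.val_injective.injOn with hR
  have hmem : ∀ z : (AlgebraicClosure F)ˣ, z ∈ R ↔ aeval (z : AlgebraicClosure F) M.charpoly = 0 := by
    intro z
    rw [hR, Finset.mem_preimage, Set.mem_toFinset, mem_rootSet_of_ne M.charpoly_monic.ne_zero]
  have hcard : R.card ≤ Fintype.card ι := by
    rw [← M.charpoly_natDegree_eq_dim]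
    refine (Finset.card_le_card_of_injOn _ (fun z hz => Finset.mem_preimage.1 hz)
      Units.val_injective.injOn).trans ?_
    rw [← Set.ncard_eq_toFinset_card']
    exact M.charpoly.ncard_rootSet_le _
  have hex : ∀ k, k ≠ 0 → M ^ k ≠ 1 → ∃ z ∈ R, z ^ k ≠ 1 := by
    intro k hk hMk
    by_contra! hc
    refine hMk (Matrix.pow_eq_one_of_forall_aeval_charpoly hN hk hst fun z hz => ?_)
    have hzu : IsUnit z := IsUnit.of_pow_eq_one (hroot z hz) (mul_ne_zero hs.ne_zero ht.ne_zero)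
    obtain ⟨w, rfl⟩ := hzu
    rw [← Units.val_pow_eq_pow_val, hc w ((hmem w).2 hz), Units.val_one]
  refine (_root_.four_mul_le_card (R := R) ?_ ?_ hs ht hs2 hds hdt hd ?_ (hex t ht.ne_zero hMt)
    (hex s hs.ne_zero hMs)).trans hcard
  · intro z hz
    rw [hmem] at hz ⊢
    rw [Units.val_pow_eq_pow_val]
    have := aeval_algHom_apply (FiniteField.frobeniusAlgHom F (AlgebraicClosure F))
      (z : AlgebraicClosure F) M.charpoly
    rwa [hz, map_zero] at this
  · intro z hz
    rw [hmem] at hz ⊢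
    rw [← hinv, Matrix.charpoly_inv _ hMu, map_mul, ← Matrix.reverse_charpoly,
      Units.val_inv_eq_inv_val]
    have := (eval₂_reverse_eq_zero_iff (algebraMap F (AlgebraicClosure F)) (z : AlgebraicClosure F)
      M.charpoly).2 hz
    rw [invOf_eq_inv] at this
    rw [aeval_def _ (reverse _), this, mul_zero]
  · intro z hz
    exact Units.ext (by rw [Units.val_pow_eq_pow_val]; exact hroot z ((hmem z).1 hz))

end EigenvalueOrbits

section PrimitivePrimes

lemma exists_prime_orderOf_intCast_eq {a : ℤ} {d : ℕ} (ha : Odd a) (ha3 : 3 ≤ a.natAbs)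
    (hd : d.Prime) (hd5 : 5 ≤ d) : ∃ s : ℕ, s.Prime ∧ s ≠ 2 ∧ orderOf (a : ZMod s) = d := by
  have hdo : Odd d := hd.odd_of_ne_two (by omega)
  set N := ∑ i ∈ Finset.range d, a ^ i with hN
  have hgeom : N * (a - 1) = a ^ d - 1 := geom_sum_mul a d
  have hNodd : Odd N := by
    have h1 : (a : ZMod 2) = 1 := ZMod.intCast_eq_one_iff_odd.2 ha
    rw [← ZMod.intCast_eq_one_iff_odd, hN]
    push_cast
    simpa [h1] using ZMod.natCast_eq_one_iff_odd.2 hdo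
  have hdvd : ∀ s : ℕ, s.Prime → (s : ℤ) ∣ N → s = d ∧ (a : ZMod s) = 1 ∨
      orderOf (a : ZMod s) = d := by
    intro s hs hsN
    have := Fact.mk hs
    have h1 : (a : ZMod s) ^ d = 1 := by
      have := (hsN.mul_right (a - 1))
      rw [hgeom, ← ZMod.intCast_zmod_eq_zero_iff_dvd] at this
      push_cast at this
      exact sub_eq_zero.1 this
    rcases (Nat.dvd_prime hd).1 (orderOf_dvd_of_pow_eq_one h1) with h | h
    · left
      rw [orderOf_eq_one_iff] at h
      refine ⟨?_, h⟩
      rw [← ZMod.intCast_zmod_eq_zero_iff_dvd, hN] at hsN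
      push_cast at hsN
      simp only [h, one_pow, Finset.sum_const, Finset.card_range, nsmul_eq_mul, mul_one] at hsN
      rw [ZMod.natCast_eq_zero_iff] at hsN
      exact (Nat.prime_dvd_prime_iff_eq hs hd).1 hsN
    · exact Or.inr h
  by_contra! hno
  have hall : ∀ s : ℕ, s.Prime → s ∣ N.natAbs → s = d ∧ (a : ZMod s) = 1 := by
    intro s hs hsN
    refine (hdvd s hs (Int.natCast_dvd.2 hsN)).resolve_right (hno s hs ?_)
    rintro rfl
    exact (Int.not_even_iff_odd.2 hNodd) (even_iff_two_dvd.2 (Int.natCast_dvd.2 hsN))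
  have hN0 : N.natAbs ≠ 0 := by
    intro h
    rw [Int.natAbs_eq_zero] at h
    exact absurd hNodd (by rw [h]; decide)
  have hpow := Nat.eq_prime_pow_of_unique_prime_dvd hN0 fun {s} hs hsN => (hall s hs hsN).1
  have hle : N.natAbs ≤ d := by
    by_cases hdN : d ^ 2 ∣ N.natAbs
    · exfalso
      have h1 := (hall d hd ((dvd_pow_self d two_ne_zero).trans hdN)).2
      rw [← sub_eq_zero] at h1
      have h2 : (d : ℤ) ∣ a - 1 := by
        rw [← ZMod.intCast_zmod_eq_zero_iff_dvd]
        push_cast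
        exact h1
      obtain ⟨c, hc⟩ := h2
      have h3 := odd_sq_dvd_geom_sum₂_sub (1 : ℤ) c hdo
      rw [← hc] at h3
      simp only [add_sub_cancel, one_pow, mul_one] at h3
      rw [← hN] at h3
      have h4 : (d : ℤ) ^ 2 ∣ N := by
        have := Int.natCast_dvd.2 hdN
        rwa [Nat.cast_pow] at this
      have h5 := (dvd_sub_right h4).1 h3
      rw [← Nat.cast_pow, Int.natCast_dvd_natCast] at h5
      have := Nat.le_of_dvd hd.pos h5
      nlinarith
    · rw [hpow] at hdN ⊢
      have : N.natAbs.primeFactorsList.length < 2 := by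
        by_contra! h
        exact hdN (pow_dvd_pow d h)
      calc d ^ _ ≤ d ^ 1 := Nat.pow_le_pow_right hd.pos (by omega)
        _ = d := pow_one d
  have hg := congrArg Int.natAbs hgeom
  rw [Int.natAbs_mul] at hg
  have h1 : a.natAbs ^ d ≤ (a ^ d - 1).natAbs + 1 := by
    rw [← Int.natAbs_pow]; omega
  have h2 : (a - 1).natAbs ≤ a.natAbs + 1 := by omega
  have h3 : a.natAbs ^ d ≤ d * (a.natAbs + 1) + 1 := by
    rw [← hg] at h1
    exact h1.trans (Nat.add_le_add_right (Nat.mul_le_mul hle h2) 1)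
  have h4 : ∀ k, 2 * (k + 5) + 1 < 3 ^ (k + 4) := by
    intro k
    induction k with
    | zero => norm_num
    | succ k ih => rw [show k + 1 + 4 = k + 4 + 1 by ring, pow_succ]; omega
  obtain ⟨k, rfl⟩ := Nat.exists_eq_add_of_le' hd5
  have h5 : 3 ^ (k + 4) ≤ a.natAbs ^ (k + 4) := Nat.pow_le_pow_left ha3 _
  rw [show k + 5 = k + 4 + 1 by ring, pow_succ] at h3
  have h6 := h4 k
  have h7 : (2 * (k + 5) + 2) * a.natAbs ≤ a.natAbs ^ (k + 4) * a.natAbs :=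
    Nat.mul_le_mul_right _ (by omega)
  nlinarith

lemma exists_primes_orderOf_eq {q d : ℕ} (hqo : Odd q) (hq : 3 ≤ q) (hd : d.Prime) (hd5 : 5 ≤ d) :
    ∃ s t : ℕ, s.Prime ∧ t.Prime ∧ s ≠ 2 ∧ t ≠ 2 ∧ orderOf (q : ZMod s) = d ∧
      orderOf (q : ZMod t) = 2 * d := by
  have hdo : Odd d := hd.odd_of_ne_two (by omega)
  obtain ⟨s, hs, hs2, hso⟩ := exists_prime_orderOf_intCast_eq (a := q) (by exact_mod_cast hqo)
    (by simpa using hq) hd hd5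
  obtain ⟨t, ht, ht2, hto⟩ := exists_prime_orderOf_intCast_eq (a := -q)
    (by simpa using hqo) (by simpa using hq) hd hd5
  refine ⟨s, t, hs, ht, hs2, ht2, by simpa using hso, ?_⟩
  have := Fact.mk ht
  have := Fact.mk (lt_of_le_of_ne ht.two_le ht2.symm)
  have h1 : (q : ZMod t) = -1 * ((-q : ℤ) : ZMod t) := by push_cast; ring
  rw [h1, (Commute.all _ _).orderOf_mul_eq_mul_orderOf_of_coprime, hto, orderOf_neg_one,
    ZMod.ringChar_zmod_n, if_neg ht2]
  rw [hto, orderOf_neg_one, ZMod.ringChar_zmod_n, if_neg ht2]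
  exact Nat.coprime_two_left.2 hdo

end PrimitivePrimes

section Nonsolvable

open Matrix

lemma SymplecticGroup.charpoly_inv {F : Type*} [Field F] {l : Type*} [Fintype l] [DecidableEq l]
    {x : Matrix (l ⊕ l) (l ⊕ l) F} (hx : x ∈ symplecticGroup l F) : x⁻¹.charpoly = x.charpoly := by
  have hJ : J l F * -J l F = 1 := by rw [mul_neg, J_squared, neg_neg]
  have hJ' : -J l F * J l F = 1 := by rw [neg_mul, J_squared, neg_neg]
  rw [SymplecticGroup.inv_eq_symplectic_inv x hx,
    ← (x.charpoly_transpose), ← Matrix.charpoly_units_conj ⟨-J l F, J l F, hJ', hJ⟩ xᵀ]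
  rw [Units.val_mk, Matrix.inv_eq_left_inv hJ]

lemma SymplecticGroup.orderOf_quotient_ne_mul {F : Type*} [Field F] [Fintype F] {l : Type*}
    [Fintype l] [DecidableEq l] {s t d : ℕ} (hs : s.Prime) (ht : t.Prime) (hs2 : s ≠ 2)
    (ht2 : t ≠ 2) (hds : orderOf (Fintype.card F : ZMod s) = d)
    (hdt : orderOf (Fintype.card F : ZMod t) = 2 * d) (hd : Odd d)
    (hl : Fintype.card l + Fintype.card l < 4 * d)
    (y : symplecticGroup l F ⧸ Subgroup.center (symplecticGroup l F)) : orderOf y ≠ s * t := by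
  intro hy
  obtain ⟨g, rfl⟩ := QuotientGroup.mk'_surjective _ y
  set π := QuotientGroup.mk' (Subgroup.center (symplecticGroup l F)) with hπ
  have hodd : Odd (s * t) := (hs.odd_of_ne_two hs2).mul (ht.odd_of_ne_two ht2)
  obtain ⟨j, hj⟩ := hodd.add_one.two_dvd
  set x := g ^ (s * t + 1) with hx
  have hπx : π x = π g := by
    rw [hx, map_pow, pow_succ, ← hy, pow_orderOf_eq_one, one_mul]
  have hxst : x ^ (s * t) = 1 := by
    have h1 : π (g ^ (s * t)) = 1 := by rw [map_pow, ← hy, pow_orderOf_eq_one]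
    rw [hx, ← pow_mul, mul_comm, pow_mul, hj, pow_mul,
      SymplecticGroup.sq_eq_one_of_mem_center ((QuotientGroup.eq_one_iff _).1 h1), one_pow]
  have hne : ∀ k, 0 < k → k < s * t → (x : Matrix (l ⊕ l) (l ⊕ l) F) ^ k ≠ 1 := by
    intro k hk0 hk h
    have h1 : x ^ k = 1 := Subtype.ext (by rw [SubmonoidClass.coe_pow, h, OneMemClass.coe_one])
    have h2 := congrArg π h1
    rw [map_pow, hπx, map_one] at h2
    exact absurd (Nat.le_of_dvd hk0 (orderOf_dvd_of_pow_eq_one h2)) (by omega)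
  have key := Matrix.four_mul_le_card hs ht hs2 hds hdt hd
    (M := (x : Matrix (l ⊕ l) (l ⊕ l) F))
    (by rw [← SubmonoidClass.coe_pow, hxst, OneMemClass.coe_one])
    (hne s hs.pos (lt_mul_of_one_lt_right hs.pos ht.one_lt))
    (hne t ht.pos (lt_mul_of_one_lt_left ht.pos hs.one_lt))
    (SymplecticGroup.charpoly_inv x.2)
  rw [Fintype.card_sum] at key
  omega

/-- A finite group with the spectrum of `PSp n F`, where `n` is even and `6 ≤ n ≤ 16`, is not
solvable. -/
lemma not_isSolvable_of_elementOrders_eq {n : ℕ} (hn1 : 6 ≤ n) (hn2 : n ≤ 16) (hn : Even n)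
    {F : Type} [Field F] [Fintype F] (hqo : Odd (Fintype.card F)) (hq : 3 ≤ Fintype.card F)
    {G : Type} [Group G] [Finite G] (hspec : elementOrders G = elementOrders (PSp n F)) :
    ¬ Group.IsSolvable G := by
  intro hG
  obtain ⟨d, hd, hd5, hdn, hnd, hd2n⟩ : ∃ d : ℕ, d.Prime ∧ 5 ≤ d ∧ d ≤ n ∧ 2 * n < 4 * d ∧
      ¬ d ∣ 2 * n := by
    obtain ⟨k, rfl⟩ := hn
    have : k = 3 ∨ k = 4 ∨ k = 5 ∨ k = 6 ∨ k = 7 ∨ k = 8 := by omega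
    rcases this with rfl | rfl | rfl | rfl | rfl | rfl
    · exact ⟨5, by norm_num⟩
    · exact ⟨5, by norm_num⟩
    · exact ⟨7, by norm_num⟩
    · exact ⟨7, by norm_num⟩
    · exact ⟨11, by norm_num⟩
    · exact ⟨11, by norm_num⟩
  obtain ⟨s, t, hs, ht, hs2, ht2, hso, hto⟩ := exists_primes_orderOf_eq hqo hq hd hd5
  obtain ⟨B, -, -, hB⟩ := kpart_bound hqo hq hn1 hn2 hn
  obtain ⟨r, hr, hrk⟩ := Nat.exists_prime_and_dvd (n := kpart (2 * n) (Fintype.card F)) (by omega)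
  have hro := (prime_dvd_kpart_iff (by omega) (by omega) hr).1 hrk
  have hr2 : r ≠ 2 := by
    rintro rfl
    have := Nat.le_of_dvd (by norm_num) (dvd_pred_of_orderOf hr (by omega) hro)
    omega
  have hrF := Fact.mk hr
  have hrn : r ∣ Fintype.card F ^ n + 1 :=
    (dvd_pow_add_one_iff).2 (pow_eq_neg_one_of_orderOf (by omega) hro)
  have hA2 : ∀ {a : ℕ}, a.Prime → a ≠ 2 → ¬ orderOf (Fintype.card F : ZMod a) ∣ 2 * n →
      ∀ g : G, orderOf g ≠ r * a := by
    intro a ha ha2 hno g hg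
    have hmem : r * a ∈ elementOrders (PSp n F) := hspec ▸ ⟨g, hg⟩
    obtain ⟨y, hy⟩ := hmem
    have h1 := SymplecticGroup.orderOf_quotient_dvd_of_dvd hr hr2 hqo
      (by rw [hro, Fintype.card_fin, two_mul]) (by rw [Fintype.card_fin]; omega)
      (by rwa [Fintype.card_fin]) y (hy ▸ dvd_mul_right r a)
    rw [hy, Fintype.card_fin] at h1
    have h2 : a ∣ Fintype.card F ^ n + 1 := by
      rw [← two_mul_half_pow_add_one hqo]
      exact ((dvd_mul_left a r).trans h1).mul_left 2
    apply hno
    apply orderOf_dvd_of_pow_eq_one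
    rw [two_mul, pow_add, dvd_pow_add_one_iff.1 h2, neg_mul_neg, one_mul]
  have hex : ∀ {a : ℕ}, a.Prime → a ≠ 2 → (∃ e, e ≠ 0 ∧ e ≤ n ∧
      (a ∣ Fintype.card F ^ e - 1 ∨ a ∣ Fintype.card F ^ e + 1)) → a ∣ Nat.card G := by
    rintro a ha ha2 ⟨e, he0, hen, he⟩
    have hmem : a ∈ elementOrders G := hspec ▸ exists_PSp_orderOf he0 hen (ha.odd_of_ne_two ha2) he
    obtain ⟨g, hg⟩ := hmem
    exact hg ▸ orderOf_dvd_natCard g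
  have hq0 : Fintype.card F ≠ 0 := by omega
  refine exists_orderOf_of_three_primes _ G rfl hr hs ht ?_ ?_ ?_
    (hex hr hr2 ⟨n, by omega, le_rfl, Or.inr hrn⟩)
    (hex hs hs2 ⟨d, hd.ne_zero, hdn, Or.inl ?_⟩) (hex ht ht2 ⟨d, hd.ne_zero, hdn, Or.inr ?_⟩)
    (hA2 hs hs2 (by rwa [hso])) (hA2 ht ht2 (by rw [hto]; exact fun h => hd2n (dvd_of_mul_left_dvd h)))
    ?_
  · rintro rfl
    exact hd2n (by rw [← hro, hso])
  · rintro rfl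
    exact hd2n ⟨2, by rw [← hro, hto, mul_comm]⟩
  · rintro rfl
    have := hd.pos
    omega
  · rw [dvd_pow_sub_one_iff hq0, ← hso, pow_orderOf_eq_one]
  · have := Fact.mk ht
    exact dvd_pow_add_one_iff.2 (pow_eq_neg_one_of_orderOf hd.ne_zero hto)
  · intro g hg
    have hmem : s * t ∈ elementOrders (PSp n F) := hspec ▸ ⟨g, hg⟩
    obtain ⟨y, hy⟩ := hmem
    exact SymplecticGroup.orderOf_quotient_ne_mul hs ht hs2 ht2 hso hto
      (hd.odd_of_ne_two (by omega)) (by rw [Fintype.card_fin]; omega) y hy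

end Nonsolvable

section SpecialLinear

open Matrix

namespace Matrix.SpecialLinearGroup

variable {α β F : Type*} [Fintype α] [DecidableEq α] [Fintype β] [DecidableEq β] [Field F]

/-- Relabelling of the indices, as a homomorphism of special linear groups. -/
def reindexHom (e : α ≃ β) : SpecialLinearGroup α F →* SpecialLinearGroup β F where
  toFun g := ⟨reindexAlgEquiv F F e g, by rw [det_reindexAlgEquiv, det_coe]⟩
  map_one' := Subtype.ext (map_one _)
  map_mul' _ _ := Subtype.ext (map_mul _ _ _)

lemma coe_reindexHom (e : α ≃ β) (g : SpecialLinearGroup α F) :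
    (reindexHom e g : Matrix β β F) = reindexAlgEquiv F F e g := rfl

/-- The embedding `g ↦ diag(g, 1)`. -/
def blockHom : SpecialLinearGroup α F →* SpecialLinearGroup (α ⊕ β) F where
  toFun g := ⟨fromBlocks g 0 0 1, by simp⟩
  map_one' := Subtype.ext (by simp)
  map_mul' g h := Subtype.ext (by
    change fromBlocks ((g : Matrix α α F) * (h : Matrix α α F)) 0 0 1 =
      fromBlocks (g : Matrix α α F) 0 0 1 * fromBlocks (h : Matrix α α F) 0 0 1
    simp [fromBlocks_multiply])

lemma coe_blockHom (g : SpecialLinearGroup α F) :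
    (blockHom (β := β) g : Matrix (α ⊕ β) (α ⊕ β) F) = fromBlocks g 0 0 1 := rfl

/-- The embedding `g ↦ diag(g, (det g)⁻¹)`. -/
def detHom : GL α F →* SpecialLinearGroup (α ⊕ Fin 1) F where
  toFun g := ⟨fromBlocks g 0 0 (scalar (Fin 1) ((GeneralLinearGroup.det g⁻¹ : Fˣ) : F)), by
    rw [det_fromBlocks_zero₂₁, det_fin_one, scalar_apply, diagonal_apply_eq,
      ← GeneralLinearGroup.val_det_apply, ← Units.val_mul, map_inv, mul_inv_cancel, Units.val_one]⟩
  map_one' := Subtype.ext (by simp)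
  map_mul' g h := Subtype.ext (by
    change fromBlocks ((g : Matrix α α F) * (h : Matrix α α F)) 0 0 (scalar (Fin 1) _) =
      fromBlocks (g : Matrix α α F) 0 0 (scalar (Fin 1) _) *
        fromBlocks (h : Matrix α α F) 0 0 (scalar (Fin 1) _)
    simp [fromBlocks_multiply, mul_comm])

lemma coe_detHom (g : GL α F) : (detHom g : Matrix (α ⊕ Fin 1) (α ⊕ Fin 1) F) =
    fromBlocks g 0 0 (scalar (Fin 1) ((GeneralLinearGroup.det g⁻¹ : Fˣ) : F)) := rfl

variable {Q : Type*} [Group Q]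

/-- The kernel of the homomorphism consists of scalar matrices. -/
def KerScalar (Φ : SpecialLinearGroup α F →* Q) : Prop :=
  ∀ g, Φ g = 1 → ∃ c : F, (g : Matrix α α F) = scalar α c

lemma kerScalar_comp_reindexHom {Φ : SpecialLinearGroup β F →* Q} (hΦ : KerScalar Φ) (e : α ≃ β) :
    KerScalar (Φ.comp (reindexHom e)) := by
  intro g hg
  obtain ⟨c, hc⟩ := hΦ _ hg
  refine ⟨c, (reindexAlgEquiv F F e).injective ?_⟩
  rw [← coe_reindexHom, hc]
  ext i j
  simp [scalar_apply, diagonal_apply]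

lemma kerScalar_comp_blockHom {Φ : SpecialLinearGroup (α ⊕ β) F →* Q} (hΦ : KerScalar Φ) :
    KerScalar (Φ.comp (blockHom (β := β))) := by
  intro g hg
  obtain ⟨c, hc⟩ := hΦ _ hg
  refine ⟨c, ?_⟩
  ext i j
  have := congrFun (congrFun hc (Sum.inl i)) (Sum.inl j)
  simpa [coe_blockHom, scalar_apply, diagonal_apply] using this

lemma exists_eq_scalar_of_conj_eq_one {g : SpecialLinearGroup α F}
    (hg : MulAut.conj (QuotientGroup.mk' (Subgroup.center (SpecialLinearGroup α F)) g) = 1) :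
    ∃ c : F, (g : Matrix α α F) = scalar α c := by
  obtain ⟨c, hc⟩ : (g : Matrix α α F) ∈ Set.range (scalar α) := by
    refine mem_range_scalar_of_commute_transvectionStruct fun t => ?_
    have h1 := congrFun (congrArg DFunLike.coe hg)
      (QuotientGroup.mk' (Subgroup.center (SpecialLinearGroup α F)) t.toSpecialLinearGroup)
    rw [MulAut.conj_apply, MulAut.one_apply, ← map_inv, ← map_mul, ← map_mul] at h1
    have h2 := (QuotientGroup.mk'_eq_mk' _).1 h1.symm
    obtain ⟨z, hz, h2⟩ := h2
    obtain ⟨c, -, hc⟩ := mem_center_iff.1 hz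
    have h3 : (g : Matrix α α F) * t.toMatrix = c • (t.toMatrix * (g : Matrix α α F)) := by
      have h4 : t.toSpecialLinearGroup * z * g = g * t.toSpecialLinearGroup := by
        rw [h2]; group
      have h5 := congrArg Subtype.val h4
      rw [coe_mul, coe_mul, coe_mul, ← hc] at h5
      rw [TransvectionStruct.toSpecialLinearGroup_coe] at h5
      rw [← h5, ← (scalar_commute c (fun _ => Commute.all _ _) _).eq, Matrix.mul_assoc,
        scalar_apply, ← smul_eq_diagonal_mul]
    have h4 : c = 1 := by
      set E : Matrix α α F := Matrix.single t.i t.j t.c with hE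
      have hEE : E * E = 0 := by simp [hE, Matrix.single_mul_single_of_ne, t.hij.symm]
      have ht : t.toMatrix = 1 + E := rfl
      have hgi : (g : Matrix α α F) * (g⁻¹ : SpecialLinearGroup α F) = 1 := by
        rw [← coe_mul, mul_inv_cancel, coe_one]
      have hgi' : ((g⁻¹ : SpecialLinearGroup α F) : Matrix α α F) * g = 1 := by
        rw [← coe_mul, inv_mul_cancel, coe_one]
      have h5 : (g : Matrix α α F) * E * (g⁻¹ : SpecialLinearGroup α F) =
          (c - 1) • 1 + c • E := by
        have h6 := congrArg (· * ((g⁻¹ : SpecialLinearGroup α F) : Matrix α α F)) h3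
        simp only [ht, Matrix.mul_add, Matrix.add_mul, Matrix.mul_one, Matrix.smul_mul, hgi,
          Matrix.mul_assoc, Matrix.one_mul] at h6
        rw [Matrix.mul_assoc, eq_sub_of_add_eq' h6, smul_add, sub_smul, one_smul]
        abel
      have h6 : ((c - 1) • (1 : Matrix α α F) + c • E) * ((c - 1) • 1 + c • E) = 0 := by
        rw [← h5]
        calc _ = (g : Matrix α α F) * (E * (((g⁻¹ : SpecialLinearGroup α F) : Matrix α α F) * g) * E)
              * (g⁻¹ : SpecialLinearGroup α F) := by simp only [Matrix.mul_assoc]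
          _ = 0 := by rw [hgi', Matrix.mul_one, hEE, Matrix.mul_zero, Matrix.zero_mul]
      have h7 := congrFun (congrFun h6 t.i) t.i
      simp only [Matrix.add_mul, Matrix.mul_add, Matrix.smul_mul, Matrix.mul_smul, hEE,
        Matrix.one_mul, Matrix.mul_one, Matrix.add_apply, Matrix.smul_apply, Matrix.zero_apply,
        Matrix.one_apply_eq, smul_zero, smul_eq_mul] at h7
      have h8 : E t.i t.i = 0 := by
        rw [hE, Matrix.single_apply_of_ne]
        exact fun h => t.hij h.2.symm
      rw [h8] at h7
      simpa [sub_eq_zero] using h7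
    rw [h4, one_smul] at h3
    exact h3.symm
  exact ⟨c, hc.symm⟩

lemma exists_orderOf_eq_two_mul [Finite Q] {Φ : SpecialLinearGroup α F →* Q} (hΦ : KerScalar Φ) {r : ℕ}
    (hr : r.Prime) (hr2 : r ≠ 2) {S W : SpecialLinearGroup α F} (h : Commute S W) (hS : S ^ 2 = 1)
    (hS1 : ∀ c : F, (S : Matrix α α F) ≠ scalar α c) (hW : W ^ r = 1)
    (hW1 : ∀ c : F, (W : Matrix α α F) ≠ scalar α c) : ∃ g : Q, orderOf g = 2 * r := by
  have := Fact.mk hr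
  have key : ∀ {p : ℕ} [Fact p.Prime] {X : SpecialLinearGroup α F}, X ^ p = 1 →
      (∀ c : F, (X : Matrix α α F) ≠ scalar α c) → p ∣ orderOf (Φ X) := by
    intro p _ X hX hX1
    rw [orderOf_eq_prime (p := p) (by rw [← map_pow, hX, map_one])]
    intro h1
    obtain ⟨c, hc⟩ := hΦ X h1
    exact hX1 c hc
  exact exists_orderOf_mul_of_commute (h.map Φ)
    ((Nat.coprime_primes Nat.prime_two hr).2 hr2.symm) (key hS hS1) (key hW hW1)

lemma det_eq_one_of_pow_eq_one [Fintype F] {r : ℕ} (hr : r.Prime) (hrF : ¬ r ∣ Fintype.card F - 1)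
    {c : F} (hc : c ^ r = 1) : c = 1 := by
  have hc0 : c ≠ 0 := by
    rintro rfl
    rw [zero_pow hr.ne_zero] at hc
    exact zero_ne_one hc
  have h1 := orderOf_dvd_of_pow_eq_one hc
  rcases (Nat.dvd_prime hr).1 h1 with h2 | h2
  · exact orderOf_eq_one_iff.1 h2
  · exact absurd (h2 ▸ orderOf_dvd_of_pow_eq_one (FiniteField.pow_card_sub_one_eq_one c hc0)) hrF

/-- A block-diagonal element of prime order `r` together with an involution acting on the
complementary block produces an element of order `2 * r`. -/
lemma exists_orderOf_eq_two_mul_of_dvd_card_GL [Finite Q] [Fintype F] [Nonempty β]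
    {Φ : SpecialLinearGroup (α ⊕ β) F →* Q}
    (hΦ : KerScalar Φ) {r : ℕ} (hr : r.Prime) (hr2 : r ≠ 2) (hrF : ¬ r ∣ Fintype.card F - 1)
    (hA : r ∣ Nat.card (GL α F)) {S : SpecialLinearGroup (α ⊕ β) F} {s : F} {T : Matrix β β F}
    (hST : (S : Matrix (α ⊕ β) (α ⊕ β) F) = fromBlocks (scalar α s) 0 0 T) (hS : S ^ 2 = 1)
    (hS1 : ∀ c : F, (S : Matrix (α ⊕ β) (α ⊕ β) F) ≠ scalar (α ⊕ β) c) :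
    ∃ g : Q, orderOf g = 2 * r := by
  have := Fact.mk hr
  obtain ⟨A, hAr⟩ := exists_prime_orderOf_dvd_card' r hA
  have hAp : (A : Matrix α α F) ^ r = 1 := by
    rw [← Units.val_pow_eq_pow_val, ← hAr, pow_orderOf_eq_one, Units.val_one]
  have hdet : (A : Matrix α α F).det = 1 :=
    det_eq_one_of_pow_eq_one hr hrF (by rw [← det_pow, hAp, det_one])
  obtain ⟨B, hB⟩ : ∃ B : SpecialLinearGroup α F, (B : Matrix α α F) = A := ⟨⟨A, hdet⟩, rfl⟩
  refine exists_orderOf_eq_two_mul hΦ hr hr2 (S := S) (W := blockHom B) ?_ hS hS1 ?_ ?_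
  · apply Subtype.ext
    rw [coe_mul, coe_mul, hST, coe_blockHom, fromBlocks_multiply, fromBlocks_multiply]
    simp only [Matrix.mul_one, Matrix.one_mul, Matrix.mul_zero, Matrix.zero_mul, add_zero,
      zero_add, (scalar_commute s (fun _ => Commute.all _ _) _).eq]
  · rw [← map_pow, show B ^ r = 1 from Subtype.ext (by
      rw [coe_pow, hB, hAp, coe_one]), map_one]
  · intro c hc
    rw [coe_blockHom, hB] at hc
    obtain ⟨b⟩ := ‹Nonempty β›
    have h1 := congrFun (congrFun hc (Sum.inr b)) (Sum.inr b)
    simp only [fromBlocks_apply₂₂, one_apply_eq, scalar_apply, diagonal_apply_eq] at h1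
    have h2 : A = 1 := by
      ext i j
      have := congrFun (congrFun hc (Sum.inl i)) (Sum.inl j)
      simpa [scalar_apply, diagonal_apply, ← h1, one_apply] using this
    rw [h2, orderOf_one] at hAr
    exact hr.one_lt.ne hAr

end Matrix.SpecialLinearGroup

end SpecialLinear

section ElementsOfOrderTwoR

open Matrix

namespace Matrix.SpecialLinearGroup

variable {F : Type*} [Field F] {Q : Type*} [Group Q]

lemma dvd_card_GL [Fintype F] {r j N : ℕ} (hj : 0 < j) (hjN : j ≤ N)
    (h : r ∣ Fintype.card F ^ j - 1) : r ∣ Nat.card (GL (Fin N) F) := by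
  rw [Matrix.card_GL_field]
  refine dvd_trans ?_ (Finset.dvd_prod_of_mem _ (Finset.mem_univ ⟨N - j, by omega⟩))
  have : Fintype.card F ^ N - Fintype.card F ^ (N - j) =
      Fintype.card F ^ (N - j) * (Fintype.card F ^ j - 1) := by
    rw [Nat.mul_sub, mul_one, ← pow_add, Nat.sub_add_cancel hjN]
  exact this ▸ h.mul_left _

/-- The restriction of a homomorphism to the upper left block of size `j`. -/
lemma exists_kerScalar_restrict {j k m : ℕ} (hjm : j + k = m) {Φ : SpecialLinearGroup (Fin m) F →* Q}
    (hΦ : KerScalar Φ) :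
    ∃ Ψ : SpecialLinearGroup (Fin j ⊕ Fin k) F →* Q, KerScalar Ψ ∧ Ψ.range = Φ.range := by
  obtain ⟨e⟩ : Nonempty (Fin j ⊕ Fin k ≃ Fin m) :=
    ⟨finSumFinEquiv.trans (finCongr hjm)⟩
  refine ⟨Φ.comp (reindexHom e), kerScalar_comp_reindexHom hΦ e, ?_⟩
  apply le_antisymm
  · rintro _ ⟨x, rfl⟩
    exact ⟨_, rfl⟩
  · rintro _ ⟨x, rfl⟩
    refine ⟨reindexHom e.symm x, ?_⟩
    rw [MonoidHom.comp_apply]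
    congr 1
    apply Subtype.ext
    rw [coe_reindexHom, coe_reindexHom]
    ext a b
    simp

lemma exists_kerScalar_three {m : ℕ} (hm : 3 ≤ m) {Φ : SpecialLinearGroup (Fin m) F →* Q}
    (hΦ : KerScalar Φ) : ∃ Ψ : SpecialLinearGroup (Fin 3) F →* Q, KerScalar Ψ := by
  obtain ⟨Ψ, hΨ, -⟩ := exists_kerScalar_restrict (Nat.add_sub_of_le hm) hΦ
  exact ⟨_, kerScalar_comp_blockHom hΨ⟩

lemma exists_orderOf_eq_two_mul_of_dvd_card_sub_one [Finite Q] [Fintype F]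
    {Φ : SpecialLinearGroup (Fin 3) F →* Q} (hΦ : KerScalar Φ) {r : ℕ} (hr : r.Prime) (hr2 : r ≠ 2)
    (hr3 : r ≠ 3) (h : r ∣ Fintype.card F - 1) : ∃ g : Q, orderOf g = 2 * r := by
  have := Fact.mk hr
  obtain ⟨a, ha⟩ : ∃ a : Fˣ, orderOf a = r :=
    exists_prime_orderOf_dvd_card' r (by rwa [Nat.card_units, Nat.card_eq_fintype_card])
  have har : a ^ r = 1 := ha ▸ pow_orderOf_eq_one a
  obtain ⟨b, hb⟩ : ∃ b : F, b = ((a⁻¹ ^ 2 : Fˣ) : F) := ⟨_, rfl⟩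
  have hbr : b ^ r = 1 := by
    rw [hb, ← Units.val_pow_eq_pow_val, ← pow_mul, mul_comm, pow_mul, inv_pow, har]
    simp
  have hba : b * a * a = 1 := by
    rw [hb, ← Units.val_mul, ← Units.val_mul]
    simp [pow_two, mul_assoc]
  have hbne : b ≠ a := by
    intro hc
    have h3 : a ^ 3 = 1 := by
      apply Units.ext
      rw [Units.val_pow_eq_pow_val, Units.val_one, ← hba, hc]
      ring
    have h4 := ha ▸ orderOf_dvd_of_pow_eq_one h3
    exact hr3 ((Nat.prime_dvd_prime_iff_eq hr Nat.prime_three).1 h4)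
  have har' : (a : F) ^ r = 1 := by
    rw [← Units.val_pow_eq_pow_val, har, Units.val_one]
  have hWdet : (diagonal ![b, (a : F), a]).det = 1 := by
    rw [det_diagonal, Fin.prod_univ_three]
    exact hba
  obtain ⟨S, hS, hS1, hSW⟩ : ∃ S : Matrix (Fin 3) (Fin 3) F, S.det = 1 ∧ S ^ 2 = 1 ∧
      (∀ c, S ≠ scalar _ c) ∧ S * diagonal ![b, (a : F), a] = diagonal ![b, (a : F), a] * S := by
    by_cases h2 : (2 : F) = 0
    · have h11 : (1 : F) + 1 = 0 := by rw [one_add_one_eq_two, h2]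
      refine ⟨!![1, 0, 0; 0, 1, 1; 0, 0, 1], by simp [det_fin_three], ?_, ?_, ?_⟩
      · rw [pow_two]
        ext i j
        fin_cases i <;> fin_cases j <;> simp [Matrix.mul_apply, Fin.sum_univ_three, h11]
      · intro c hc
        have := congrFun (congrFun hc 1) 2
        simp [scalar_apply] at this
      · ext i j
        fin_cases i <;> fin_cases j <;> simp
    · refine ⟨diagonal ![1, -1, -1], by simp [det_diagonal, Fin.prod_univ_three], ?_, ?_, ?_⟩
      · rw [diagonal_pow, ← diagonal_one]
        congr 1
        ext i
        fin_cases i <;> simp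
      · intro c hc
        have h0 := congrFun (congrFun hc 0) 0
        have h1 := congrFun (congrFun hc 1) 1
        simp [scalar_apply] at h0 h1
        apply h2
        rw [← one_add_one_eq_two]
        nth_rewrite 1 [h0]
        rw [← h1]
        ring
      · rw [diagonal_mul_diagonal, diagonal_mul_diagonal]
        congr 1
        ext i
        exact mul_comm _ _
  refine exists_orderOf_eq_two_mul hΦ hr hr2 (S := ⟨S, hS⟩) (W := ⟨_, hWdet⟩)
    (Subtype.ext hSW.2) (Subtype.ext hS1) hSW.1 (Subtype.ext ?_) ?_
  · change diagonal _ ^ r = 1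
    rw [diagonal_pow, ← diagonal_one]
    congr 1
    ext i
    fin_cases i <;> simp [hbr, har']
  · intro c hc
    have h0 := congrFun (congrFun hc 0) 0
    have h1 := congrFun (congrFun hc 1) 1
    simp [scalar_apply] at h0 h1
    exact hbne (h0.trans h1.symm)

lemma exists_orderOf_eq_two_mul_of_charP [Finite Q] {Φ : SpecialLinearGroup (Fin 3) F →* Q}
    (hΦ : KerScalar Φ) {r : ℕ} (hr : r.Prime) (hr2 : r ≠ 2) [CharP F r] :
    ∃ g : Q, orderOf g = 2 * r := by
  have := Fact.mk hr
  have h2 : (2 : F) ≠ 0 := by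
    intro h
    have h3 := (CharP.cast_eq_zero_iff F r 2).1 (by exact_mod_cast h)
    exact hr2 ((Nat.prime_dvd_prime_iff_eq hr Nat.prime_two).1 h3)
  have hW : (1 + Matrix.single (0 : Fin 3) (1 : Fin 3) (1 : F)) ^ r = 1 := by
    have := expChar_prime (Matrix (Fin 3) (Fin 3) F) r
    rw [add_pow_expChar_of_commute r (Commute.one_left _), one_pow,
      ← Nat.sub_add_cancel hr.two_le, pow_add, pow_two, Matrix.single_mul_single_of_ne _ _ _ _ (by simp)]
    simp
  refine exists_orderOf_eq_two_mul hΦ hr hr2 (S := ⟨diagonal ![-1, -1, 1], by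
      simp [det_diagonal, Fin.prod_univ_three]⟩)
    (W := ⟨1 + Matrix.single 0 1 1, by simp [det_fin_three]⟩)
    (Subtype.ext ?_) (Subtype.ext ?_) ?_ (Subtype.ext hW) ?_
  · change diagonal _ * (1 + Matrix.single 0 1 1) = (1 + Matrix.single 0 1 1) * diagonal _
    ext i j
    fin_cases i <;> fin_cases j <;> simp
  · change diagonal _ ^ 2 = 1
    rw [diagonal_pow, ← diagonal_one]
    congr 1
    ext i
    fin_cases i <;> simp
  · intro c hc
    have h0 := congrFun (congrFun hc 0) 0
    have h1 := congrFun (congrFun hc 2) 2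
    simp [scalar_apply] at h0 h1
    apply h2
    rw [← one_add_one_eq_two]
    nth_rewrite 1 [h1]
    rw [← h0]
    ring
  · intro c hc
    have h0 := congrFun (congrFun hc 0) 1
    simp [scalar_apply] at h0

/-- If there is no element of order `2 * r` in the target, then `r` is coprime to the order of
the linear groups of smaller dimension. -/
lemma not_dvd_pow_sub_one_of_no_orderOf [Finite Q] [Fintype F] {m : ℕ} (hm : 3 ≤ m) (hmo : Odd m)
    {Φ : SpecialLinearGroup (Fin m) F →* Q} (hΦ : KerScalar Φ) {r : ℕ} (hr : r.Prime) (hr2 : r ≠ 2)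
    (hr3 : r ≠ 3) (hno : ∀ g : Q, orderOf g ≠ 2 * r) {j : ℕ} (hj : 0 < j) (hjm : j ≤ m - 2) :
    ¬ r ∣ Fintype.card F ^ j - 1 := by
  intro h
  have hF : ¬ r ∣ Fintype.card F - 1 := by
    intro h
    obtain ⟨Ψ, hΨ⟩ := exists_kerScalar_three hm hΦ
    obtain ⟨g, hg⟩ := exists_orderOf_eq_two_mul_of_dvd_card_sub_one hΨ hr hr2 hr3 h
    exact hno g hg
  by_cases h2 : (2 : F) = 0
  · obtain ⟨Ψ, hΨ, -⟩ := exists_kerScalar_restrict (j := m - 2) (k := 2) (by omega) hΦ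
    have h11 : (1 : F) + 1 = 0 := by rw [one_add_one_eq_two, h2]
    refine not_exists.2 hno (exists_orderOf_eq_two_mul_of_dvd_card_GL hΨ hr hr2 hF
      (dvd_card_GL hj hjm h) (s := 1) (T := !![1, 1; 0, 1])
      (S := ⟨fromBlocks (scalar _ 1) 0 0 !![1, 1; 0, 1], by simp⟩) rfl ?_ ?_)
    · apply Subtype.ext
      change fromBlocks (scalar _ 1) 0 0 !![1, 1; 0, 1] ^ 2 = 1
      rw [pow_two, fromBlocks_multiply, ← fromBlocks_one]
      simp [h11, Matrix.one_fin_two]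
    · intro c hc
      have h1 := congrFun (congrFun hc (Sum.inr 0)) (Sum.inr 1)
      simp [scalar_apply] at h1
  · obtain ⟨Ψ, hΨ, -⟩ := exists_kerScalar_restrict (j := m - 1) (k := 1) (by omega) hΦ
    have hev : Even (m - 1) := Nat.Odd.sub_odd hmo odd_one
    refine not_exists.2 hno (exists_orderOf_eq_two_mul_of_dvd_card_GL hΨ hr hr2 hF
      (dvd_card_GL hj (by omega) h) (s := -1) (T := 1)
      (S := ⟨fromBlocks (scalar _ (-1)) 0 0 1, by simp [hev.neg_one_pow]⟩) rfl ?_ ?_)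
    · apply Subtype.ext
      change fromBlocks (scalar _ (-1)) 0 0 1 ^ 2 = 1
      rw [pow_two, fromBlocks_multiply, ← fromBlocks_one]
      simp
    · intro c hc
      have h1 := congrFun (congrFun hc (Sum.inr 0)) (Sum.inr 0)
      have h0 := congrFun (congrFun hc (Sum.inl ⟨0, by omega⟩)) (Sum.inl ⟨0, by omega⟩)
      simp [scalar_apply] at h1 h0
      apply h2
      rw [← one_add_one_eq_two]
      nth_rewrite 1 [h1]
      rw [← h0]
      ring

lemma not_charP_of_no_orderOf [Finite Q] {m : ℕ} (hm : 3 ≤ m)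
    {Φ : SpecialLinearGroup (Fin m) F →* Q} (hΦ : KerScalar Φ) {r : ℕ} (hr : r.Prime) (hr2 : r ≠ 2)
    (hno : ∀ g : Q, orderOf g ≠ 2 * r) : ¬ CharP F r := by
  intro h
  obtain ⟨Ψ, hΨ⟩ := exists_kerScalar_three hm hΦ
  obtain ⟨g, hg⟩ := exists_orderOf_eq_two_mul_of_charP hΨ hr hr2
  exact hno g hg

end Matrix.SpecialLinearGroup

end ElementsOfOrderTwoR

section TwoSubgroups

open Matrix

namespace Matrix.SpecialLinearGroup

variable {F : Type*} [Field F]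

lemma isPGroup_sup_zpowers {H : Type*} [Group H] [Finite H] {p : ℕ} [Fact p.Prime] {x y : H} {i j : ℕ}
    (hx : x ^ p ^ i = 1) (hy : y ^ p ^ j = 1) (h : x * y * x⁻¹ ∈ Subgroup.zpowers y) :
    IsPGroup p (Subgroup.zpowers x ⊔ Subgroup.zpowers y : Subgroup H) := by
  have key : ∀ {z : H} {i : ℕ}, z ^ p ^ i = 1 → IsPGroup p (Subgroup.zpowers z) := by
    rintro z i hz ⟨_, n, rfl⟩
    refine ⟨i, Subtype.ext ?_⟩
    change (z ^ n) ^ p ^ i = 1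
    rw [← _root_.zpow_natCast, ← _root_.zpow_mul, mul_comm, _root_.zpow_mul, _root_.zpow_natCast, hz,
      _root_.one_zpow]
  refine (key hx).to_sup_of_normal_right' (key hy) ?_
  rw [Subgroup.zpowers_le]
  refine Subgroup.mem_normalizer_fintype ?_
  rintro _ ⟨n, rfl⟩
  have h2 : x * y ^ n * x⁻¹ = (x * y * x⁻¹) ^ n := by rw [conj_zpow]
  change x * y ^ n * x⁻¹ ∈ _
  rw [h2]
  exact zpow_mem h n

lemma not_dvd_card_of_two_subgroups {α : Type*} [Fintype α] [DecidableEq α] {G : Type*} [Group G]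
    [Finite G] {K : Subgroup G} [K.Normal] {Φ : SpecialLinearGroup α F →* G ⧸ K} (hΦ : KerScalar Φ)
    {r : ℕ} (hr : r.Prime) (hr2 : r ≠ 2) (hno : ∀ g : G, orderOf g ≠ 2 * r)
    {V W : Subgroup (SpecialLinearGroup α F)} (hV : IsPGroup 2 V) (hW : IsPGroup 2 W)
    {a b : SpecialLinearGroup α F} (ha : a ∈ V) (hb : b ∈ V) (ha2 : a ^ 2 = 1) (hb2 : b ^ 2 = 1)
    (ha1 : ∀ c : F, (a : Matrix α α F) ≠ scalar α c)
    (hb1 : ∀ c : F, (b : Matrix α α F) ≠ scalar α c)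
    (hab : ∀ c : F, (a : Matrix α α F) * b ≠ scalar α c)
    {x y : SpecialLinearGroup α F} (hx : x ∈ W) (hy : y ∈ W)
    (hx2 : ∀ c : F, (x : Matrix α α F) ^ 2 ≠ scalar α c)
    (hy2 : ∀ c : F, (y : Matrix α α F) ^ 2 ≠ scalar α c)
    (hxy : ∀ c : F, (x : Matrix α α F) * y ≠ y * x * scalar α c) : ¬ r ∣ Nat.card K := by
  have h1 : ∀ z : SpecialLinearGroup α F, (∀ c : F, (z : Matrix α α F) ≠ scalar α c) → Φ z ≠ 1 :=
    fun z hz h => (hΦ z h).elim hz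
  refine _root_.not_dvd_card_of_two_subgroups hr hr2 hno (hV.map Φ) (hW.map Φ)
    (Subgroup.mem_map_of_mem Φ ha) (Subgroup.mem_map_of_mem Φ hb) (by rw [← map_pow, ha2, map_one])
    (by rw [← map_pow, hb2, map_one]) (h1 a ha1) (h1 b hb1) ?_ (Subgroup.mem_map_of_mem Φ hx)
    (Subgroup.mem_map_of_mem Φ hy) ?_ ?_ ?_
  · intro h
    refine h1 (a * b) (by rwa [coe_mul]) ?_
    rw [map_mul, h, ← map_mul, ← pow_two, hb2, map_one]
  · rw [← map_pow]
    exact h1 _ (by rwa [coe_pow])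
  · rw [← map_pow]
    exact h1 _ (by rwa [coe_pow])
  · intro h
    obtain ⟨c, hc⟩ := hΦ ((y * x)⁻¹ * (x * y)) (by
      rw [map_mul, map_inv, map_mul, map_mul, h, inv_mul_cancel])
    apply hxy c
    rw [← hc, ← coe_mul, ← coe_mul, ← coe_mul, mul_inv_cancel_left]

lemma exists_isPGroup_unitriangular (h2 : (1 : F) + 1 = 0) :
    ∃ U : Subgroup (SpecialLinearGroup (Fin 3) F), IsPGroup 2 U ∧
      ∀ g : SpecialLinearGroup (Fin 3) F,
        (∃ a b c : F, (g : Matrix (Fin 3) (Fin 3) F) = !![1, a, b; 0, 1, c; 0, 0, 1]) → g ∈ U := by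
  have hmul : ∀ a b c a' b' c' : F, !![1, a, b; 0, 1, c; 0, 0, 1] * !![1, a', b'; 0, 1, c'; 0, 0, 1] =
      !![1, a' + a, b' + a * c' + b; 0, 1, c' + c; 0, 0, 1] := by
    intro a b c a' b' c'
    ext i j
    fin_cases i <;> fin_cases j <;> simp [Matrix.mul_apply, Fin.sum_univ_three]
  have h22 : ∀ a : F, a + a = 0 := fun a => by rw [← mul_one a, ← mul_add, h2, mul_zero]
  have hpow : ∀ g : SpecialLinearGroup (Fin 3) F,
      (∃ a b c : F, (g : Matrix (Fin 3) (Fin 3) F) = !![1, a, b; 0, 1, c; 0, 0, 1]) →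
        g ^ 2 ^ 2 = 1 := by
    rintro g ⟨a, b, c, hg⟩
    apply Subtype.ext
    rw [show g ^ 2 ^ 2 = g * g * (g * g) by rw [pow_two 2, pow_mul, pow_two, pow_two], coe_mul, coe_mul, hg, hmul, hmul, coe_one]
    ext i j
    fin_cases i <;> fin_cases j <;> simp [h22]
  have hmem : ∀ {g h : SpecialLinearGroup (Fin 3) F},
      (∃ a b c : F, (g : Matrix (Fin 3) (Fin 3) F) = !![1, a, b; 0, 1, c; 0, 0, 1]) →
      (∃ a b c : F, (h : Matrix (Fin 3) (Fin 3) F) = !![1, a, b; 0, 1, c; 0, 0, 1]) →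
      ∃ a b c : F, ((g * h : SpecialLinearGroup (Fin 3) F) : Matrix (Fin 3) (Fin 3) F) =
        !![1, a, b; 0, 1, c; 0, 0, 1] := by
    rintro g h ⟨a, b, c, hg⟩ ⟨a', b', c', hh⟩
    exact ⟨_, _, _, by rw [coe_mul, hg, hh, hmul]⟩
  refine ⟨{ carrier := {g | ∃ a b c : F, (g : Matrix (Fin 3) (Fin 3) F) =
              !![1, a, b; 0, 1, c; 0, 0, 1]}
            one_mem' := ⟨0, 0, 0, by rw [coe_one, Matrix.one_fin_three]⟩
            mul_mem' := hmem
            inv_mem' := ?_ }, ?_, fun g hg => hg⟩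
  · intro g hg
    have h3 : g⁻¹ = g * g * g := by
      rw [inv_eq_iff_mul_eq_one, ← hpow g hg]
      rw [pow_two 2, pow_mul, pow_two, pow_two]
      simp only [mul_assoc]
    rw [h3]
    exact hmem (hmem hg hg) hg
  · rintro ⟨g, hg⟩
    exact ⟨2, Subtype.ext (hpow g hg)⟩

lemma not_dvd_card_of_two_eq_zero {G : Type*} [Group G]
    [Finite G] {K : Subgroup G} [K.Normal] {Φ : SpecialLinearGroup (Fin 3) F →* G ⧸ K}
    (hΦ : KerScalar Φ) {r : ℕ} (hr : r.Prime) (hr2 : r ≠ 2) (hno : ∀ g : G, orderOf g ≠ 2 * r)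
    (h2 : (1 : F) + 1 = 0) {t : F} (ht0 : t ≠ 0) (ht1 : t ≠ 1) : ¬ r ∣ Nat.card K := by
  obtain ⟨U, hU, hmem⟩ := exists_isPGroup_unitriangular h2
  obtain ⟨M, hM⟩ : ∃ M : F → F → F → SpecialLinearGroup (Fin 3) F, ∀ a b c,
      (M a b c : Matrix (Fin 3) (Fin 3) F) = !![1, a, b; 0, 1, c; 0, 0, 1] :=
    ⟨fun a b c => ⟨!![1, a, b; 0, 1, c; 0, 0, 1], by simp [det_fin_three]⟩, fun _ _ _ => rfl⟩
  have hMU : ∀ a b c, M a b c ∈ U := fun a b c => hmem _ ⟨a, b, c, hM a b c⟩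
  have h22 : ∀ a : F, a + a = 0 := fun a => by rw [← mul_one a, ← mul_add, h2, mul_zero]
  have hsq : ∀ b, M 0 b 0 ^ 2 = 1 := by
    intro b
    apply Subtype.ext
    rw [coe_pow, hM, coe_one, pow_two]
    ext i j
    fin_cases i <;> fin_cases j <;> simp [Matrix.mul_apply, Fin.sum_univ_three, h22]
  refine not_dvd_card_of_two_subgroups hΦ hr hr2 hno hU hU (hMU 0 1 0) (hMU 0 t 0) (hsq 1) (hsq t)
    ?_ ?_ ?_ (hMU 1 0 1) (hMU 1 0 t) ?_ ?_ ?_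
  all_goals
    intro c hc
    simp only [hM, pow_two] at hc
    have h02 := congrFun (congrFun hc 0) 2
    have h00 := congrFun (congrFun hc 0) 0
    simp [Matrix.mul_apply, Fin.sum_univ_three, scalar_apply] at h02 h00
  · exact ht0 h02
  · have h3 : t = -1 := by linear_combination h02
    exact ht1 (h3.trans (eq_of_sub_eq_zero (by linear_combination -h2)))
  · exact ht0 h02
  · rw [← h00] at h02
    exact ht1 h02

lemma not_dvd_card_of_two_ne_zero [Fintype F] {G : Type*} [Group G]
    [Finite G] {K : Subgroup G} [K.Normal] {Φ : SpecialLinearGroup (Fin 3) F →* G ⧸ K}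
    (hΦ : KerScalar Φ) {r : ℕ} (hr : r.Prime) (hr2 : r ≠ 2) (hno : ∀ g : G, orderOf g ≠ 2 * r)
    (h2 : (2 : F) ≠ 0) : ¬ r ∣ Nat.card K := by
  obtain ⟨p, hp⟩ := CharP.exists F
  have hp0 : NeZero p := ⟨CharP.char_ne_zero_of_finite F p⟩
  obtain ⟨a, b, hab⟩ := CharP.sq_add_sq F p (-1)
  push_cast at hab
  generalize (a : F) = a at hab
  generalize (b : F) = b at hab
  have hneg : ∀ c : F, c = -c → c = 0 := fun c hc =>
    (mul_eq_zero.1 (show 2 * c = 0 by linear_combination hc)).resolve_left h2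
  obtain ⟨D, hD⟩ : ∃ D : SpecialLinearGroup (Fin 3) F,
      (D : Matrix (Fin 3) (Fin 3) F) = !![1, 0, 0; 0, -1, 0; 0, 0, -1] :=
    ⟨⟨_, by simp [det_fin_three]⟩, rfl⟩
  obtain ⟨E, hE⟩ : ∃ D : SpecialLinearGroup (Fin 3) F,
      (D : Matrix (Fin 3) (Fin 3) F) = !![-1, 0, 0; 0, -1, 0; 0, 0, 1] :=
    ⟨⟨_, by simp [det_fin_three]⟩, rfl⟩
  obtain ⟨x, hx⟩ : ∃ D : SpecialLinearGroup (Fin 3) F,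
      (D : Matrix (Fin 3) (Fin 3) F) = !![0, 1, 0; -1, 0, 0; 0, 0, 1] :=
    ⟨⟨_, by simp [det_fin_three]⟩, rfl⟩
  obtain ⟨y, hy⟩ : ∃ D : SpecialLinearGroup (Fin 3) F,
      (D : Matrix (Fin 3) (Fin 3) F) = !![a, b, 0; b, -a, 0; 0, 0, 1] :=
    ⟨⟨_, by simp [det_fin_three]; linear_combination -hab⟩, rfl⟩
  have hD2 : D ^ 2 = 1 := by
    apply Subtype.ext
    rw [coe_pow, hD, coe_one, pow_two]
    ext i j
    fin_cases i <;> fin_cases j <;> simp [Matrix.mul_apply, Fin.sum_univ_three]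
  have hE2 : E ^ 2 = 1 := by
    apply Subtype.ext
    rw [coe_pow, hE, coe_one, pow_two]
    ext i j
    fin_cases i <;> fin_cases j <;> simp [Matrix.mul_apply, Fin.sum_univ_three]
  have hDE : D * E * D⁻¹ = E := by
    rw [mul_inv_eq_iff_eq_mul]
    apply Subtype.ext
    rw [coe_mul, coe_mul, hD, hE]
    ext i j
    fin_cases i <;> fin_cases j <;> simp [Matrix.mul_apply, Fin.sum_univ_three]
  have hxx : x ^ 2 = E := by
    apply Subtype.ext
    rw [coe_pow, hx, hE, pow_two]
    ext i j
    fin_cases i <;> fin_cases j <;> simp [Matrix.mul_apply, Fin.sum_univ_three]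
  have hyy : y ^ 2 = E := by
    apply Subtype.ext
    rw [coe_pow, hy, hE, pow_two]
    ext i j
    fin_cases i <;> fin_cases j <;> simp [Matrix.mul_apply, Fin.sum_univ_three]
    · linear_combination hab
    · ring
    · ring
    · linear_combination hab
  have hyxy : x * y * x⁻¹ = y⁻¹ := by
    rw [mul_inv_eq_iff_eq_mul, eq_inv_mul_iff_mul_eq]
    apply Subtype.ext
    rw [coe_mul, coe_mul, hx, hy]
    ext i j
    fin_cases i <;> fin_cases j <;> simp [Matrix.mul_apply, Fin.sum_univ_three]
    · ring
    · linear_combination -hab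
    · linear_combination hab
    · ring
  have hEs : ∀ c : F, (E : Matrix (Fin 3) (Fin 3) F) ≠ scalar _ c := by
    intro c hc
    rw [hE] at hc
    have h0 := congrFun (congrFun hc 0) 0
    have h1 := congrFun (congrFun hc 2) 2
    simp [scalar_apply] at h0 h1
    exact one_ne_zero (hneg 1 (h1.trans h0.symm))
  refine not_dvd_card_of_two_subgroups hΦ hr hr2 hno
    (isPGroup_sup_zpowers (p := 2) (i := 1) (j := 1) hD2 hE2 (by rw [hDE]; exact Subgroup.mem_zpowers E))
    (isPGroup_sup_zpowers (p := 2) (i := 2) (j := 2) (x := x) (y := y)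
      (by rw [pow_two 2, pow_mul, hxx, hE2]) (by rw [pow_two 2, pow_mul, hyy, hE2])
      (by rw [hyxy]; exact inv_mem (Subgroup.mem_zpowers y)))
    (Subgroup.mem_sup_left (Subgroup.mem_zpowers D)) (Subgroup.mem_sup_right (Subgroup.mem_zpowers E))
    hD2 hE2 ?_ hEs ?_ (Subgroup.mem_sup_left (Subgroup.mem_zpowers x))
    (Subgroup.mem_sup_right (Subgroup.mem_zpowers y))
    (by rwa [← coe_pow, hxx]) (by rwa [← coe_pow, hyy]) ?_
  · intro c hc
    rw [hD] at hc
    have h0 := congrFun (congrFun hc 0) 0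
    have h1 := congrFun (congrFun hc 2) 2
    simp [scalar_apply] at h0 h1
    exact one_ne_zero (hneg 1 (h0.trans h1.symm))
  · intro c hc
    rw [hD, hE] at hc
    have h0 := congrFun (congrFun hc 0) 0
    have h1 := congrFun (congrFun hc 1) 1
    simp [Matrix.mul_apply, Fin.sum_univ_three, scalar_apply] at h0 h1
    exact one_ne_zero (hneg 1 (h1.trans h0.symm))
  · intro c hc
    rw [hx, hy] at hc
    have h0 := congrFun (congrFun hc 0) 0
    have h1 := congrFun (congrFun hc 0) 1
    have h2 := congrFun (congrFun hc 2) 2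
    simp [Matrix.mul_apply, Fin.sum_univ_three, scalar_apply] at h0 h1 h2
    rw [← h2, mul_one] at h0 h1
    have hb := hneg b h0
    have ha := hneg a h1.symm
    rw [ha, hb] at hab
    simp at hab

/-- The prime `r` does not divide the order of a normal subgroup `K` if a group containing a
projective special linear group of dimension at least three acts as a quotient by `K`. -/
lemma not_dvd_card_of_no_orderOf [Fintype F] (hF : 3 < Fintype.card F) {m : ℕ} (hm : 3 ≤ m)
    {G : Type*} [Group G] [Finite G] {K : Subgroup G} [K.Normal]
    {Φ : SpecialLinearGroup (Fin m) F →* G ⧸ K} (hΦ : KerScalar Φ) {r : ℕ} (hr : r.Prime)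
    (hr2 : r ≠ 2) (hno : ∀ g : G, orderOf g ≠ 2 * r) : ¬ r ∣ Nat.card K := by
  obtain ⟨Ψ, hΨ⟩ := exists_kerScalar_three hm hΦ
  by_cases h2 : (2 : F) = 0
  · classical
    obtain ⟨t, ht⟩ := Finset.exists_mem_notMem_of_card_lt_card (s := {(0 : F), 1}) (t := Finset.univ)
      (lt_of_le_of_lt Finset.card_le_two (by rw [Finset.card_univ]; omega))
    simp at ht
    exact not_dvd_card_of_two_eq_zero hΨ hr hr2 hno (by rw [one_add_one_eq_two, h2]) ht.1 ht.2
  · exact not_dvd_card_of_two_ne_zero hΨ hr hr2 hno h2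

end Matrix.SpecialLinearGroup

end TwoSubgroups

section ConjugateInvolutions

open Module

section LinearAlgebra

variable {K V V' : Type*} [Field K] [AddCommGroup V] [Module K V] [AddCommGroup V'] [Module K V']

lemma exists_linearEquiv_of_isCompl {U C : Submodule K V} {U' C' : Submodule K V'} (h : IsCompl U C)
    (h' : IsCompl U' C') (e : U ≃ₗ[K] U') (f : C ≃ₗ[K] C') :
    ∃ T : V ≃ₗ[K] V', (∀ x : U, T x = e x) ∧ ∀ x : C, T x = f x := by
  refine ⟨(Submodule.prodEquivOfIsCompl U C h).symm.trans
    ((e.prodCongr f).trans (Submodule.prodEquivOfIsCompl U' C' h')), fun x => ?_, fun x => ?_⟩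
  · simp
  · simp

lemma exists_linearEquiv_extend [FiniteDimensional K V] [FiniteDimensional K V'] {U : Submodule K V}
    {U' : Submodule K V'} (e : U ≃ₗ[K] U') (h : finrank K V = finrank K V') :
    ∃ T : V ≃ₗ[K] V', ∀ x : U, T x = e x := by
  obtain ⟨C, hC⟩ := U.exists_isCompl
  obtain ⟨C', hC'⟩ := U'.exists_isCompl
  have h1 := Submodule.finrank_add_eq_of_isCompl hC
  have h2 := Submodule.finrank_add_eq_of_isCompl hC'
  have h3 := e.finrank_eq
  obtain ⟨T, hT, -⟩ := exists_linearEquiv_of_isCompl hC hC' e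
    (LinearEquiv.ofFinrankEq C C' (by omega))
  exact ⟨T, hT⟩

variable [FiniteDimensional K V]

/-- Two endomorphisms of the same rank satisfying the same equation `X ^ 2 = c X` are similar. -/
lemma exists_linearEquiv_of_sq_eq_smul {N M : V →ₗ[K] V} {c : K} (hN : ∀ x, N (N x) = c • N x)
    (hM : ∀ x, M (M x) = c • M x)
    (h : finrank K (LinearMap.range N) = finrank K (LinearMap.range M)) :
    ∃ T : V ≃ₗ[K] V, ∀ x, T (N x) = M (T x) := by
  have hker : finrank K (LinearMap.ker N) = finrank K (LinearMap.ker M) := by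
    have h1 := N.finrank_range_add_finrank_ker
    have h2 := M.finrank_range_add_finrank_ker
    omega
  have e := LinearEquiv.ofFinrankEq _ _ h
  by_cases hc : c = 0
  · subst hc
    have hle : ∀ {P : V →ₗ[K] V}, (∀ x, P (P x) = (0 : K) • P x) →
        LinearMap.range P ≤ LinearMap.ker P := by
      rintro P hP _ ⟨x, rfl⟩
      rw [LinearMap.mem_ker, hP, zero_smul]
    obtain ⟨k, hk⟩ := exists_linearEquiv_extend (((Submodule.submoduleOfEquivOfLe (hle hN)).trans e).trans
      (Submodule.submoduleOfEquivOfLe (hle hM)).symm) hker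
    obtain ⟨C, hC⟩ := (LinearMap.ker N).exists_isCompl
    obtain ⟨C', hC'⟩ := (LinearMap.ker M).exists_isCompl
    obtain ⟨T, hT1, hT2⟩ := exists_linearEquiv_of_isCompl hC hC' k
      (((LinearMap.kerComplementEquivRange N hC.symm).trans e).trans
        (LinearMap.kerComplementEquivRange M hC'.symm).symm)
    refine ⟨T, fun x => ?_⟩
    obtain ⟨y, z, hy, hz, rfl⟩ := Submodule.codisjoint_iff_exists_add_eq.mp hC.codisjoint x
    have h1 : M (T y) = 0 := by rw [hT1 ⟨y, hy⟩]; exact (k ⟨y, hy⟩).2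
    have h2 : M (T z) = e ⟨N z, z, rfl⟩ := by
      rw [hT2 ⟨z, hz⟩]
      exact congrArg Subtype.val ((LinearMap.kerComplementEquivRange M hC'.symm).apply_symm_apply
        (e ⟨N z, z, rfl⟩))
    have h3 : T (N z) = e ⟨N z, z, rfl⟩ := by
      rw [hT1 ⟨N z, hle hN ⟨z, rfl⟩⟩]
      exact congrArg Subtype.val (hk ⟨⟨N z, hle hN ⟨z, rfl⟩⟩, ⟨z, rfl⟩⟩)
    rw [map_add, map_add, map_add, map_add, LinearMap.mem_ker.1 hy, map_zero, h1, h2, h3]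
  · have hcompl : ∀ {P : V →ₗ[K] V}, (∀ x, P (P x) = c • P x) →
        IsCompl (LinearMap.ker P) (LinearMap.range P) := by
      intro P hP
      refine IsCompl.of_le (fun x hx => ?_) (fun x _ => ?_)
      · obtain ⟨hx, y, rfl⟩ := hx
        have h1 := hP y
        rw [LinearMap.mem_ker.1 hx] at h1
        exact ((smul_eq_zero.1 h1.symm).resolve_left hc)
      · refine Submodule.mem_sup.2 ⟨x - c⁻¹ • P x, ?_, c⁻¹ • P x, ⟨c⁻¹ • x, by simp⟩, by simp⟩
        rw [LinearMap.mem_ker, map_sub, map_smul, hP, inv_smul_smul₀ hc, sub_self]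
    obtain ⟨T, hT1, hT2⟩ := exists_linearEquiv_of_isCompl (hcompl hN) (hcompl hM)
      (LinearEquiv.ofFinrankEq _ _ hker) e
    refine ⟨T, fun x => ?_⟩
    obtain ⟨y, z, hy, ⟨w, rfl⟩, rfl⟩ :=
      Submodule.codisjoint_iff_exists_add_eq.mp (hcompl hN).codisjoint x
    have h1 : M (T y) = 0 := by rw [hT1 ⟨y, hy⟩]; exact (LinearEquiv.ofFinrankEq _ _ hker ⟨y, hy⟩).2
    have h2 := hT2 ⟨N w, w, rfl⟩
    obtain ⟨t, ht⟩ := (e ⟨N w, w, rfl⟩).2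
    simp only at h2
    rw [map_add, map_add, map_add, map_add, LinearMap.mem_ker.1 hy, map_zero, h1, hN, map_smul, h2,
      ← ht, hM]

/-- The centralizer of `N` contains elements of arbitrary determinant as soon as the kernel of `N`
is not contained in the range. -/
lemma exists_linearEquiv_commute_det {N : V →ₗ[K] V}
    (hN : ¬ LinearMap.ker N ≤ LinearMap.range N) {d : K} (hd : d ≠ 0) :
    ∃ T : V ≃ₗ[K] V, (∀ x, T (N x) = N (T x)) ∧ LinearMap.det (T : V →ₗ[K] V) = d := by
  obtain ⟨w, hw, hw'⟩ := Set.not_subset.1 hN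
  obtain ⟨f, hf, hfN⟩ := Submodule.exists_le_ker_of_notMem hw'
  have hdet : LinearMap.det (LinearMap.transvection (((d - 1) / f w) • f) w) = d := by
    rw [LinearMap.transvection.det, LinearMap.smul_apply, smul_eq_mul, div_mul_cancel₀ _ hf]
    ring
  refine ⟨LinearMap.equivOfDetNeZero (LinearMap.transvection (((d - 1) / f w) • f) w)
    (hdet.symm ▸ hd), fun x => ?_, hdet⟩
  change LinearMap.transvection _ _ _ = N (LinearMap.transvection _ _ _)
  rw [LinearMap.transvection.apply, LinearMap.transvection.apply, LinearMap.smul_apply,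
    LinearMap.mem_ker.1 (hfN ⟨x, rfl⟩), map_add, map_smul, LinearMap.mem_ker.1 hw]
  simp

lemma exists_linearEquiv_of_sq_eq_smul_of_det {N M : V →ₗ[K] V} {c : K} (hN : ∀ x, N (N x) = c • N x)
    (hM : ∀ x, M (M x) = c • M x)
    (h : finrank K (LinearMap.range N) = finrank K (LinearMap.range M))
    (hN' : ¬ LinearMap.ker N ≤ LinearMap.range N) :
    ∃ T : V →ₗ[K] V, (∀ x, T (N x) = M (T x)) ∧ LinearMap.det T = 1 := by
  obtain ⟨T, hT⟩ := exists_linearEquiv_of_sq_eq_smul hN hM h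
  have hd : LinearMap.det (T : V →ₗ[K] V) ≠ 0 := T.isUnit_det'.ne_zero
  obtain ⟨R, hR, hRd⟩ := exists_linearEquiv_commute_det hN' (inv_ne_zero hd)
  refine ⟨(T : V →ₗ[K] V) ∘ₗ (R : V →ₗ[K] V), fun x => ?_, ?_⟩
  · simp only [LinearMap.comp_apply, LinearEquiv.coe_coe, hR, hT]
  · rw [LinearMap.det_comp, hRd, mul_inv_cancel₀ hd]

end LinearAlgebra

open Matrix

namespace Matrix.SpecialLinearGroup

variable {α F : Type*} [Fintype α] [DecidableEq α] [Field F]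

lemma sub_one_mul_sub_one {A : SpecialLinearGroup α F} (hA : A ^ 2 = 1) :
    ((A : Matrix α α F) - 1) * ((A : Matrix α α F) - 1) = (-2 : F) • ((A : Matrix α α F) - 1) := by
  have h : (A : Matrix α α F) * A = 1 := by rw [← coe_mul, ← pow_two, hA, coe_one]
  rw [Matrix.mul_sub, Matrix.sub_mul, h, Matrix.one_mul, Matrix.mul_one, neg_smul, two_smul]
  abel

lemma not_ker_le_range (hα : Odd (Fintype.card α)) {A : SpecialLinearGroup α F} (hA : A ^ 2 = 1) :
    ¬ LinearMap.ker (Matrix.toLin' ((A : Matrix α α F) - 1)) ≤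
      LinearMap.range (Matrix.toLin' ((A : Matrix α α F) - 1)) := by
  intro hle
  set N := Matrix.toLin' ((A : Matrix α α F) - 1) with hN
  have hNN : ∀ x, N (N x) = (-2 : F) • N x := by
    intro x
    rw [hN, ← LinearMap.comp_apply, ← Matrix.toLin'_mul, sub_one_mul_sub_one hA, map_smul]
    rfl
  have hrank := N.finrank_range_add_finrank_ker
  rw [finrank_fintype_fun_eq_card] at hrank
  by_cases h2 : (2 : F) = 0
  · have hge : LinearMap.range N ≤ LinearMap.ker N := by
      rintro _ ⟨x, rfl⟩
      rw [LinearMap.mem_ker, hNN, h2, neg_zero, zero_smul]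
    rw [le_antisymm hge hle] at hrank
    exact (Nat.not_even_iff_odd.2 hα) ⟨_, hrank.symm⟩
  · have hinj : LinearMap.ker N = ⊥ := by
      rw [eq_bot_iff]
      intro x hx
      obtain ⟨y, rfl⟩ := hle hx
      have h1 := hNN y
      rw [LinearMap.mem_ker.1 hx] at h1
      exact (smul_eq_zero.1 h1.symm).resolve_left (neg_ne_zero.2 h2)
    have h3 : ∀ x, N x = (-2 : F) • x := fun x =>
      LinearMap.ker_eq_bot.1 hinj (by rw [hNN, map_smul])
    have h4 : (A : Matrix α α F) - 1 = (-2 : F) • 1 := by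
      apply Matrix.toLin'.injective
      rw [← hN, map_smul, Matrix.toLin'_one]
      exact LinearMap.ext h3
    have h5 : (A : Matrix α α F) = -1 := by
      rw [sub_eq_iff_eq_add.1 h4, neg_smul, two_smul]
      abel
    have h6 := A.det_coe
    rw [h5, det_neg, hα.neg_one_pow, det_one, mul_one] at h6
    apply h2
    rw [← one_add_one_eq_two]
    nth_rewrite 1 [← h6]
    ring

lemma rank_sub_one_lt (hα : Odd (Fintype.card α)) {A : SpecialLinearGroup α F} (hA : A ^ 2 = 1) :
    ((A : Matrix α α F) - 1).rank < Fintype.card α := by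
  refine lt_of_le_of_ne (rank_le_card_width _) fun h => not_ker_le_range hα hA ?_
  have h1 : LinearMap.range (Matrix.toLin' ((A : Matrix α α F) - 1)) = ⊤ :=
    Submodule.eq_top_of_finrank_eq (by rw [finrank_fintype_fun_eq_card, ← h]; rfl)
  rw [h1]
  exact le_top

/-- Involutions of a special linear group of odd dimension are classified by the rank of
`A - 1`. -/
lemma exists_conj_of_rank_eq (hα : Odd (Fintype.card α)) {A B : SpecialLinearGroup α F}
    (hA : A ^ 2 = 1) (hB : B ^ 2 = 1)
    (h : ((A : Matrix α α F) - 1).rank = ((B : Matrix α α F) - 1).rank) :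
    ∃ P : SpecialLinearGroup α F, P * A * P⁻¹ = B := by
  have hsq : ∀ {A : SpecialLinearGroup α F}, A ^ 2 = 1 → ∀ x,
      Matrix.toLin' ((A : Matrix α α F) - 1) (Matrix.toLin' ((A : Matrix α α F) - 1) x) =
        (-2 : F) • Matrix.toLin' ((A : Matrix α α F) - 1) x := by
    intro A hA x
    rw [← LinearMap.comp_apply, ← Matrix.toLin'_mul, sub_one_mul_sub_one hA, map_smul]
    rfl
  have h' : finrank F (LinearMap.range (Matrix.toLin' ((A : Matrix α α F) - 1))) =
      finrank F (LinearMap.range (Matrix.toLin' ((B : Matrix α α F) - 1))) := h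
  obtain ⟨T, hT, hTd⟩ := exists_linearEquiv_of_sq_eq_smul_of_det (hsq hA) (hsq hB) h'
    (not_ker_le_range hα hA)
  obtain ⟨P, hP⟩ : ∃ P, P = LinearMap.toMatrix' T := ⟨_, rfl⟩
  have hPd : P.det = 1 := by rw [hP, LinearMap.det_toMatrix', hTd]
  have hcomm : P * ((A : Matrix α α F) - 1) = ((B : Matrix α α F) - 1) * P := by
    apply Matrix.toLin'.injective
    rw [Matrix.toLin'_mul, Matrix.toLin'_mul, hP, Matrix.toLin'_toMatrix']
    refine LinearMap.ext fun x => ?_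
    exact hT x
  rw [Matrix.mul_sub, Matrix.sub_mul, Matrix.mul_one, Matrix.one_mul, sub_left_inj] at hcomm
  obtain ⟨X, hX⟩ : ∃ X : SpecialLinearGroup α F, (X : Matrix α α F) = P := ⟨⟨P, hPd⟩, rfl⟩
  refine ⟨X, ?_⟩
  rw [mul_inv_eq_iff_eq_mul]
  exact Subtype.ext (by rw [coe_mul, coe_mul, hX, hcomm])

end Matrix.SpecialLinearGroup

end ConjugateInvolutions

section OuterAutomorphisms

open Matrix

namespace Matrix.SpecialLinearGroup

variable {F : Type*} [Field F] {Q : Type*} [Group Q]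

lemma exists_sq_eq_one_three : ∃ S : SpecialLinearGroup (Fin 3) F, S ^ 2 = 1 ∧
    ∀ c, (S : Matrix (Fin 3) (Fin 3) F) ≠ scalar _ c := by
  by_cases h2 : (2 : F) = 0
  · have h11 : (1 : F) + 1 = 0 := by rw [one_add_one_eq_two, h2]
    refine ⟨⟨!![1, 0, 0; 0, 1, 1; 0, 0, 1], by simp [det_fin_three]⟩, Subtype.ext ?_, ?_⟩
    · change !![1, 0, 0; 0, 1, 1; 0, 0, 1] ^ 2 = 1
      rw [pow_two]
      ext i j
      fin_cases i <;> fin_cases j <;> simp [Matrix.mul_apply, Fin.sum_univ_three, h11]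
    · intro c hc
      have := congrFun (congrFun hc 1) 2
      simp [scalar_apply] at this
  · refine ⟨⟨diagonal ![1, -1, -1], by simp [det_diagonal, Fin.prod_univ_three]⟩,
      Subtype.ext ?_, ?_⟩
    · change diagonal ![1, -1, -1] ^ 2 = 1
      rw [diagonal_pow, ← diagonal_one]
      congr 1
      ext i
      fin_cases i <;> simp
    · intro c hc
      have h0 := congrFun (congrFun hc 0) 0
      have h1 := congrFun (congrFun hc 1) 1
      simp [scalar_apply] at h0 h1
      apply h2
      rw [← one_add_one_eq_two]
      nth_rewrite 1 [h0]
      rw [← h1]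
      ring

lemma kerScalar_rangeRestrict {α : Type*} [Fintype α] [DecidableEq α]
    {Φ : SpecialLinearGroup α F →* Q} (hΦ : KerScalar Φ) : KerScalar Φ.rangeRestrict :=
  fun g hg => hΦ g (congrArg Subtype.val hg)

lemma exists_orderOf_eq_two_mem_range {m : ℕ} (hm : 3 ≤ m)
    {Φ : SpecialLinearGroup (Fin m) F →* Q} (hΦ : KerScalar Φ) : ∃ t ∈ Φ.range, orderOf t = 2 := by
  obtain ⟨Ψ, hΨ⟩ := exists_kerScalar_three hm (kerScalar_rangeRestrict hΦ)
  obtain ⟨S, hS, hS1⟩ := exists_sq_eq_one_three (F := F)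
  refine ⟨_, (Ψ S).2, ?_⟩
  rw [Subgroup.orderOf_coe]
  refine orderOf_eq_prime (by rw [← map_pow, hS, map_one]) fun h => ?_
  obtain ⟨c, hc⟩ := hΨ S h
  exact hS1 c hc

/-- Involutions lift to involutions, since the center of `SL m F` has odd order. -/
lemma exists_sq_eq_one_lift {m : ℕ} (hmo : Odd m) {Φ : SpecialLinearGroup (Fin m) F →* Q}
    (hΦ : KerScalar Φ) {t : Q} (ht : t ∈ Φ.range) (ht2 : t ^ 2 = 1) :
    ∃ A : SpecialLinearGroup (Fin m) F, A ^ 2 = 1 ∧ Φ A = t := by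
  obtain ⟨B, rfl⟩ := ht
  obtain ⟨c, hc⟩ := hΦ (B ^ 2) (by rw [map_pow, ht2])
  have hcm : c ^ m = 1 := by
    have h := (B ^ 2).det_coe
    rwa [hc, scalar_apply, det_diagonal, Finset.prod_const, Finset.card_univ, Fintype.card_fin] at h
  refine ⟨B ^ m, ?_, ?_⟩
  · apply Subtype.ext
    rw [← pow_mul, mul_comm, pow_mul, coe_pow, hc, ← map_pow, hcm, map_one, coe_one]
  · have h : ∀ x : Q, x ^ 2 = 1 → x ^ m = x := by
      intro x hx
      obtain ⟨j, hj⟩ := hmo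
      rw [hj, pow_succ, pow_mul, hx, one_pow, one_mul]
    rw [map_pow, h _ ht2]

lemma not_dvd_card_quotient_range [Finite Q] {m : ℕ} (hm : 3 ≤ m) (hmo : Odd m)
    {Φ : SpecialLinearGroup (Fin m) F →* Q} (hΦ : KerScalar Φ) [Φ.range.Normal] {r : ℕ}
    (hr : r.Prime) (hr2 : r ≠ 2) (hno : ∀ g : Q, orderOf g ≠ 2 * r) (hmr : m - 1 < r) :
    ¬ r ∣ Nat.card (Q ⧸ Φ.range) := by
  classical
  have hcard : Fintype.card (Fin m) = m := Fintype.card_fin m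
  have hlift : ∀ t : Q, ∃ A : SpecialLinearGroup (Fin m) F,
      t ∈ Φ.range → orderOf t = 2 → A ^ 2 = 1 ∧ Φ A = t := by
    intro t
    by_cases h : t ∈ Φ.range ∧ orderOf t = 2
    · obtain ⟨A, hA⟩ := exists_sq_eq_one_lift hmo hΦ h.1 (h.2 ▸ pow_orderOf_eq_one t)
      exact ⟨A, fun _ _ => hA⟩
    · exact ⟨1, fun h1 h2 => (h ⟨h1, h2⟩).elim⟩
  choose A hA using hlift
  have hrank : ∀ t ∈ Φ.range, orderOf t = 2 →
      0 < ((A t : Matrix (Fin m) (Fin m) F) - 1).rank := by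
    intro t ht ht2
    refine Nat.pos_of_ne_zero fun h => ?_
    have h0 : (A t : Matrix (Fin m) (Fin m) F) - 1 = 0 :=
      Matrix.toLin'.map_eq_zero_iff.1 (LinearMap.range_eq_bot.1 (Submodule.finrank_eq_zero.1 h))
    have h1 : A t = 1 := Subtype.ext (sub_eq_zero.1 h0)
    rw [← (hA t ht ht2).2, h1, map_one, orderOf_one] at ht2
    omega
  obtain ⟨t, ht, ht2⟩ := exists_orderOf_eq_two_mem_range hm hΦ
  refine not_dvd_index_of_involution_classes hr hr2 hno
    (fun t => ((A t : Matrix (Fin m) (Fin m) F) - 1).rank - 1) hmr ?_ ?_ ht ht2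
  · intro t ht ht2
    have h1 := rank_sub_one_lt (hcard.symm ▸ hmo) (hA t ht ht2).1
    rw [hcard] at h1
    have h2 := hrank t ht ht2
    change _ - 1 < _
    omega
  · intro t ht t' ht' ht2 ht2' h
    obtain ⟨P, hP⟩ := exists_conj_of_rank_eq (hcard.symm ▸ hmo) (hA t ht ht2).1
      (hA t' ht' ht2').1 (by
        have h1 := hrank t ht ht2
        have h2 := hrank t' ht' ht2'
        omega)
    refine ⟨Φ P, ⟨P, rfl⟩, ?_⟩
    rw [← (hA t ht ht2).2, ← (hA t' ht' ht2').2, ← map_inv, ← map_mul, ← map_mul, hP]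

end Matrix.SpecialLinearGroup

end OuterAutomorphisms

section LiftToQuotient

lemma exists_hom_of_conj_range_le {Q S : Type*} [Group Q] [Group S] {ι : Q →* MulAut S}
    (hι : Function.Injective ι) (hInn : (MulAut.conj (G := S)).range ≤ ι.range) :
    ∃ Φ : S →* Q, (∀ s, ι (Φ s) = MulAut.conj s) ∧ Φ.range.Normal := by
  have hmem : ∀ s : S, MulAut.conj s ∈ ι.range := fun s => hInn ⟨s, rfl⟩
  have hΦ : ∀ s, ι ((MonoidHom.ofInjective hι).symm ⟨MulAut.conj s, hmem s⟩) = MulAut.conj s := by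
    intro s
    have h := (MonoidHom.ofInjective hι).apply_symm_apply ⟨MulAut.conj s, hmem s⟩
    exact congrArg Subtype.val h
  refine ⟨(MonoidHom.ofInjective hι).symm.toMonoidHom.comp
    ((MulAut.conj (G := S)).codRestrict ι.range hmem), hΦ, ⟨?_⟩⟩
  rintro _ ⟨s, rfl⟩ h
  refine ⟨ι h s, hι ?_⟩
  refine (hΦ _).trans ?_
  rw [map_mul, map_mul, map_inv]
  refine Eq.trans ?_ (congrArg (fun t => ι h * t * (ι h)⁻¹) (hΦ s)).symm
  ext x
  simp

open Matrix in
lemma Matrix.SpecialLinearGroup.exists_kerScalar_of_conj_range_le {Q F : Type*} [Group Q] [Field F]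
    {m : ℕ} {ι : Q →* MulAut (PSL m F)} (hι : Function.Injective ι)
    (hInn : (MulAut.conj (G := PSL m F)).range ≤ ι.range) :
    ∃ Φ : SpecialLinearGroup (Fin m) F →* Q, KerScalar Φ ∧ Φ.range.Normal := by
  obtain ⟨Φ, hΦ, hN⟩ := exists_hom_of_conj_range_le hι hInn
  refine ⟨Φ.comp (QuotientGroup.mk' _), fun g hg => ?_, ?_⟩
  · apply exists_eq_scalar_of_conj_eq_one
    rw [← hΦ]
    exact (congrArg ι hg).trans (map_one ι)
  · rwa [← MonoidHom.map_range, MonoidHom.range_eq_top.2 (QuotientGroup.mk'_surjective _),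
      ← MonoidHom.range_eq_map]

end LiftToQuotient

section Counting

open Matrix

lemma exists_mem_orderOf_eq_of_coprime {G : Type*} [Group G] [Finite G] {K : Subgroup G} [K.Normal]
    {S : Subgroup (G ⧸ K)} [S.Normal] {N : ℕ} (hK : N.Coprime (Nat.card K))
    (hS : N.Coprime (Nat.card ((G ⧸ K) ⧸ S))) {g : G} (hg : orderOf g = N) :
    ∃ x ∈ S, orderOf x = N := by
  have h1 : orderOf (QuotientGroup.mk' K g) ∣ N := hg ▸ orderOf_map_dvd _ g
  refine ⟨QuotientGroup.mk' K g, ?_, Nat.dvd_antisymm h1 (hK.dvd_of_dvd_mul_right ?_)⟩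
  · rw [← QuotientGroup.eq_one_iff, ← QuotientGroup.mk'_apply, ← orderOf_eq_one_iff]
    exact Nat.eq_one_of_dvd_coprimes hS ((orderOf_map_dvd _ _).trans h1) (orderOf_dvd_natCard _)
  · rw [← hg]
    apply orderOf_dvd_of_pow_eq_one
    have h2 : g ^ orderOf (QuotientGroup.mk' K g) ∈ K := by
      rw [← QuotientGroup.eq_one_iff, ← QuotientGroup.mk'_apply, map_pow, pow_orderOf_eq_one]
    rw [pow_mul]
    exact congrArg Subtype.val (pow_card_eq_one' (x := (⟨_, h2⟩ : K)))

lemma pow_dvd_pow_sub_one_of_dvd_prod {U m r a : ℕ} (hm : 3 ≤ m) (hr : r.Prime) (hrU : ¬ r ∣ U)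
    (hU : U ≠ 0) (ha : a ≠ 0) (he : m - 1 ≤ orderOf (U : ZMod r))
    (h : r ^ a ∣ ∏ i : Fin m, (U ^ m - U ^ (i : ℕ))) :
    orderOf (U : ZMod r) ≤ m ∧ r ^ a ∣ U ^ orderOf (U : ZMod r) - 1 := by
  set e := orderOf (U : ZMod r) with he'
  have hfac : ∀ i : Fin m, U ^ m - U ^ (i : ℕ) = U ^ (i : ℕ) * (U ^ (m - i) - 1) := by
    intro i
    rw [Nat.mul_sub, mul_one, ← pow_add, Nat.add_sub_of_le i.2.le]
  have hdvd : ∀ i : Fin m, r ∣ U ^ m - U ^ (i : ℕ) → m - i = e := by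
    intro i hi
    rw [hfac, hr.dvd_mul] at hi
    have h1 := hi.resolve_left fun h => hrU (hr.dvd_of_dvd_pow h)
    rw [dvd_pow_sub_one_iff hU] at h1
    obtain ⟨c, hc⟩ := orderOf_dvd_of_pow_eq_one h1
    rw [← he'] at hc
    have hi := i.2
    rcases c with _ | _ | c
    · omega
    · omega
    · have : e * (c + 1 + 1) = e * c + 2 * e := by ring
      have : 0 ≤ e * c := Nat.zero_le _
      omega
  obtain ⟨i, -, hi⟩ := (hr.prime.dvd_finsetProd_iff _).1 ((dvd_pow_self r ha).trans h)
  have hie := hdvd i hi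
  refine ⟨by omega, ?_⟩
  rw [← Finset.mul_prod_erase _ _ (Finset.mem_univ i)] at h
  have hco : (r ^ a).Coprime (∏ j ∈ Finset.univ.erase i, (U ^ m - U ^ (j : ℕ))) := by
    refine Nat.Coprime.pow_left _ (Nat.Coprime.prod_right fun j hj => ?_)
    rw [hr.coprime_iff_not_dvd]
    intro hj'
    have := hdvd j hj'
    have hi := i.2
    have hj2 := j.2
    exact Finset.ne_of_mem_erase hj (Fin.ext (by omega))
  have h1 := hco.dvd_of_dvd_mul_right h
  rw [hfac, hie] at h1
  exact (Nat.Coprime.pow _ _ ((hr.coprime_iff_not_dvd).2 hrU)).dvd_of_dvd_mul_left h1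

namespace Matrix.SpecialLinearGroup

variable {F : Type*} [Field F] [Fintype F] {Q : Type*} [Group Q]

lemma orderOf_dvd_prod {m : ℕ} {Φ : SpecialLinearGroup (Fin m) F →* Q} {x : Q} (hx : x ∈ Φ.range) :
    orderOf x ∣ ∏ i : Fin m, (Fintype.card F ^ m - Fintype.card F ^ (i : ℕ)) := by
  obtain ⟨y, rfl⟩ := hx
  rw [← Matrix.card_GL_field]
  refine (orderOf_map_dvd Φ y).trans ?_
  rw [← orderOf_injective (toGL (n := Fin m) (R := F)) toGL_injective]
  exact orderOf_dvd_natCard _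

lemma not_dvd_card_field_of_no_orderOf [Finite Q] {m : ℕ} (hm : 3 ≤ m)
    {Φ : SpecialLinearGroup (Fin m) F →* Q} (hΦ : KerScalar Φ) {r : ℕ} (hr : r.Prime) (hr2 : r ≠ 2)
    (hno : ∀ g : Q, orderOf g ≠ 2 * r) : ¬ r ∣ Fintype.card F := by
  intro h
  obtain ⟨p, hp⟩ := CharP.exists F
  obtain ⟨l, hpp, hc⟩ := FiniteField.card F p
  rw [hc] at h
  obtain rfl := (Nat.prime_dvd_prime_iff_eq hr hpp).1 (hr.dvd_of_dvd_pow h)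
  exact not_charP_of_no_orderOf hm hΦ hr hr2 hno hp

lemma le_orderOf_of_no_orderOf [Finite Q] {m : ℕ} (hm : 3 ≤ m) (hmo : Odd m)
    {Φ : SpecialLinearGroup (Fin m) F →* Q} (hΦ : KerScalar Φ) {r : ℕ} (hr : r.Prime) (hr2 : r ≠ 2)
    (hr3 : r ≠ 3) (hno : ∀ g : Q, orderOf g ≠ 2 * r) :
    m - 1 ≤ orderOf (Fintype.card F : ZMod r) := by
  have := Fact.mk hr
  have hU := not_dvd_card_field_of_no_orderOf hm hΦ hr hr2 hno
  have h0 : (Fintype.card F : ZMod r) ≠ 0 := by rwa [Ne, ZMod.natCast_eq_zero_iff]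
  have hpos : 0 < orderOf (Fintype.card F : ZMod r) := by
    rw [orderOf_pos_iff]
    exact Units.isOfFinOrder_val.2 (isOfFinOrder_of_finite (Units.mk0 _ h0))
  by_contra! hlt
  exact not_dvd_pow_sub_one_of_no_orderOf hm hmo hΦ hr hr2 hr3 hno hpos (by omega)
    ((dvd_pow_sub_one_iff Fintype.card_ne_zero).2 (pow_orderOf_eq_one _))

end Matrix.SpecialLinearGroup

end Counting

section Torus

open Matrix

namespace Matrix.SpecialLinearGroup

variable {F : Type*} [Field F] [Fintype F] {Q : Type*} [Group Q]

lemma exists_dvd_orderOf_mul_gcd {d m : ℕ} (hd : d ≠ 0) (hm : d + 1 = m)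
    {Φ : SpecialLinearGroup (Fin m) F →* Q} (hΦ : KerScalar Φ) :
    ∃ t : Q, Fintype.card F ^ d - 1 ∣ orderOf t * m.gcd (Fintype.card F - 1) := by
  obtain ⟨p, hp⟩ := CharP.exists F
  have := Fact.mk (CharP.char_is_prime F p)
  have := NeZero.mk hd
  let E := FiniteField.Extension F p d
  have := Fintype.ofFinite E
  have hc : Fintype.card E = Fintype.card F ^ d := by
    rw [Fintype.card_eq_nat_card, FiniteField.natCard_extension, Nat.card_eq_fintype_card]
  let b : Module.Basis (Fin d) F E :=
    Module.finBasisOfFinrankEq F E (FiniteField.finrank_extension F p d)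
  obtain ⟨γ, hγ⟩ := IsCyclic.exists_ofOrder_eq_natCard (α := Eˣ)
  rw [Nat.card_units, Nat.card_eq_fintype_card, hc] at hγ
  obtain ⟨Ψ, hΨ, -⟩ := exists_kerScalar_restrict hm hΦ
  let f : Eˣ →* GL (Fin d) F := Units.map (Algebra.leftMulMatrix b : E →* Matrix (Fin d) (Fin d) F)
  refine ⟨Ψ (detHom (f γ)), ?_⟩
  set j := orderOf (Ψ (detHom (f γ))) with hj
  obtain ⟨c, hcj⟩ := hΨ (detHom (f (γ ^ j))) (by
    rw [map_pow, map_pow, map_pow, hj, pow_orderOf_eq_one])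
  rw [coe_detHom, ← fromBlocks_toBlocks (scalar (Fin d ⊕ Fin 1) c), fromBlocks_inj] at hcj
  obtain ⟨h1, -, -, h2⟩ := hcj
  have h1' : (f (γ ^ j) : Matrix (Fin d) (Fin d) F) = scalar _ c := by
    rw [h1]
    ext i k
    simp [toBlocks₁₁, scalar_apply, diagonal_apply]
  have h2' : ((GeneralLinearGroup.det (f (γ ^ j))⁻¹ : Fˣ) : F) = c := by
    have h := congrFun (congrFun h2 0) 0
    simpa [toBlocks₂₂, scalar_apply] using h
  have hcm : c ^ m = 1 := by
    have h := congrArg Matrix.det h1'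
    rw [← GeneralLinearGroup.val_det_apply, scalar_apply, det_diagonal, Finset.prod_const,
      Finset.card_univ, Fintype.card_fin] at h
    rw [← hm, pow_succ, ← h, ← h2', map_inv, ← Units.val_mul, mul_inv_cancel, Units.val_one]
  have hγc : ((γ ^ j : Eˣ) : E) = algebraMap F E c := by
    apply Algebra.leftMulMatrix_injective b
    rw [AlgHom.commutes]
    exact h1'
  have hc0 : c ≠ 0 := by
    rintro rfl
    rw [zero_pow (by omega)] at hcm
    exact zero_ne_one hcm
  have hcg := pow_gcd_eq_one.2 ⟨hcm, FiniteField.pow_card_sub_one_eq_one c hc0⟩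
  rw [← hγ]
  apply orderOf_dvd_of_pow_eq_one
  apply Units.ext
  rw [pow_mul, Units.val_pow_eq_pow_val, hγc, ← map_pow, hcg, map_one, Units.val_one]

/-- Elements whose order is a product of primitive prime divisors of `|F| ^ m - 1` and
`|F| ^ (m - 1) - 1` do not exist. -/
lemma orderOf_ne_mul_of_orderOf_eq {m : ℕ} (hm : 3 ≤ m) {Φ : SpecialLinearGroup (Fin m) F →* Q}
    (hΦ : KerScalar Φ) {r s : ℕ} (hr : r.Prime) (hs : s.Prime)
    (hro : orderOf (Fintype.card F : ZMod r) = m - 1) (hso : orderOf (Fintype.card F : ZMod s) = m)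
    {t : Q} (ht : t ∈ Φ.range) : orderOf t ≠ r * s := by
  intro h
  obtain ⟨x, rfl⟩ := ht
  have hs0 : s ∣ Fintype.card F ^ m - 1 := by
    rw [dvd_pow_sub_one_iff Fintype.card_ne_zero, ← hso, pow_orderOf_eq_one]
  obtain ⟨c, hc⟩ := hΦ (x ^ (r * s)) (by rw [map_pow, ← h, pow_orderOf_eq_one])
  have hcm : c ^ m = 1 := by
    have h1 := (x ^ (r * s)).det_coe
    rwa [hc, scalar_apply, det_diagonal, Finset.prod_const, Finset.card_univ, Fintype.card_fin] at h1
  have hxm : (x ^ (r * m)) ^ s = 1 := by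
    apply Subtype.ext
    rw [← pow_mul, mul_right_comm, pow_mul, coe_pow, hc, ← map_pow, hcm, map_one, coe_one]
  have hx1 : x ^ (r * m) ≠ 1 := by
    intro h1
    have h2 : r * s ∣ r * m := by
      rw [← h]
      exact orderOf_dvd_of_pow_eq_one (by rw [← map_pow, h1, map_one])
    have h3 := Nat.le_of_dvd (by omega) (Nat.dvd_of_mul_dvd_mul_left hr.pos h2)
    have h4 := Nat.le_of_dvd (by have := hs.two_le; omega) (dvd_pred_of_orderOf hs (by omega) hso)
    have := hs.two_le
    omega
  have hxne : (x : Matrix (Fin m) (Fin m) F) ≠ 0 := by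
    have := Fin.pos_iff_nonempty.1 (show 0 < m by omega)
    intro h0
    have h1 := x.det_coe
    rw [h0, det_zero] at h1
    exact zero_ne_one h1
  have key := pow_card_sub_one_of_commute hs (ι := Fin m) (F := F) (by rw [hso, Fintype.card_fin])
    (by rw [Fintype.card_fin]; omega) (x := ((x ^ (r * m) : SpecialLinearGroup (Fin m) F) :
      Matrix (Fin m) (Fin m) F)) (g := x) (by rw [← coe_pow, hxm, coe_one])
    (fun h1 => hx1 (Subtype.ext (by rw [h1, coe_one])))
    (by rw [coe_pow]; exact Commute.self_pow _ _) hxne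
  rw [Fintype.card_fin, ← coe_pow] at key
  have h5 : r ∣ Fintype.card F ^ m - 1 := by
    refine (dvd_mul_right r s).trans (h ▸ ?_)
    exact orderOf_dvd_of_pow_eq_one (by
      rw [← map_pow, show x ^ (Fintype.card F ^ m - 1) = 1 from Subtype.ext (by rw [key, coe_one]),
        map_one])
  rw [dvd_pow_sub_one_iff Fintype.card_ne_zero] at h5
  have h6 := orderOf_dvd_of_pow_eq_one h5
  rw [hro] at h6
  have h7 : m - 1 ∣ 1 := (Nat.dvd_add_right dvd_rfl).1 (by rwa [Nat.sub_add_cancel (by omega)])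
  have := Nat.le_of_dvd one_pos h7
  omega

end Matrix.SpecialLinearGroup

end Torus

section Assembly

open Matrix

section Spectrum

variable {n : ℕ} {F : Type*} [Field F] [Fintype F]

lemma orderOf_dvd_half_of_elementOrders_eq (hn : 0 < n) (hqo : Odd (Fintype.card F)) {G : Type*}
    [Group G] (hspec : elementOrders G = elementOrders (PSp n F)) {r : ℕ} (hr : r.Prime)
    (hr2 : r ≠ 2) (hro : orderOf (Fintype.card F : ZMod r) = 2 * n) {g : G} (hg : r ∣ orderOf g) :
    orderOf g ∣ (Fintype.card F ^ n + 1) / 2 := by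
  have hrF := Fact.mk hr
  obtain ⟨y, hy⟩ : orderOf g ∈ elementOrders (PSp n F) := hspec ▸ ⟨g, rfl⟩
  have h := SymplecticGroup.orderOf_quotient_dvd_of_dvd hr hr2 hqo
    (by rw [hro, Fintype.card_fin, two_mul]) (by rwa [Fintype.card_fin])
    (by rw [Fintype.card_fin]
        exact (dvd_pow_add_one_iff).2 (pow_eq_neg_one_of_orderOf (by omega) hro))
    y (hy ▸ hg)
  rwa [hy, Fintype.card_fin] at h

lemma orderOf_ne_two_mul_of_elementOrders_eq (hn : 0 < n) (hne : Even n)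
    (hqo : Odd (Fintype.card F)) {G : Type*} [Group G]
    (hspec : elementOrders G = elementOrders (PSp n F)) {r : ℕ} (hr : r.Prime) (hr2 : r ≠ 2)
    (hro : orderOf (Fintype.card F : ZMod r) = 2 * n) (g : G) : orderOf g ≠ 2 * r := by
  intro hg
  have h := orderOf_dvd_half_of_elementOrders_eq hn hqo hspec hr hr2 hro (hg ▸ dvd_mul_left r 2)
  exact (Nat.not_even_iff_odd.2 (odd_half_pow_add_one hqo hne))
    (even_iff_two_dvd.2 ((hg ▸ dvd_mul_right 2 r).trans h))

lemma exists_orderOf_of_dvd_half (hn : 0 < n) (hne : Even n) (hqo : Odd (Fintype.card F))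
    {G : Type*} [Group G] (hspec : elementOrders G = elementOrders (PSp n F)) {N : ℕ}
    (hN : N ∣ (Fintype.card F ^ n + 1) / 2) : ∃ g : G, orderOf g = N := by
  have h : N ∈ elementOrders G := hspec ▸ exists_PSp_orderOf hn.ne' le_rfl
    ((odd_half_pow_add_one hqo hne).of_dvd_nat hN)
    (Or.inr (two_mul_half_pow_add_one (n := n) hqo ▸ hN.mul_left 2))
  exact h

end Spectrum

/-- The numerical contradiction excluding a primitive prime divisor of `U ^ (2 * k) - 1`. -/
lemma pow_sub_one_mul_lt {U k κ B g : ℕ} (hk : 0 < k) (hκU : κ ≤ U ^ k + 1) (hB : 5 * B ^ 2 ≤ 4 * κ)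
    (hκ : 73 ≤ κ) (hg1 : g ≤ 2 * k + 1) (hg2 : g ≤ U - 1) : g * B < U ^ k - 1 := by
  by_contra! h
  have hU : 0 < U := Nat.pos_of_ne_zero (by
    rintro rfl
    rw [zero_pow hk.ne'] at hκU
    omega)
  obtain ⟨Y, hY⟩ : ∃ Y, U ^ k = Y + 1 := ⟨U ^ k - 1, by omega⟩
  have hgY : g ^ 2 ≤ Y + 1 := by
    rcases Nat.lt_or_ge 1 k with h1 | h1
    · calc g ^ 2 ≤ U ^ 2 := Nat.pow_le_pow_left (by omega) 2
        _ ≤ U ^ k := Nat.pow_le_pow_right hU h1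
        _ = Y + 1 := hY
    · have : g ≤ 3 := by omega
      calc g ^ 2 ≤ 3 ^ 2 := Nat.pow_le_pow_left this 2
        _ ≤ Y + 1 := by omega
  rw [hY] at h hκU
  have h2 : Y ^ 2 ≤ (g * B) ^ 2 := Nat.pow_le_pow_left h 2
  have h3 : 5 * Y ^ 2 ≤ (Y + 1) * (4 * (Y + 2)) :=
    calc 5 * Y ^ 2 ≤ g ^ 2 * (5 * B ^ 2) := by nlinarith
      _ ≤ (Y + 1) * (4 * (Y + 2)) := Nat.mul_le_mul hgY (by omega)
  nlinarith

theorem kpart_dvd_kpart_of_kerScalar {n : ℕ} (hn1 : 6 ≤ n) (hn2 : n ≤ 16) (hne : Even n)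
    {F : Type*} [Field F] [Fintype F] (hqo : Odd (Fintype.card F)) (hq : 3 ≤ Fintype.card F)
    {G : Type*} [Group G] [Finite G] (hspec : elementOrders G = elementOrders (PSp n F))
    {K : Subgroup G} [K.Normal] {m : ℕ} (hm : 3 ≤ m) (hmo : Odd m) {F' : Type*} [Field F']
    [Fintype F'] (hF' : 3 < Fintype.card F') {Φ : SpecialLinearGroup (Fin m) F' →* G ⧸ K}
    (hΦ : SpecialLinearGroup.KerScalar Φ) [Φ.range.Normal] :
    kpart (2 * n) (Fintype.card F) ∣ kpart m (Fintype.card F') := by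
  have hn0 : 0 < n := by omega
  obtain ⟨B, hκB, hB, hκ⟩ := kpart_bound hqo hq hn1 hn2 hne
  set q := Fintype.card F with hq'
  set U := Fintype.card F' with hU'
  have hU0 : U ≠ 0 := Fintype.card_ne_zero
  have hpow : ∀ r : ℕ, r.Prime → orderOf (q : ZMod r) = 2 * n →
      r ^ (q ^ (2 * n) - 1).factorization r ∣ (q ^ n + 1) / 2 ∧
        (q ^ (2 * n) - 1).factorization r ≠ 0 := by
    intro r hr hro
    refine ⟨pow_factorization_dvd_half hn0.ne' hqo (by omega) hr hro,
      (hr.factorization_pos_of_dvd ?_ ?_).ne'⟩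
    · have := Nat.one_lt_pow (n := 2 * n) (a := q) (by omega) (by omega)
      omega
    · rw [dvd_pow_sub_one_iff (by omega), ← hro, pow_orderOf_eq_one]
  have main : ∀ r : ℕ, r.Prime → orderOf (q : ZMod r) = 2 * n → r ≠ 2 ∧
      ¬ r ∣ Nat.card K ∧ ¬ r ∣ Nat.card ((G ⧸ K) ⧸ Φ.range) ∧ m - 1 ≤ orderOf (U : ZMod r) ∧
      orderOf (U : ZMod r) ≤ m ∧
      r ^ (q ^ (2 * n) - 1).factorization r ∣ U ^ orderOf (U : ZMod r) - 1 := by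
    intro r hr hro
    have hr13 : 2 * n ≤ r - 1 := Nat.le_of_dvd (by have := hr.two_le; omega)
      (dvd_pred_of_orderOf hr (by omega) hro)
    have hr2 : r ≠ 2 := by omega
    have hnoG := orderOf_ne_two_mul_of_elementOrders_eq hn0 hne hqo hspec hr hr2 hro
    have hnoQ : ∀ x : G ⧸ K, orderOf x ≠ 2 * r := by
      intro x hx
      obtain ⟨g, hg⟩ := exists_orderOf_of_surjective (QuotientGroup.mk'_surjective K) x
      exact hnoG g (hg.trans hx)
    have hK := SpecialLinearGroup.not_dvd_card_of_no_orderOf hF' hm hΦ hr hr2 hnoG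
    have he : m - 1 ≤ orderOf (U : ZMod r) :=
      SpecialLinearGroup.le_orderOf_of_no_orderOf hm hmo hΦ hr hr2 (by omega) hnoQ
    have hrU := SpecialLinearGroup.not_dvd_card_field_of_no_orderOf hm hΦ hr hr2 hnoQ
    have her : orderOf (U : ZMod r) ≤ r - 1 := Nat.le_of_dvd (by omega)
      (dvd_pred_of_orderOf hr (n := orderOf (U : ZMod r)) (by omega) rfl)
    have hS := SpecialLinearGroup.not_dvd_card_quotient_range hm hmo hΦ hr hr2 hnoQ (by omega)
    obtain ⟨hp1, hp2⟩ := hpow r hr hro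
    obtain ⟨g, hg⟩ := exists_orderOf_of_dvd_half hn0 hne hqo hspec hp1
    obtain ⟨x, hx, hxo⟩ := exists_mem_orderOf_eq_of_coprime (S := Φ.range)
      (Nat.Coprime.pow_left _ ((hr.coprime_iff_not_dvd).2 hK))
      (Nat.Coprime.pow_left _ ((hr.coprime_iff_not_dvd).2 hS)) hg
    obtain ⟨he1, he2⟩ := pow_dvd_pow_sub_one_of_dvd_prod hm hr hrU hU0 hp2 he
      (hxo ▸ SpecialLinearGroup.orderOf_dvd_prod hx)
    exact ⟨hr2, hK, hS, he, he1, he2⟩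
  refine kpart_dvd_kpart (by omega) (by omega) (by omega) (by omega) fun r hr hro => ?_
  obtain ⟨hr2, hK, hS, he, he1, he2⟩ := main r hr hro
  suffices h : orderOf (U : ZMod r) = m from ⟨h, h ▸ he2⟩
  by_contra hem
  have hem1 : orderOf (U : ZMod r) = m - 1 := by omega
  have hall : ∀ s : ℕ, s.Prime → orderOf (q : ZMod s) = 2 * n →
      orderOf (U : ZMod s) = m - 1 := by
    intro s hs hso
    obtain ⟨hs2, hsK, hsS, hse, hse1, -⟩ := main s hs hso
    by_contra hsm
    have hsm1 : orderOf (U : ZMod s) = m := by omega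
    have hrs : r.Coprime s := (Nat.coprime_primes hr hs).2 (by
      rintro rfl
      omega)
    have hd : ∀ s : ℕ, s.Prime → orderOf (q : ZMod s) = 2 * n → s ∣ (q ^ n + 1) / 2 :=
      fun s hs hso => (dvd_pow_self s (hpow s hs hso).2).trans (hpow s hs hso).1
    obtain ⟨g, hg⟩ := exists_orderOf_of_dvd_half hn0 hne hqo hspec
      (hrs.mul_dvd_of_dvd_of_dvd (hd r hr hro) (hd s hs hso))
    obtain ⟨x, hx, hxo⟩ := exists_mem_orderOf_eq_of_coprime (S := Φ.range)
      (Nat.Coprime.mul_left ((hr.coprime_iff_not_dvd).2 hK) ((hs.coprime_iff_not_dvd).2 hsK))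
      (Nat.Coprime.mul_left ((hr.coprime_iff_not_dvd).2 hS) ((hs.coprime_iff_not_dvd).2 hsS)) hg
    exact SpecialLinearGroup.orderOf_ne_mul_of_orderOf_eq hm hΦ hr hs hem1 hsm1 hx hxo
  obtain ⟨k, hk⟩ := hmo
  have hk0 : 0 < k := by omega
  have hm1 : m - 1 = 2 * k := by omega
  have hfac : U ^ (m - 1) - 1 = (U ^ k + 1) * (U ^ k - 1) := by
    rw [hm1, mul_comm 2 k, pow_mul, ← Nat.sq_sub_sq, one_pow]
  have hκU : kpart (2 * n) q ≤ U ^ k + 1 := by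
    refine Nat.le_of_dvd (Nat.succ_pos _) (kpart_dvd_of_forall fun s hs hso => ?_)
    obtain ⟨-, -, -, -, -, h⟩ := main s hs hso
    rw [hall s hs hso, hfac] at h
    refine (Nat.Coprime.pow_left _ ((hs.coprime_iff_not_dvd).2 fun h1 => ?_)).dvd_of_dvd_mul_right h
    rw [dvd_pow_sub_one_iff hU0] at h1
    have h2 := Nat.le_of_dvd hk0 (orderOf_dvd_of_pow_eq_one h1)
    rw [hall s hs hso] at h2
    omega
  obtain ⟨t, ht⟩ : ∃ t : G ⧸ K, U ^ (m - 1) - 1 ∣ orderOf t * m.gcd (U - 1) :=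
    SpecialLinearGroup.exists_dvd_orderOf_mul_gcd (by omega) (Nat.sub_add_cancel (by omega)) hΦ
  set g := m.gcd (U - 1) with hg
  have hg1 : g ≤ 2 * k + 1 := hk ▸ Nat.gcd_le_left _ (by omega)
  have hg2 : g ≤ U - 1 := Nat.gcd_le_right _ (by omega)
  have hrg : ¬ r ∣ g := by
    intro h
    have h1 : r ∣ U ^ 1 - 1 := by
      rw [pow_one]
      exact h.trans (Nat.gcd_dvd_right _ _)
    rw [dvd_pow_sub_one_iff hU0] at h1
    have h2 := Nat.le_of_dvd one_pos (orderOf_dvd_of_pow_eq_one h1)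
    omega
  have hrt : r ∣ orderOf t := by
    refine (hr.dvd_mul.1 (dvd_trans ?_ ht)).resolve_right hrg
    rw [dvd_pow_sub_one_iff hU0, ← hem1, pow_orderOf_eq_one]
  obtain ⟨x, hx⟩ := exists_orderOf_of_surjective (QuotientGroup.mk'_surjective K) t
  have hxd := orderOf_dvd_half_of_elementOrders_eq hn0 hqo hspec hr hr2 hro (hx ▸ hrt)
  rw [hx, ← hκB] at hxd
  have hle := Nat.le_of_dvd (Nat.mul_pos (hκB ▸ (odd_half_pow_add_one hqo hne).pos)
    (Nat.gcd_pos_of_pos_left _ (by omega))) (ht.trans (Nat.mul_dvd_mul_right hxd g))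
  rw [hfac] at hle
  have hlt := pow_sub_one_mul_lt hk0 hκU hB hκ hg1 hg2
  have h1 : kpart (2 * n) q * B * g ≤ (U ^ k + 1) * (g * B) := by
    rw [mul_assoc, mul_comm B g]
    exact Nat.mul_le_mul_right _ hκU
  exact absurd (hle.trans h1) (not_le.2 (Nat.mul_lt_mul_of_pos_left hlt (Nat.succ_pos (U ^ k))))

end Assembly

/-- Let `L = PSp_{2n}(q)`, `q` a power of an odd prime `p`, `n` even with
`6 ≤ n ≤ 16`. If a finite group `G` with `ω(G) = ω(L)` is not almost simple
with socle `L`, `K` is its solvable radical, and `G/K` embeds into `Aut S`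
above `Inn S` for `S = PSL_m(u)` with `m` odd and `u > 3` a power of a prime
`v ≠ p`, then `k_{2n}(q)` divides `k_m(u)`. -/
theorem kpart_dvd_of_psl_odd_quotient
    (p k q : ℕ) (hp : p.Prime) (hpodd : Odd p) (hk : 0 < k) (hq : q = p ^ k)
    (n : ℕ) (hn1 : 6 ≤ n) (hn2 : n ≤ 16) (hneven : Even n)
    (F : Type) [Field F] [Fintype F] (hF : Fintype.card F = q)
    (G : Type) [Group G] [Finite G]
    (hspec : elementOrders G = elementOrders (PSp n F))
    (hnas : ¬ IsAlmostSimpleWithSocle G (PSp n F))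
    (K : Subgroup G) (hKnorm : K.Normal) (hKsolv : IsSolvable K)
    (hKrad : ∀ K' : Subgroup G, K'.Normal → IsSolvable K' → K' ≤ K)
    (m : ℕ) (hmodd : Odd m)
    (u v l : ℕ) (hv : v.Prime) (hl : 0 < l) (hu : u = v ^ l)
    (hu3 : 3 < u) (hvp : v ≠ p)
    (F' : Type) [Field F'] [Fintype F'] (hF' : Fintype.card F' = u)
    (ι : G ⧸ K →* MulAut (PSL m F')) (hι : Function.Injective ι)
    (hInn : (MulAut.conj (G := PSL m F')).range ≤ ι.range) :
    kpart (2 * n) q ∣ kpart m u := by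
  have hqo : Odd (Fintype.card F) := by rw [hF, hq]; exact hpodd.pow
  have hq3 : 3 ≤ Fintype.card F := by
    have h1 : 1 < Fintype.card F := Fintype.one_lt_card
    obtain ⟨a, ha⟩ := hqo
    omega
  rw [← hF, ← hF']
  rw [← hF'] at hu3
  rcases Nat.lt_or_ge m 3 with hm | hm
  · refine (not_isSolvable_of_elementOrders_eq hn1 hn2 hneven hqo hq3 hspec ?_).elim
    obtain rfl : m = 1 := by
      obtain ⟨a, ha⟩ := hmodd
      omega
    have : Subsingleton (PSL 1 F') :=
      (QuotientGroup.mk'_surjective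
        (Subgroup.center (Matrix.SpecialLinearGroup (Fin 1) F'))).subsingleton
    have : Subsingleton (MulAut (PSL 1 F')) := ⟨fun a b => by ext x; exact Subsingleton.elim _ _⟩
    have := hι.subsingleton
    have hK : K = ⊤ := by rwa [QuotientGroup.subsingleton_iff] at this
    subst hK
    have : Group.IsSolvable (⊤ : Subgroup G) := hKsolv
    exact Group.isSolvable_of_surjective (f := (Subgroup.topEquiv (G := G)).toMonoidHom)
      Subgroup.topEquiv.surjective
  · obtain ⟨Φ, hΦ, hN⟩ :=
      Matrix.SpecialLinearGroup.exists_kerScalar_of_conj_range_le hι hInn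
    exact kpart_dvd_kpart_of_kerScalar hn1 hn2 hneven hqo hq3 hspec hm hmodd hu3 hΦ
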